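/- (Homogeneous Kato–Ponce inequality) Let d ≥ 1, s ≥ 0 and 1 < r < ∞, and suppose 1/r = 1/r₁ + 1/r₂ = 1/r₃ + 1/r₄ with r₂, r₃ ∈ (1,∞) and r₁, r₄ ∈ (1,∞]. Then there is a constant C > 0, independent of f and g, such that for all f, g ∈ 𝒮(ℝ^d): ‖|D|^s(f·g)‖_{L^r} ≤ C ( ‖f‖_{L^{r₁}} ‖|D|^s g‖_{L^{r₂}} + ‖|D|^s f‖_{L^{r₃}} ‖g‖_{L^{r₄}} ). -/

import Mathlib

open MeasureTheory Complex Filter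
open scoped ENNReal RealInnerProductSpace

noncomputable section

/-- `d`-dimensional Euclidean space. -/
abbrev Ed (d : ℕ) := EuclideanSpace ℝ (Fin d)

/-- Fourier transform: `f̂(ξ) = ∫ e^{-i x·ξ} f(x) dx`. -/
def FT (d : ℕ) (f : Ed d → ℂ) (ξ : Ed d) : ℂ :=
  ∫ x, Complex.exp (-Complex.I * (⟪x, ξ⟫ : ℝ)) * f x

/-- Inverse Fourier transform: `(F⁻¹ g)(x) = (2π)^{-d} ∫ e^{i x·ξ} g(ξ) dξ`. -/
def FTinv (d : ℕ) (g : Ed d → ℂ) (x : Ed d) : ℂ :=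
  (((2 * Real.pi) ^ d : ℝ) : ℂ)⁻¹ * ∫ ξ, Complex.exp (Complex.I * (⟪x, ξ⟫ : ℝ)) * g ξ

/-- Bessel-type fractional differentiation `⟨D⟩^s f = F⁻¹((1+|ξ|²)^{s/2} f̂(ξ))`. -/
def besselD (d : ℕ) (s : ℝ) (f : Ed d → ℂ) : Ed d → ℂ :=
  FTinv d fun ξ => (((1 + ‖ξ‖ ^ 2) ^ (s / 2) : ℝ) : ℂ) * FT d f ξ

/-- Riesz-type fractional differentiation `|D|^s f = F⁻¹(|ξ|^s f̂(ξ))`. -/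
def rieszD (d : ℕ) (s : ℝ) (f : Ed d → ℂ) : Ed d → ℂ :=
  FTinv d fun ξ => ((‖ξ‖ ^ s : ℝ) : ℂ) * FT d f ξ

/-- Homogeneous Sobolev seminorm `‖f‖_{Ẇ^{s,r}} = ‖|D|^s f‖_{L^r}`. -/
def sobNorm (d : ℕ) (s : ℝ) (r : ℝ≥0∞) (f : Ed d → ℂ) : ℝ≥0∞ :=
  eLpNorm (rieszD d s f) r volume

/-- Index of the dyadic cube of side `2⁻ⁿ` containing `x`. -/
def dyIdx {d : ℕ} (n : ℤ) (x : Ed d) : Fin d → ℤ := fun i => ⌊(2 : ℝ) ^ n * x i⌋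

/-- The half-open dyadic cube of side `2⁻ⁿ` with index `k`. -/
def dyCube {d : ℕ} (n : ℤ) (k : Fin d → ℤ) : Set (Ed d) := {x | dyIdx n x = k}

lemma dyCube_eq_preimage {d : ℕ} (n : ℤ) (k : Fin d → ℤ) :
    (dyCube n k : Set (Ed d)) = WithLp.ofLp ⁻¹' (Set.univ.pi fun i =>
      Set.Ico ((2 : ℝ) ^ (-n) * k i) ((2 : ℝ) ^ (-n) * (k i + 1))) := by
  ext x
  have h2 : (0 : ℝ) < 2 ^ n := by positivity
  have key : ∀ t y : ℝ, (2 : ℝ) ^ (-n) * t ≤ y ↔ t ≤ 2 ^ n * y := by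
    intro t y
    rw [zpow_neg, inv_mul_le_iff₀ h2]
  simp only [dyCube, dyIdx, Set.mem_ofPred_eq, funext_iff, Set.mem_preimage, Set.mem_pi,
    Set.mem_univ, true_imp_iff, Set.mem_Ico, Int.floor_eq_iff]
  refine forall_congr' fun i => and_congr (key _ _).symm ?_
  rw [← not_le, ← not_le, key]

lemma measurableSet_dyCube {d : ℕ} (n : ℤ) (k : Fin d → ℤ) :
    MeasurableSet (dyCube n k : Set (Ed d)) := by
  rw [dyCube_eq_preimage]
  exact (MeasurableSet.univ_pi fun i => measurableSet_Ico).preimage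
    (PiLp.volume_preserving_ofLp (Fin d)).measurable

lemma volume_dyCube {d : ℕ} (n : ℤ) (k : Fin d → ℤ) :
    volume (dyCube n k : Set (Ed d)) = ENNReal.ofReal ((2 : ℝ) ^ (-n)) ^ d := by
  rw [dyCube_eq_preimage, (PiLp.volume_preserving_ofLp (Fin d)).measure_preimage
    (MeasurableSet.univ_pi fun i => measurableSet_Ico).nullMeasurableSet, Real.volume_pi_Ico]
  have : ∀ i : Fin d, (2 : ℝ) ^ (-n) * (k i + 1) - (2 : ℝ) ^ (-n) * k i = 2 ^ (-n) :=
    fun i => by ring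
  simp only [this, Finset.prod_const, Finset.card_univ, Fintype.card_fin]

lemma dyIdx_eq_of_le {d : ℕ} {m n : ℤ} (hmn : m ≤ n) {x y : Ed d} (h : dyIdx n x = dyIdx n y) :
    dyIdx m x = dyIdx m y := by
  obtain ⟨k, rfl⟩ := Int.le.dest hmn
  funext i
  have key : ∀ t : ℝ, ⌊(2 : ℝ) ^ m * t⌋ = ⌊(2 : ℝ) ^ (m + (k : ℤ)) * t⌋ / ((2 ^ k : ℕ) : ℤ) := by
    intro t
    rw [← Int.floor_div_natCast]
    congr 1
    rw [zpow_add₀ (by norm_num)]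
    push_cast
    rw [zpow_natCast]
    field_simp
  have hi := congrFun h i
  simp only [dyIdx] at hi ⊢
  rw [key, key, hi]

lemma dyCube_subset_of_le {d : ℕ} {m n : ℤ} (hmn : m ≤ n) (x : Ed d) :
    dyCube n (dyIdx n x) ⊆ dyCube m (dyIdx m x) :=
  fun _ hy => dyIdx_eq_of_le hmn hy

lemma norm_sub_le_of_mem_dyCube {d : ℕ} {n : ℤ} {k : Fin d → ℤ} {x y : Ed d}
    (hx : x ∈ dyCube n k) (hy : y ∈ dyCube n k) : ‖x - y‖ ≤ √d * 2 ^ (-n) := by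
  have h2 : (0 : ℝ) < 2 ^ (-n) := by positivity
  rw [dyCube_eq_preimage] at hx hy
  rw [EuclideanSpace.norm_eq]
  have hc : ∀ i, ‖(x - y) i‖ ^ 2 ≤ ((2 : ℝ) ^ (-n)) ^ 2 := by
    intro i
    have h1 := hx i trivial
    have h3 := hy i trivial
    simp only [Set.mem_Ico] at h1 h3
    apply pow_le_pow_left₀ (norm_nonneg _)
    rw [PiLp.sub_apply, Real.norm_eq_abs, abs_le]
    constructor <;> nlinarith [h1.1, h1.2, h3.1, h3.2]
  calc √(∑ i, ‖(x - y) i‖ ^ 2) ≤ √(∑ _i : Fin d, ((2 : ℝ) ^ (-n)) ^ 2) :=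
        Real.sqrt_le_sqrt (Finset.sum_le_sum fun i _ => hc i)
    _ = √d * 2 ^ (-n) := by
        rw [Finset.sum_const, Finset.card_univ, Fintype.card_fin, nsmul_eq_mul,
          Real.sqrt_mul (by positivity), Real.sqrt_sq h2.le]

lemma dyCube_nonempty {d : ℕ} (n : ℤ) (k : Fin d → ℤ) : (dyCube n k : Set (Ed d)).Nonempty := by
  refine ⟨WithLp.toLp 2 fun i => (2 : ℝ) ^ (-n) * k i, ?_⟩
  rw [dyCube_eq_preimage]
  have h2 : (0 : ℝ) < 2 ^ (-n) := by positivity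
  intro i _
  simp only [Set.mem_Ico]
  constructor
  · exact le_rfl
  · nlinarith

/-- Calderón–Zygmund stopping cubes at height `lam`. -/
theorem exists_stopping_cubes {d : ℕ} (hd : 1 ≤ d) (F : Ed d → ℝ≥0∞) (hF : ∫⁻ x, F x ≠ ∞)
    {lam : ℝ≥0∞} (hlam : lam ≠ 0) :
    ∃ S : Set (ℤ × (Fin d → ℤ)),
      S.PairwiseDisjoint (fun q => (dyCube q.1 q.2 : Set (Ed d))) ∧
      (∀ q ∈ S, lam * volume (dyCube q.1 q.2 : Set (Ed d)) ≤ ∫⁻ x in dyCube q.1 q.2, F x) ∧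
      (∀ q ∈ S, ∫⁻ x in dyCube q.1 q.2, F x
        ≤ 2 ^ d * (lam * volume (dyCube q.1 q.2 : Set (Ed d)))) ∧
      (∀ x : Ed d, (∀ q ∈ S, x ∉ (dyCube q.1 q.2 : Set (Ed d))) → ∀ n : ℤ,
        ∫⁻ y in dyCube n (dyIdx n x), F y ≤ lam * volume (dyCube n (dyIdx n x) : Set (Ed d))) := by
  classical
  set bad : ℤ → (Fin d → ℤ) → Prop := fun n k =>
    lam * volume (dyCube n k : Set (Ed d)) < ∫⁻ x in dyCube n k, F x with hbad
  refine ⟨{q | bad q.1 q.2 ∧ ∀ x ∈ (dyCube q.1 q.2 : Set (Ed d)), ∀ m < q.1,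
    ¬ bad m (dyIdx m x)}, ?_, ?_, ?_, ?_⟩
  · rintro ⟨n, k⟩ ⟨h1, h2⟩ ⟨m, l⟩ ⟨h3, h4⟩ hne
    refine Set.disjoint_left.2 fun x hx hy => hne ?_
    simp only at h1 h2 h3 h4 hx hy
    have hx' : dyIdx n x = k := hx
    have hy' : dyIdx m x = l := hy
    rcases lt_trichotomy n m with h | h | h
    · exact absurd (hx' ▸ h1) (h4 x hy n h)
    · subst h
      rw [← hx', ← hy']
    · exact absurd (hy' ▸ h3) (h2 x hx m h)
  · exact fun q hq => hq.1.le
  · rintro ⟨n, k⟩ ⟨h1, h2⟩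
    simp only at h1 h2 ⊢
    obtain ⟨x, hx⟩ := dyCube_nonempty (d := d) n k
    have h3 := h2 x hx (n - 1) (by omega)
    have hx' : dyIdx n x = k := hx
    simp only [hbad, not_lt] at h3
    calc ∫⁻ x in dyCube n k, F x ≤ ∫⁻ y in dyCube (n - 1) (dyIdx (n - 1) x), F y :=
          lintegral_mono_set (hx' ▸ dyCube_subset_of_le (by omega) x)
      _ ≤ _ := h3
      _ = 2 ^ d * (lam * volume (dyCube n k : Set (Ed d))) := by
          rw [volume_dyCube, volume_dyCube]
          have : (2 : ℝ) ^ (-(n - 1)) = 2 * 2 ^ (-n) := by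
            rw [neg_sub, sub_eq_add_neg, zpow_add₀ (by norm_num), zpow_one]
          rw [this, ENNReal.ofReal_mul (by norm_num), mul_pow]
          simp only [ENNReal.ofReal_ofNat]
          ring
  · intro x hx n
    by_contra hcon
    rw [not_le] at hcon
    have hbdd : ∃ b : ℤ, ∀ z : ℤ, bad z (dyIdx z x) → b ≤ z := by
      have hlim : Tendsto (fun N : ℕ => lam * (2 : ℝ≥0∞) ^ N) atTop (nhds (lam * ∞)) :=
        ENNReal.Tendsto.const_mul (ENNReal.tendsto_pow_atTop_nhds_top_iff.2 (by norm_num))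
          (Or.inl (by simp))
      rw [ENNReal.mul_top hlam] at hlim
      obtain ⟨N, hN⟩ := (hlim.eventually (lt_mem_nhds hF.lt_top)).exists
      refine ⟨-N, fun z hz => ?_⟩
      by_contra hlt
      rw [not_le] at hlt
      have h1 : (∫⁻ y in dyCube z (dyIdx z x), F y) ≤ ∫⁻ y, F y := setLIntegral_le_lintegral _ _
      have h2 : (2 : ℝ≥0∞) ^ N ≤ volume (dyCube z (dyIdx z x) : Set (Ed d)) := by
        rw [volume_dyCube]
        have h3 : (2 : ℝ≥0∞) ^ N ≤ ENNReal.ofReal (2 ^ (-z)) := by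
          rw [← ENNReal.ofReal_ofNat, ← ENNReal.ofReal_pow (by norm_num)]
          apply ENNReal.ofReal_le_ofReal
          rw [← zpow_natCast]
          exact zpow_le_zpow_right₀ (by norm_num) (by omega)
        calc (2 : ℝ≥0∞) ^ N ≤ ENNReal.ofReal (2 ^ (-z)) := h3
          _ ≤ _ := le_self_pow₀ (le_trans (one_le_pow₀ (by norm_num)) h3) (by omega)
      have h4 : lam * volume (dyCube z (dyIdx z x) : Set (Ed d)) < lam * 2 ^ N :=
        lt_of_lt_of_le hz (h1.trans hN.le)
      exact absurd h4 (not_lt.2 (by gcongr))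
    obtain ⟨lb, hlb, hmin⟩ := Int.exists_least_of_bdd hbdd ⟨n, hcon⟩
    refine hx (lb, dyIdx lb x) ⟨hlb, fun y hy m hm hb => ?_⟩ rfl
    simp only at hy hm hb
    have : dyIdx m y = dyIdx m x := dyIdx_eq_of_le hm.le hy
    rw [this] at hb
    exact absurd (hmin m hb) (by omega)

theorem exists_cz_cubes {d : ℕ} (hd : 1 ≤ d) {H : Type*} [NormedAddCommGroup H] [NormedSpace ℝ H]
    [CompleteSpace H] {f : Ed d → H} (hfc : Continuous f) (hfi : Integrable f)
    {lam : ℝ} (hlam : 0 < lam) :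
    ∃ (S : Set (ℤ × (Fin d → ℤ))) (g : Ed d → H),
      S.PairwiseDisjoint (fun q => (dyCube q.1 q.2 : Set (Ed d))) ∧
      Integrable g ∧
      (∀ x, ‖g x‖ ≤ 2 ^ d * lam) ∧
      (∀ q ∈ S, ∫ x in dyCube q.1 q.2, (f x - g x) = 0) ∧
      (∀ x, x ∉ ⋃ q : S, (dyCube q.1.1 q.1.2 : Set (Ed d)) → g x = f x ∧ ‖f x‖ ≤ lam) ∧
      ENNReal.ofReal lam * volume (⋃ q : S, (dyCube q.1.1 q.1.2 : Set (Ed d)))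
        ≤ 2 * ∫⁻ x in {x | lam / 2 < ‖f x‖}, ‖f x‖ₑ ∧
      (∀ q ∈ S, ∫⁻ x in dyCube q.1 q.2, ‖f x‖ₑ
        ≤ 2 ^ d * (ENNReal.ofReal lam * volume (dyCube q.1 q.2 : Set (Ed d)))) := by
  classical
  obtain ⟨S, hS1, hS2, hS3, hS4⟩ := exists_stopping_cubes hd (fun x => ‖f x‖ₑ)
    hfi.hasFiniteIntegral.ne (lam := ENNReal.ofReal lam) (by simpa using hlam)
  set Q : ℤ × (Fin d → ℤ) → Set (Ed d) := fun q => dyCube q.1 q.2 with hQ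
  have hQm : ∀ q, MeasurableSet (Q q) := fun q => measurableSet_dyCube _ _
  have hvol0 : ∀ q, volume (Q q) ≠ 0 := fun q => by
    simp only [hQ]; rw [volume_dyCube]; positivity
  have hvolt : ∀ q, volume (Q q) ≠ ∞ := fun q => by
    simp only [hQ]; rw [volume_dyCube]; simp
  set Ω : Set (Ed d) := ⋃ q : S, Q q with hΩ
  have hΩm : MeasurableSet Ω := MeasurableSet.iUnion fun q => hQm _
  have hdisj : Pairwise (Function.onFun Disjoint fun q : S => Q q) := fun a b hab =>
    hS1 a.2 b.2 (fun h => hab (Subtype.ext h))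
  have hvolΩ : ENNReal.ofReal lam * volume Ω ≤ ∫⁻ x in Ω, ‖f x‖ₑ := by
    rw [hΩ, measure_iUnion hdisj (fun q => hQm _), lintegral_iUnion (fun q => hQm _) hdisj,
      ← ENNReal.tsum_mul_left]
    exact ENNReal.tsum_le_tsum fun q => hS2 q q.2
  have hl0 : ENNReal.ofReal lam ≠ 0 := by simpa using hlam
  have hΩfin : volume Ω ≠ ∞ := by
    intro h
    rw [h, ENNReal.mul_top hl0] at hvolΩ
    exact absurd (hvolΩ.trans (setLIntegral_le_lintegral _ _)) (not_le.2 hfi.hasFiniteIntegral)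
  have hoff : ∀ x, x ∉ Ω → ‖f x‖ ≤ lam := by
    intro x hx
    by_contra hcon
    rw [not_le] at hcon
    obtain ⟨l', hl1, hl2⟩ := exists_between hcon
    have hev := (hfc.norm.continuousAt (x := x)).eventually (lt_mem_nhds hl2)
    obtain ⟨δ, hδ, hball⟩ := Metric.eventually_nhds_iff_ball.1 hev
    obtain ⟨n, hn⟩ := exists_pow_lt_of_lt_one (y := (1 / 2 : ℝ)) (x := δ / (√d + 1)) (by positivity)
      (by norm_num)
    have hx' : ∀ q ∈ S, x ∉ (dyCube q.1 q.2 : Set (Ed d)) := by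
      intro q hq hxq
      exact hx (Set.mem_iUnion.2 ⟨⟨q, hq⟩, hxq⟩)
    have h4 := hS4 x hx' n
    have hmono : ENNReal.ofReal l' * volume (dyCube n (dyIdx n x) : Set (Ed d)) ≤
        ∫⁻ y in dyCube n (dyIdx n x), ‖f y‖ₑ := by
      rw [← setLIntegral_const]
      refine setLIntegral_mono' (measurableSet_dyCube _ _) fun y hy => ?_
      have hyb : y ∈ Metric.ball x δ := by
        rw [Metric.mem_ball, dist_eq_norm]
        calc ‖y - x‖ ≤ √d * 2 ^ (-(n : ℤ)) := norm_sub_le_of_mem_dyCube hy rfl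
          _ ≤ (√d + 1) * (1 / 2) ^ n := by
            rw [zpow_neg, zpow_natCast, one_div, inv_pow]
            gcongr
            linarith
          _ < δ := by
            rw [lt_div_iff₀ (by positivity)] at hn
            linarith
      rw [← ofReal_norm]
      exact ENNReal.ofReal_le_ofReal (hball y hyb).le
    have h5 := hmono.trans h4
    rw [ENNReal.mul_le_mul_iff_left (hvol0 (_, _)) (hvolt (_, _)),
      ENNReal.ofReal_le_ofReal_iff hlam.le] at h5
    linarith
  set g : Ed d → H := fun x => if h : ∃ q ∈ S, x ∈ Q q then ⨍ y in Q h.choose, f y else f x with hg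
  have hgQ : ∀ q ∈ S, ∀ x ∈ Q q, g x = ⨍ y in Q q, f y := by
    intro q hq x hx
    have h : ∃ q ∈ S, x ∈ Q q := ⟨q, hq, hx⟩
    have : h.choose = q := by
      by_contra hne
      exact Set.disjoint_left.1 (hS1 h.choose_spec.1 hq hne) h.choose_spec.2 hx
    simp only [hg]
    rw [dif_pos h, this]
  have hgΩ : ∀ x, x ∉ Ω → g x = f x := by
    intro x hx
    simp only [hg]
    rw [dif_neg]
    rintro ⟨q, hq, hxq⟩
    exact hx (Set.mem_iUnion.2 ⟨⟨q, hq⟩, hxq⟩)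
  have hgb : ∀ x, ‖g x‖ ≤ 2 ^ d * lam := by
    intro x
    by_cases hx : x ∈ Ω
    · obtain ⟨⟨q, hq⟩, hxq⟩ := Set.mem_iUnion.1 hx
      rw [hgQ q hq x hxq, setAverage_eq, norm_smul, norm_inv, Real.norm_of_nonneg measureReal_nonneg]
      have hpos : 0 < volume.real (Q q) := ENNReal.toReal_pos (hvol0 q) (hvolt q)
      rw [inv_mul_le_iff₀ hpos]
      have h1 : ‖∫ x in Q q, f x‖ₑ ≤ 2 ^ d * (ENNReal.ofReal lam * volume (Q q)) :=
        (enorm_integral_le_lintegral_enorm _).trans (hS3 q hq)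
      have h2 := ENNReal.toReal_mono (by finiteness [hvolt q]) h1
      simp only [toReal_enorm, ENNReal.toReal_mul, ENNReal.toReal_pow, ENNReal.toReal_ofNat,
        ENNReal.toReal_ofReal hlam.le] at h2
      rw [Measure.real]
      linarith
    · rw [hgΩ x hx]
      calc ‖f x‖ ≤ 1 * lam := by simpa using hoff x hx
        _ ≤ _ := by gcongr; exact one_le_pow₀ (by norm_num)
  have hgm : AEStronglyMeasurable g volume := by
    have : AEStronglyMeasurable g (volume.restrict (Ω ∪ Ωᶜ)) := by
      rw [aestronglyMeasurable_union_iff]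
      constructor
      · rw [hΩ, aestronglyMeasurable_iUnion_iff]
        intro q
        refine (aestronglyMeasurable_const (b := ⨍ y in Q q, f y)).congr ?_
        filter_upwards [ae_restrict_mem (hQm q)] with x hx
        exact (hgQ q q.2 x hx).symm
      · refine hfc.aestronglyMeasurable.congr ?_
        filter_upwards [ae_restrict_mem hΩm.compl] with x hx
        exact (hgΩ x hx).symm
    simpa using this
  have hgi : Integrable g := by
    refine ⟨hgm, ?_⟩
    rw [hasFiniteIntegral_iff_enorm, ← lintegral_add_compl _ hΩm]
    refine ENNReal.add_lt_top.2 ⟨?_, ?_⟩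
    · calc ∫⁻ x in Ω, ‖g x‖ₑ ≤ ∫⁻ _x in Ω, ENNReal.ofReal (2 ^ d * lam) := by
            refine lintegral_mono fun x => ?_
            rw [← ofReal_norm]
            exact ENNReal.ofReal_le_ofReal (hgb x)
        _ < ∞ := by
            rw [setLIntegral_const]
            exact ENNReal.mul_lt_top ENNReal.ofReal_lt_top hΩfin.lt_top
    · calc ∫⁻ x in Ωᶜ, ‖g x‖ₑ = ∫⁻ x in Ωᶜ, ‖f x‖ₑ :=
            setLIntegral_congr_fun hΩm.compl fun x hx => by
              rw [hgΩ x hx]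
        _ < ∞ := (setLIntegral_le_lintegral _ _).trans_lt hfi.hasFiniteIntegral
  refine ⟨S, g, hS1, hgi, hgb, ?_, fun x hx => ⟨hgΩ x hx, hoff x hx⟩, ?_, hS3⟩
  · intro q hq
    rw [integral_sub hfi.integrableOn hgi.integrableOn]
    have : ∫ x in Q q, g x = ∫ _x in Q q, ⨍ y in Q q, f y :=
      setIntegral_congr_fun (hQm q) fun x hx => hgQ q hq x hx
    rw [show (dyCube q.1 q.2 : Set (Ed d)) = Q q from rfl, this, setIntegral_const, setAverage_eq,
      smul_smul, mul_inv_cancel₀, one_smul, sub_self]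
    exact (ENNReal.toReal_pos (hvol0 q) (hvolt q)).ne'
  · have hset : MeasurableSet {x | lam / 2 < ‖f x‖} :=
      (isOpen_lt continuous_const hfc.norm).measurableSet
    set V := ∫⁻ x in {x | lam / 2 < ‖f x‖}, ‖f x‖ₑ with hV
    have h1 : ∫⁻ x in Ω, ‖f x‖ₑ ≤ V + ENNReal.ofReal (lam / 2) * volume Ω := by
      rw [← setLIntegral_const, hV, ← lintegral_indicator hset, ← lintegral_indicator hΩm,
        ← lintegral_indicator hΩm, ← lintegral_add_left]
      · refine lintegral_mono fun x => ?_
        by_cases hx : x ∈ Ω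
        · simp only [Set.indicator_of_mem hx]
          by_cases hx2 : lam / 2 < ‖f x‖
          · rw [Set.indicator_of_mem (by exact hx2)]
            exact le_self_add
          · rw [Set.indicator_of_notMem (by exact hx2), zero_add, ← ofReal_norm]
            exact ENNReal.ofReal_le_ofReal (not_lt.1 hx2)
        · simp [Set.indicator_of_notMem hx]
      · exact (hfc.enorm.measurable).indicator hset
    have h2 : ENNReal.ofReal lam = ENNReal.ofReal (lam / 2) + ENNReal.ofReal (lam / 2) := by
      rw [← ENNReal.ofReal_add (by positivity) (by positivity)]
      ring_nf
    have h3 : ENNReal.ofReal (lam / 2) * volume Ω ≤ V := by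
      have := hvolΩ.trans h1
      rw [h2, add_mul] at this
      exact (ENNReal.add_le_add_iff_right (by finiteness)).1 this
    calc ENNReal.ofReal lam * volume Ω = 2 * (ENNReal.ofReal (lam / 2) * volume Ω) := by
          rw [h2]; ring
      _ ≤ 2 * V := by gcongr

/-- Convolution with an operator-valued kernel. -/
def convOp {d : ℕ} {H₁ H₂ : Type*} [NormedAddCommGroup H₁] [NormedSpace ℂ H₁]
    [NormedAddCommGroup H₂] [NormedSpace ℂ H₂] (K : Ed d → H₁ →L[ℂ] H₂) (f : Ed d → H₁)
    (x : Ed d) : H₂ := ∫ y, K (x - y) (f y)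

/-- Hörmander's regularity condition with constant `A`. -/
def IsHormander {d : ℕ} {G : Type*} [NormedAddCommGroup G] (K : Ed d → G) (A : ℝ≥0∞) : Prop :=
  ∀ (c y : Ed d) (ρ : ℝ), ‖y - c‖ ≤ ρ →
    ∫⁻ x in {x | 2 * ρ ≤ ‖x - c‖}, ‖K (x - y) - K (x - c)‖ₑ ≤ A

section convOp

variable {d : ℕ} {H₁ H₂ : Type*} [NormedAddCommGroup H₁] [NormedSpace ℂ H₁]
    [NormedAddCommGroup H₂] [NormedSpace ℂ H₂]

lemma integrable_convOp_integrand {K : Ed d → H₁ →L[ℂ] H₂} (hK : Continuous K) {M : ℝ}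
    (hKb : ∀ x, ‖K x‖ ≤ M) {f : Ed d → H₁} (hf : Integrable f) (x : Ed d) :
    Integrable (fun y => K (x - y) (f y)) := by
  refine (hf.norm.const_mul M).mono' ?_ (Eventually.of_forall fun y => ?_)
  · exact (ContinuousLinearMap.id ℂ (H₁ →L[ℂ] H₂)).aestronglyMeasurable_comp₂
      (hK.comp (continuous_const.sub continuous_id)).aestronglyMeasurable hf.aestronglyMeasurable
  · exact (ContinuousLinearMap.le_opNorm _ _).trans (by gcongr; exact hKb _)

lemma convOp_add {K : Ed d → H₁ →L[ℂ] H₂} (hK : Continuous K) {M : ℝ}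
    (hKb : ∀ x, ‖K x‖ ≤ M) {f g : Ed d → H₁} (hf : Integrable f) (hg : Integrable g) (x : Ed d) :
    convOp K (fun y => f y + g y) x = convOp K f x + convOp K g x := by
  simp only [convOp, map_add]
  exact integral_add (integrable_convOp_integrand hK hKb hf x)
    (integrable_convOp_integrand hK hKb hg x)

lemma continuous_convOp {K : Ed d → H₁ →L[ℂ] H₂} (hK : Continuous K) {M : ℝ}
    (hKb : ∀ x, ‖K x‖ ≤ M) {f : Ed d → H₁} (hf : Integrable f) : Continuous (convOp K f) := by
  refine continuous_of_dominated (bound := fun y => M * ‖f y‖)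
    (fun x => (integrable_convOp_integrand hK hKb hf x).aestronglyMeasurable)
    (fun x => Eventually.of_forall fun y =>
      (ContinuousLinearMap.le_opNorm _ _).trans (by gcongr; exact hKb _))
    (hf.norm.const_mul M) (Eventually.of_forall fun y => ?_)
  exact (hK.comp (continuous_id.sub continuous_const)).clm_apply continuous_const

/-- The image of the bad part of a Calderón–Zygmund decomposition is integrable away from the
dilated cubes. -/
lemma lintegral_convOp_bad_le [CompleteSpace H₁] [CompleteSpace H₂]
    {K : Ed d → H₁ →L[ℂ] H₂} (hK : Continuous K) {M : ℝ}
    (hKb : ∀ x, ‖K x‖ ≤ M) {A : ℝ≥0∞} (hA : IsHormander K A) {b : Ed d → H₁} (hb : Integrable b)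
    {ι : Type*} [Countable ι] {Q : ι → Set (Ed d)} (hQm : ∀ i, MeasurableSet (Q i))
    (hQd : Pairwise (Function.onFun Disjoint Q)) (hb0 : ∀ x ∉ ⋃ i, Q i, b x = 0)
    (hmean : ∀ i, ∫ x in Q i, b x = 0) (c : ι → Ed d) (ρ : ι → ℝ)
    (hc : ∀ i, ∀ y ∈ Q i, ‖y - c i‖ ≤ ρ i) :
    ∫⁻ x in {x | ∀ i, 2 * ρ i ≤ ‖x - c i‖}, ‖convOp K b x‖ₑ ≤ A * ∫⁻ x in ⋃ i, Q i, ‖b x‖ₑ := by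
  have hpt : ∀ x, ‖convOp K b x‖ₑ ≤
      ∑' i, ∫⁻ y in Q i, ‖K (x - y) - K (x - c i)‖ₑ * ‖b y‖ₑ := by
    intro x
    have hKint := integrable_convOp_integrand hK hKb hb x
    have h1 : convOp K b x = ∑' i, ∫ y in Q i, K (x - y) (b y) := by
      rw [← integral_iUnion hQm hQd hKint.integrableOn, setIntegral_eq_integral_of_forall_compl_eq_zero]
      · rfl
      · intro y hy
        rw [hb0 y hy, map_zero]
    rw [h1]
    refine enorm_tsum_le_tsum_enorm.trans (ENNReal.tsum_le_tsum fun i => ?_)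
    have h2 : ∫ y in Q i, K (x - y) (b y) = ∫ y in Q i, (K (x - y) - K (x - c i)) (b y) := by
      simp only [sub_apply]
      rw [integral_sub hKint.integrableOn ((K (x - c i)).integrable_comp hb).integrableOn,
        ContinuousLinearMap.integral_comp_comm _ hb.integrableOn, hmean i, map_zero, sub_zero]
    rw [h2]
    refine (enorm_integral_le_lintegral_enorm _).trans (lintegral_mono fun y => ?_)
    exact ContinuousLinearMap.le_opENorm _ _
  set W : Set (Ed d) := {x | ∀ i, 2 * ρ i ≤ ‖x - c i‖} with hW
  have hmeas : ∀ i, AEMeasurable (Function.uncurry fun x y => ‖K (x - y) - K (x - c i)‖ₑ * ‖b y‖ₑ)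
      ((volume.restrict W).prod (volume.restrict (Q i))) := by
    intro i
    have h1 : Measurable (fun p : Ed d × Ed d => ‖K (p.1 - p.2) - K (p.1 - c i)‖ₑ) :=
      (((hK.comp (continuous_fst.sub continuous_snd)).sub
        (hK.comp (continuous_fst.sub continuous_const))).enorm).measurable
    have h2 : AEMeasurable (fun p : Ed d × Ed d => ‖b p.2‖ₑ)
        ((volume.restrict W).prod (volume.restrict (Q i))) :=
      AEMeasurable.comp_snd hb.aestronglyMeasurable.enorm.restrict
    exact h1.aemeasurable.mul h2
  calc ∫⁻ x in W, ‖convOp K b x‖ₑ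
      ≤ ∫⁻ x in W, ∑' i, ∫⁻ y in Q i, ‖K (x - y) - K (x - c i)‖ₑ * ‖b y‖ₑ :=
        lintegral_mono fun x => hpt x
    _ = ∑' i, ∫⁻ x in W, ∫⁻ y in Q i, ‖K (x - y) - K (x - c i)‖ₑ * ‖b y‖ₑ :=
        lintegral_tsum fun i => (hmeas i).lintegral_prod_right'
    _ ≤ ∑' i, ∫⁻ y in Q i, A * ‖b y‖ₑ := by
        refine ENNReal.tsum_le_tsum fun i => ?_
        rw [lintegral_lintegral_swap (hmeas i)]
        refine setLIntegral_mono' (hQm i) fun y hy => ?_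
        rw [lintegral_mul_const' _ _ enorm_ne_top]
        gcongr
        refine (lintegral_mono_set fun x hx => ?_).trans (hA (c i) y (ρ i) (hc i y hy))
        exact hx i
    _ = A * ∫⁻ x in ⋃ i, Q i, ‖b x‖ₑ := by
        rw [lintegral_iUnion hQm hQd, ← ENNReal.tsum_mul_left]
        congr 1
        ext i
        rw [lintegral_const_mul'' _ hb.aestronglyMeasurable.enorm.restrict]

/-- Calderón–Zygmund decomposition at height `lam`, adapted to the kernel `K`. -/
theorem exists_calderonZygmund [CompleteSpace H₁] [CompleteSpace H₂] (hd : 1 ≤ d)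
    {K : Ed d → H₁ →L[ℂ] H₂} (hK : Continuous K) {M : ℝ}
    (hKb : ∀ x, ‖K x‖ ≤ M) {A : ℝ≥0∞} (hA : IsHormander K A) {f : Ed d → H₁} (hfc : Continuous f)
    (hfi : Integrable f) {lam : ℝ} (hlam : 0 < lam) :
    ∃ (g b : Ed d → H₁) (v : ℝ≥0∞), (∀ x, f x = g x + b x) ∧ Integrable g ∧ Integrable b ∧
      (∀ x, ‖g x‖ ≤ 2 ^ d * lam) ∧
      ENNReal.ofReal lam * v ≤ 2 * ∫⁻ x in {x | lam / 2 < ‖f x‖}, ‖f x‖ₑ ∧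
      ∫⁻ x, ‖g x‖ₑ ^ 2 ≤ (∫⁻ x in {x | ‖f x‖ ≤ lam}, ‖f x‖ₑ ^ 2) +
        ENNReal.ofReal (2 ^ d * lam) ^ 2 * v ∧
      volume {x | lam ≤ ‖convOp K b x‖} ≤
        (ENNReal.ofReal ((2 * √d) ^ d) * volume (Metric.ball (0 : Ed d) 1) +
          2 * 2 ^ d * A) * v := by
  obtain ⟨S, g, hS, hgi, hgb, hmean, hoff, hv, hQf⟩ := exists_cz_cubes hd hfc hfi hlam
  set Q : S → Set (Ed d) := fun q => dyCube q.1.1 q.1.2 with hQ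
  have hQm : ∀ q, MeasurableSet (Q q) := fun q => measurableSet_dyCube _ _
  have hQd : Pairwise (Function.onFun Disjoint Q) := fun a b hab =>
    hS a.2 b.2 (fun h => hab (Subtype.ext h))
  set Ω := ⋃ q, Q q with hΩ
  have hΩm : MeasurableSet Ω := MeasurableSet.iUnion hQm
  have hl0 : ENNReal.ofReal lam ≠ 0 := by simpa using hlam
  have hpow : ENNReal.ofReal (2 ^ d * lam) = 2 ^ d * ENNReal.ofReal lam := by
    rw [ENNReal.ofReal_mul (by positivity), ENNReal.ofReal_pow (by norm_num)]
    simp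
  have hge : ∀ x, ‖g x‖ₑ ≤ ENNReal.ofReal (2 ^ d * lam) := fun x => by
    rw [← ofReal_norm]
    exact ENNReal.ofReal_le_ofReal (hgb x)
  refine ⟨g, fun x => f x - g x, volume Ω, fun x => (add_sub_cancel _ _).symm, hgi, hfi.sub hgi, hgb, hv, ?_, ?_⟩
  · rw [← lintegral_add_compl _ hΩm, add_comm]
    gcongr ?_ + ?_
    · have hset : MeasurableSet {x | ‖f x‖ ≤ lam} :=
        (isClosed_le hfc.norm continuous_const).measurableSet
      rw [← lintegral_indicator hΩm.compl, ← lintegral_indicator hset]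
      refine lintegral_mono fun x => ?_
      by_cases hx : x ∈ Ω
      · simp [hx]
      · rw [Set.indicator_of_mem (by exact hx), (hoff x hx).1,
          Set.indicator_of_mem (by exact (hoff x hx).2)]
    · rw [← setLIntegral_const]
      exact lintegral_mono fun x => by gcongr; exact hge x
  · set c : S → Ed d := fun q => (dyCube_nonempty (d := d) q.1.1 q.1.2).some with hcdef
    have hcmem : ∀ q, c q ∈ Q q := fun q => (dyCube_nonempty (d := d) q.1.1 q.1.2).some_mem
    set ρ : S → ℝ := fun q => √d * 2 ^ (-q.1.1) with hρ
    have hbad := lintegral_convOp_bad_le hK hKb hA (hfi.sub hgi) hQm hQd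
      (fun x hx => by simp only [Pi.sub_apply]; rw [(hoff x hx).1, sub_self])
      (fun q => hmean q q.2) c ρ
      (fun q y hy => norm_sub_le_of_mem_dyCube hy (hcmem q))
    set W : Set (Ed d) := {x | ∀ i, 2 * ρ i ≤ ‖x - c i‖} with hW
    have hball : volume Wᶜ ≤
        ENNReal.ofReal ((2 * √d) ^ d) * volume (Metric.ball (0 : Ed d) 1) * volume Ω := by
      have hsub : Wᶜ ⊆ ⋃ q, Metric.closedBall (c q) (2 * ρ q) := by
        intro x hx
        simp only [hW, Set.mem_compl_iff, Set.mem_ofPred_eq, not_forall, not_le] at hx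
        obtain ⟨q, hq⟩ := hx
        refine Set.mem_iUnion.2 ⟨q, ?_⟩
        rw [Metric.mem_closedBall, dist_eq_norm]
        exact hq.le
      refine (measure_mono hsub).trans ((measure_iUnion_le _).trans ?_)
      rw [hΩ, measure_iUnion hQd hQm, ← ENNReal.tsum_mul_left]
      refine ENNReal.tsum_le_tsum fun q => le_of_eq ?_
      have h2 : (0 : ℝ) < 2 ^ (-q.1.1) := by positivity
      rw [Measure.addHaar_closedBall _ _ (by simp only [hρ]; positivity)]
      simp only [hQ, hρ]
      rw [volume_dyCube, finrank_euclideanSpace_fin, ← mul_assoc, mul_pow,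
        ENNReal.ofReal_mul (by positivity), ENNReal.ofReal_pow h2.le]
      ring
    have hbint : ∫⁻ x in Ω, ‖(f - g) x‖ₑ ≤ 2 * 2 ^ d * ENNReal.ofReal lam * volume Ω := by
      have h1 : ∫⁻ x in Ω, ‖f x‖ₑ ≤ 2 ^ d * ENNReal.ofReal lam * volume Ω := by
        rw [hΩ, lintegral_iUnion hQm hQd, measure_iUnion hQd hQm, ← ENNReal.tsum_mul_left]
        exact ENNReal.tsum_le_tsum fun q => (hQf q q.2).trans_eq (by rw [mul_assoc])
      have h2 : ∫⁻ x in Ω, ‖g x‖ₑ ≤ 2 ^ d * ENNReal.ofReal lam * volume Ω := by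
        rw [← hpow, ← setLIntegral_const]
        exact lintegral_mono fun x => hge x
      calc ∫⁻ x in Ω, ‖(f - g) x‖ₑ ≤ ∫⁻ x in Ω, (‖f x‖ₑ + ‖g x‖ₑ) :=
            lintegral_mono fun x => enorm_sub_le
        _ = (∫⁻ x in Ω, ‖f x‖ₑ) + ∫⁻ x in Ω, ‖g x‖ₑ :=
            lintegral_add_left hfc.enorm.measurable _
        _ ≤ _ := (add_le_add h1 h2).trans_eq (by ring)
    have hbc : Continuous (convOp K (f - g)) := continuous_convOp hK hKb (hfi.sub hgi)
    have hWm : volume ({x | lam ≤ ‖convOp K (f - g) x‖} ∩ W) ≤ 2 * 2 ^ d * A * volume Ω := by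
      have hWms : MeasurableSet W := by
        simp only [hW, Set.ofPred_forall]
        exact MeasurableSet.iInter fun q => (isClosed_le continuous_const
          (continuous_id.sub continuous_const).norm).measurableSet
      have h3 := mul_meas_ge_le_lintegral₀ (μ := volume.restrict W)
        hbc.enorm.measurable.aemeasurable (ENNReal.ofReal lam)
      have h4 : {x | ENNReal.ofReal lam ≤ ‖convOp K (f - g) x‖ₑ} =
          {x | lam ≤ ‖convOp K (f - g) x‖} := by
        ext x
        simp only [Set.mem_ofPred_eq]
        rw [← ofReal_norm, ENNReal.ofReal_le_ofReal_iff (norm_nonneg _)]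
      rw [Measure.restrict_apply' hWms, h4] at h3
      have h5 : ENNReal.ofReal lam * volume ({x | lam ≤ ‖convOp K (f - g) x‖} ∩ W) ≤
          ENNReal.ofReal lam * (2 * 2 ^ d * A * volume Ω) :=
        (h3.trans hbad).trans ((mul_le_mul_right hbint A).trans_eq (by ring))
      exact (ENNReal.mul_le_mul_iff_right hl0 ENNReal.ofReal_ne_top).1 h5
    calc volume {x | lam ≤ ‖convOp K (f - g) x‖}
        ≤ volume (({x | lam ≤ ‖convOp K (f - g) x‖} ∩ W) ∪ Wᶜ) := by
          refine measure_mono fun x hx => ?_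
          by_cases h : x ∈ W
          · exact Or.inl ⟨hx, h⟩
          · exact Or.inr h
      _ ≤ _ := (measure_union_le _ _).trans ((add_le_add hWm hball).trans_eq (by ring))

end convOp

section distribution

lemma lintegral_Ioo_rpow {q a : ℝ} (hq : -1 < q) (ha : 0 ≤ a) :
    ∫⁻ t in Set.Ioo 0 a, ENNReal.ofReal (t ^ q) = ENNReal.ofReal (a ^ (q + 1) / (q + 1)) := by
  have hi : IntegrableOn (fun t : ℝ => t ^ q) (Set.Ioc 0 a) := by
    rw [← intervalIntegrable_iff_integrableOn_Ioc_of_le ha]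
    exact intervalIntegral.intervalIntegrable_rpow' hq
  rw [restrict_Ioo_eq_restrict_Ioc, ← ofReal_integral_eq_lintegral_ofReal hi,
    ← intervalIntegral.integral_of_le ha, integral_rpow (Or.inl hq),
    Real.zero_rpow (by linarith), sub_zero]
  filter_upwards [ae_restrict_mem measurableSet_Ioc] with t ht
  exact Real.rpow_nonneg ht.1.le _

lemma lintegral_Ici_rpow {q a : ℝ} (hq : q < -1) (ha : 0 < a) :
    ∫⁻ t in Set.Ici a, ENNReal.ofReal (t ^ q) = ENNReal.ofReal (-a ^ (q + 1) / (q + 1)) := by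
  rw [← restrict_Ioi_eq_restrict_Ici, ← ofReal_integral_eq_lintegral_ofReal
    (integrableOn_Ioi_rpow_of_lt hq ha), integral_Ioi_rpow_of_lt hq ha]
  filter_upwards [ae_restrict_mem measurableSet_Ioi] with t ht
  exact Real.rpow_nonneg (ha.trans ht).le _

variable {X : Type*} [MeasurableSpace X] {μ : Measure X}

lemma lintegral_rpow_eq_mul_meas {F : X → ℝ} (hF : Measurable F) (hF0 : ∀ x, 0 ≤ F x)
    {p c : ℝ} (hp : 0 < p) (hc : 0 < c) :
    ∫⁻ x, ENNReal.ofReal (F x ^ p) ∂μ = ENNReal.ofReal (c ^ p * p) *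
      ∫⁻ t in Set.Ioi (0 : ℝ), μ {x | c * t < F x} * ENNReal.ofReal (t ^ (p - 1)) := by
  have h := lintegral_rpow_eq_lintegral_meas_lt_mul μ (f := fun x => F x / c)
    (Eventually.of_forall fun x => div_nonneg (hF0 x) hc.le) (hF.div_const c).aemeasurable hp
  have h2 : ∀ x, ENNReal.ofReal (F x ^ p) =
      ENNReal.ofReal (c ^ p) * ENNReal.ofReal ((F x / c) ^ p) := fun x => by
    rw [← ENNReal.ofReal_mul (by positivity), Real.div_rpow (hF0 x) hc.le,
      mul_div_cancel₀ _ (by positivity)]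
  simp_rw [h2]
  rw [lintegral_const_mul' _ _ ENNReal.ofReal_ne_top, h, ENNReal.ofReal_mul (by positivity),
    mul_assoc]
  simp only [lt_div_iff₀ hc, mul_comm c]

variable [SFinite μ]

lemma lintegral_rpow_mul_setLIntegral_lt {u : X → ℝ} (hu : Measurable u) (hu0 : ∀ x, 0 ≤ u x)
    {p : ℝ} (hp : 1 < p) :
    ∫⁻ t in Set.Ioi (0 : ℝ), ENNReal.ofReal (t ^ (p - 2)) *
        ∫⁻ x in {x | t / 2 < u x}, ENNReal.ofReal (u x) ∂μ =
      ENNReal.ofReal (2 ^ (p - 1) / (p - 1)) * ∫⁻ x, ENNReal.ofReal (u x ^ p) ∂μ := by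
  have hm : Measurable (Function.uncurry fun (t : ℝ) (x : X) =>
      ENNReal.ofReal (t ^ (p - 2)) * ({q : ℝ × X | q.1 / 2 < u q.2}.indicator
        (fun q => ENNReal.ofReal (u q.2)) (t, x))) := by
    refine Measurable.mul (by fun_prop) (Measurable.indicator (by fun_prop) ?_)
    exact measurableSet_lt (by fun_prop) (by fun_prop)
  calc _ = ∫⁻ t in Set.Ioi (0 : ℝ), ∫⁻ x, ENNReal.ofReal (t ^ (p - 2)) *
        ({q : ℝ × X | q.1 / 2 < u q.2}.indicator
        (fun q => ENNReal.ofReal (u q.2)) (t, x)) ∂μ := by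
        refine lintegral_congr fun t => ?_
        rw [lintegral_const_mul' _ _ ENNReal.ofReal_ne_top,
          ← lintegral_indicator (measurableSet_lt measurable_const hu)]
        rfl
    _ = ∫⁻ x, (∫⁻ t in Set.Ioi (0 : ℝ), ENNReal.ofReal (t ^ (p - 2)) *
        ({q : ℝ × X | q.1 / 2 < u q.2}.indicator
        (fun q => ENNReal.ofReal (u q.2)) (t, x))) ∂μ :=
        lintegral_lintegral_swap hm.aemeasurable
    _ = ∫⁻ x, ENNReal.ofReal (2 ^ (p - 1) / (p - 1)) * ENNReal.ofReal (u x ^ p) ∂μ := by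
        refine lintegral_congr fun x => ?_
        have h1 : ∀ t : ℝ, ENNReal.ofReal (t ^ (p - 2)) *
            ({q : ℝ × X | q.1 / 2 < u q.2}.indicator
            (fun q => ENNReal.ofReal (u q.2)) (t, x)) =
            (Set.Iio (2 * u x)).indicator (fun t => ENNReal.ofReal (t ^ (p - 2)) *
              ENNReal.ofReal (u x)) t := fun t => by
          by_cases h : t / 2 < u x
          · rw [Set.indicator_of_mem (by exact h), Set.indicator_of_mem]
            exact Set.mem_Iio.2 (by linarith)
          · rw [Set.indicator_of_notMem (by exact h), Set.indicator_of_notMem, mul_zero]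
            exact fun h' => h (by linarith [Set.mem_Iio.1 h'])
        simp_rw [h1]
        rw [lintegral_indicator measurableSet_Iio, Measure.restrict_restrict measurableSet_Iio,
          lintegral_mul_const' _ _ ENNReal.ofReal_ne_top, Set.inter_comm, Set.Ioi_inter_Iio,
          lintegral_Ioo_rpow (by linarith) (by linarith [hu0 x]),
          ← ENNReal.ofReal_mul (by have := hu0 x; have : 0 < p - 2 + 1 := by linarith
                                   positivity),
          ← ENNReal.ofReal_mul (by have : 0 < p - 1 := by linarith
                                   positivity)]
        congr 1
        rw [Real.mul_rpow (by norm_num) (hu0 x), show p - 2 + 1 = p - 1 by ring]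
        rcases (hu0 x).eq_or_lt with h | h
        · rw [← h, Real.zero_rpow (by linarith : p ≠ 0)]
          simp
        · have : u x ^ p = u x ^ (p - 1) * u x := by
            rw [← Real.rpow_add_one h.ne']; ring_nf
          rw [this]
          ring
    _ = _ := lintegral_const_mul' _ _ ENNReal.ofReal_ne_top

lemma lintegral_rpow_mul_setLIntegral_le {u : X → ℝ} (hu : Measurable u) (hu0 : ∀ x, 0 ≤ u x)
    {p : ℝ} (hp0 : 0 < p) (hp : p < 2) :
    ∫⁻ t in Set.Ioi (0 : ℝ), ENNReal.ofReal (t ^ (p - 3)) *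
        ∫⁻ x in {x | u x ≤ t}, ENNReal.ofReal (u x) ^ 2 ∂μ =
      ENNReal.ofReal (1 / (2 - p)) * ∫⁻ x, ENNReal.ofReal (u x ^ p) ∂μ := by
  have hm : Measurable (Function.uncurry fun (t : ℝ) (x : X) =>
      ENNReal.ofReal (t ^ (p - 3)) * ({q : ℝ × X | u q.2 ≤ q.1}.indicator
        (fun q => ENNReal.ofReal (u q.2) ^ 2) (t, x))) := by
    refine Measurable.mul (by fun_prop) (Measurable.indicator (by fun_prop) ?_)
    exact measurableSet_le (by fun_prop) (by fun_prop)
  calc _ = ∫⁻ t in Set.Ioi (0 : ℝ), ∫⁻ x, ENNReal.ofReal (t ^ (p - 3)) *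
        ({q : ℝ × X | u q.2 ≤ q.1}.indicator
        (fun q => ENNReal.ofReal (u q.2) ^ 2) (t, x)) ∂μ := by
        refine lintegral_congr fun t => ?_
        rw [lintegral_const_mul' _ _ ENNReal.ofReal_ne_top,
          ← lintegral_indicator (measurableSet_le hu measurable_const)]
        rfl
    _ = ∫⁻ x, (∫⁻ t in Set.Ioi (0 : ℝ), ENNReal.ofReal (t ^ (p - 3)) *
        ({q : ℝ × X | u q.2 ≤ q.1}.indicator
        (fun q => ENNReal.ofReal (u q.2) ^ 2) (t, x))) ∂μ :=
        lintegral_lintegral_swap hm.aemeasurable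
    _ = ∫⁻ x, ENNReal.ofReal (1 / (2 - p)) * ENNReal.ofReal (u x ^ p) ∂μ := by
        refine lintegral_congr fun x => ?_
        rcases (hu0 x).eq_or_lt with h0 | h0
        · rw [← h0, Real.zero_rpow hp0.ne']
          have : ∀ t : ℝ, ({q : ℝ × X | u q.2 ≤ q.1}.indicator
            (fun q => ENNReal.ofReal (u q.2) ^ 2) (t, x)) = 0 := fun t => by
            rw [Set.indicator_apply_eq_zero]
            intro _
            simp [← h0]
          simp [this]
        have h1 : ∀ t : ℝ, ENNReal.ofReal (t ^ (p - 3)) *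
            ({q : ℝ × X | u q.2 ≤ q.1}.indicator
            (fun q => ENNReal.ofReal (u q.2) ^ 2) (t, x)) =
            (Set.Ici (u x)).indicator (fun t => ENNReal.ofReal (t ^ (p - 3)) *
              ENNReal.ofReal (u x) ^ 2) t := fun t => by
          by_cases h : u x ≤ t
          · rw [Set.indicator_of_mem (by exact h), Set.indicator_of_mem (by exact h)]
          · rw [Set.indicator_of_notMem (by exact h), Set.indicator_of_notMem (by exact h),
              mul_zero]
        simp_rw [h1]
        rw [lintegral_indicator measurableSet_Ici, Measure.restrict_restrict measurableSet_Ici,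
          show Set.Ici (u x) ∩ Set.Ioi 0 = Set.Ici (u x) from
            Set.inter_eq_left.2 (Set.Ici_subset_Ioi.2 h0),
          lintegral_mul_const' _ _ (ENNReal.pow_ne_top ENNReal.ofReal_ne_top),
          lintegral_Ici_rpow (by linarith) h0, ← ENNReal.ofReal_pow h0.le,
          ← ENNReal.ofReal_mul' (by positivity),
          ← ENNReal.ofReal_mul (by have : 0 < 2 - p := by linarith
                                   positivity)]
        congr 1
        have : u x ^ p = u x ^ (p - 3 + 1) * u x ^ 2 := by
          rw [← Real.rpow_natCast (u x) 2, ← Real.rpow_add h0]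
          congr 1
          push_cast
          ring
        rw [this]
        have h3 : p - 3 + 1 = -(2 - p) := by ring
        rw [h3]
        have : 2 - p ≠ 0 := by linarith
        field_simp
    _ = _ := lintegral_const_mul' _ _ ENNReal.ofReal_ne_top

/-- Marcinkiewicz-type integration of a distributional estimate, with a weak `L¹` part and,
for `p < 2`, a weak `L²` part. -/
lemma lintegral_rpow_le_of_distribution {F u : X → ℝ} (hF : Measurable F) (hF0 : ∀ x, 0 ≤ F x)
    (hu : Measurable u) (hu0 : ∀ x, 0 ≤ u x) {p c : ℝ} (hp : 1 < p) (hc : 0 < c)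
    {C₁ C₂ : ℝ≥0∞} (hC₁ : C₁ ≠ ∞) (hC₂ : C₂ ≠ ∞) (hp2 : p < 2 ∨ C₂ = 0)
    (h : ∀ t : ℝ, 0 < t → μ {x | c * t < F x} ≤
      C₁ * (ENNReal.ofReal t⁻¹ * ∫⁻ x in {x | t / 2 < u x}, ENNReal.ofReal (u x) ∂μ) +
      C₂ * (ENNReal.ofReal (t⁻¹ ^ 2) * ∫⁻ x in {x | u x ≤ t}, ENNReal.ofReal (u x) ^ 2 ∂μ)) :
    ∫⁻ x, ENNReal.ofReal (F x ^ p) ∂μ ≤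
      (ENNReal.ofReal (c ^ p * p) * (C₁ * ENNReal.ofReal (2 ^ (p - 1) / (p - 1)) +
        C₂ * ENNReal.ofReal (1 / (2 - p)))) * ∫⁻ x, ENNReal.ofReal (u x ^ p) ∂μ := by
  rw [lintegral_rpow_eq_mul_meas hF hF0 (by linarith) hc, mul_assoc]
  gcongr
  have key : ∀ t ∈ Set.Ioi (0 : ℝ), μ {x | c * t < F x} * ENNReal.ofReal (t ^ (p - 1)) ≤
      C₁ * (ENNReal.ofReal (t ^ (p - 2)) *
        ∫⁻ x in {x | t / 2 < u x}, ENNReal.ofReal (u x) ∂μ) +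
      C₂ * (ENNReal.ofReal (t ^ (p - 3)) *
        ∫⁻ x in {x | u x ≤ t}, ENNReal.ofReal (u x) ^ 2 ∂μ) := fun t ht => by
    have ht' : 0 < t := ht
    have e1 : ENNReal.ofReal (t ^ (p - 2)) = ENNReal.ofReal t⁻¹ * ENNReal.ofReal (t ^ (p - 1)) := by
      rw [← ENNReal.ofReal_mul (by positivity), ← Real.rpow_neg_one, ← Real.rpow_add ht']
      ring_nf
    have e2 : ENNReal.ofReal (t ^ (p - 3)) =
        ENNReal.ofReal (t⁻¹ ^ 2) * ENNReal.ofReal (t ^ (p - 1)) := by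
      rw [← ENNReal.ofReal_mul (by positivity), ← Real.rpow_natCast, ← Real.rpow_neg_one,
        ← Real.rpow_mul ht'.le, ← Real.rpow_add ht']
      congr 2
      push_cast
      ring
    rw [e1, e2]
    calc _ ≤ _ := mul_le_mul_left (h t ht') _
      _ = _ := by ring
  refine (setLIntegral_mono' measurableSet_Ioi key).trans ?_
  have m1 : Measurable fun t : ℝ => ∫⁻ x in {x | t / 2 < u x}, ENNReal.ofReal (u x) ∂μ := by
    refine Antitone.measurable fun a b hab => lintegral_mono_set fun x hx => ?_
    exact lt_of_le_of_lt (by linarith) (show b / 2 < u x from hx)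
  rw [lintegral_add_left (by fun_prop), lintegral_const_mul' _ _ hC₁,
    lintegral_rpow_mul_setLIntegral_lt hu hu0 hp, add_mul, mul_assoc]
  gcongr
  rw [lintegral_const_mul' _ _ hC₂]
  rcases hp2 with hp2 | hp2
  · rw [lintegral_rpow_mul_setLIntegral_le hu hu0 (by linarith) hp2, mul_assoc]
  · simp [hp2]

end distribution

lemma ofReal_norm_rpow {E : Type*} [NormedAddCommGroup E] (v : E) {p : ℝ} (hp : 0 ≤ p) :
    ENNReal.ofReal (‖v‖ ^ p) = ‖v‖ₑ ^ p := by
  rw [← ENNReal.ofReal_rpow_of_nonneg (norm_nonneg _) hp, ofReal_norm]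

/-- An inequality between integrals of `p`-th powers gives one between `L^p` norms. -/
lemma eLpNorm_le_of_lintegral_rpow_le {X E F : Type*} [MeasurableSpace X] {μ : Measure X}
    [NormedAddCommGroup E] [NormedAddCommGroup F] {f : X → E} {g : X → F} {p : ℝ≥0∞}
    (hp0 : p ≠ 0) (hp : p ≠ ∞) {C : ℝ≥0∞}
    (h : ∫⁻ x, ‖f x‖ₑ ^ p.toReal ∂μ ≤ C * ∫⁻ x, ‖g x‖ₑ ^ p.toReal ∂μ) :
    eLpNorm f p μ ≤ C ^ (1 / p.toReal) * eLpNorm g p μ := by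
  rw [eLpNorm_eq_lintegral_rpow_enorm_toReal hp0 hp, eLpNorm_eq_lintegral_rpow_enorm_toReal hp0 hp,
    ← ENNReal.mul_rpow_of_nonneg _ _ (by positivity)]
  gcongr

/-- The constant of the weak type estimate in a Calderón–Zygmund decomposition. -/
def czConst (d : ℕ) (A : ℝ≥0∞) : ℝ≥0∞ :=
  ENNReal.ofReal ((2 * √d) ^ d) * volume (Metric.ball (0 : Ed d) 1) + 2 * 2 ^ d * A

lemma czConst_ne_top (d : ℕ) {A : ℝ≥0∞} (hA : A ≠ ∞) : czConst d A ≠ ∞ := by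
  refine ENNReal.add_ne_top.2 ⟨ENNReal.mul_ne_top ENNReal.ofReal_ne_top
    measure_ball_lt_top.ne, ENNReal.mul_ne_top ?_ hA⟩
  exact ENNReal.mul_ne_top (by norm_num) (ENNReal.pow_ne_top (by norm_num))

section czLp

variable {d : ℕ} {H₁ H₂ : Type*} [NormedAddCommGroup H₁] [NormedSpace ℂ H₁]
    [NormedAddCommGroup H₂] [NormedSpace ℂ H₂] [CompleteSpace H₁] [CompleteSpace H₂]

/-- Calderón–Zygmund theorem for operators bounded on `L²`. -/
theorem lintegral_convOp_rpow_le_of_L2 (hd : 1 ≤ d) {K : Ed d → H₁ →L[ℂ] H₂}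
    (hK : Continuous K) {M : ℝ} (hKb : ∀ x, ‖K x‖ ≤ M) {A B : ℝ≥0∞} (hA : IsHormander K A)
    (hA' : A ≠ ∞) (hB : B ≠ ∞)
    (hL2 : ∀ (g : Ed d → H₁) (m : ℝ), Integrable g → (∀ x, ‖g x‖ ≤ m) →
      ∫⁻ x, ‖convOp K g x‖ₑ ^ 2 ≤ B * ∫⁻ x, ‖g x‖ₑ ^ 2)
    {p : ℝ} (hp : 1 < p) (hp2 : p < 2) {f : Ed d → H₁} (hfc : Continuous f) (hfi : Integrable f) :
    ∫⁻ x, ‖convOp K f x‖ₑ ^ p ≤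
      (ENNReal.ofReal (2 ^ p * p) * ((B * 2 ^ (2 * d) + czConst d A) * 2 *
        ENNReal.ofReal (2 ^ (p - 1) / (p - 1)) +
        B * ENNReal.ofReal (1 / (2 - p)))) * ∫⁻ x, ‖f x‖ₑ ^ p := by
  have hcf : Continuous (convOp K f) := continuous_convOp hK hKb hfi
  simp only [← ofReal_norm_rpow _ (by linarith : 0 ≤ p)]
  have hC : czConst d A ≠ ∞ := czConst_ne_top d hA'
  refine lintegral_rpow_le_of_distribution hcf.norm.measurable (fun _ => norm_nonneg _)
    hfc.norm.measurable (fun _ => norm_nonneg _) hp (by norm_num) ?_ hB (Or.inl hp2)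
    fun t ht => ?_
  · exact ENNReal.mul_ne_top (ENNReal.add_ne_top.2
      ⟨ENNReal.mul_ne_top hB (ENNReal.pow_ne_top (by norm_num)), hC⟩) (by norm_num)
  obtain ⟨g, b, v, hfgb, hgi, hbi, hgb, hv, hg2, hbv⟩ :=
    exists_calderonZygmund hd hK hKb hA hfc hfi ht
  have ht0 : ENNReal.ofReal t ≠ 0 := by simpa using ht
  have hcg : Continuous (convOp K g) := continuous_convOp hK hKb hgi
  have hsub : {x | 2 * t < ‖convOp K f x‖} ⊆
      {x | t ≤ ‖convOp K g x‖} ∪ {x | t ≤ ‖convOp K b x‖} := by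
    intro x hx
    have h1 : convOp K f x = convOp K g x + convOp K b x := by
      rw [← convOp_add hK hKb hgi hbi]
      congr 1
      exact funext hfgb
    have h2 := norm_add_le (convOp K g x) (convOp K b x)
    rw [← h1] at h2
    have h3 : 2 * t < ‖convOp K f x‖ := hx
    by_cases h : t ≤ ‖convOp K g x‖
    · exact Or.inl h
    · exact Or.inr (show t ≤ _ by linarith)
  have hcheb : ENNReal.ofReal t ^ 2 * volume {x | t ≤ ‖convOp K g x‖} ≤
      ∫⁻ x, ‖convOp K g x‖ₑ ^ 2 := by
    refine le_trans ?_ (mul_meas_ge_le_lintegral₀ (hcg.enorm.measurable.pow_const 2).aemeasurable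
      (ENNReal.ofReal t ^ 2))
    gcongr
    intro hx
    rw [← ofReal_norm]
    gcongr
  have hinv : ENNReal.ofReal t⁻¹ = (ENNReal.ofReal t)⁻¹ := ENNReal.ofReal_inv_of_pos ht
  set a := ENNReal.ofReal t with ha
  have ha' : a ≠ ∞ := ENNReal.ofReal_ne_top
  set I₁ := ∫⁻ x in {x | t / 2 < ‖f x‖}, ENNReal.ofReal ‖f x‖ with hI₁
  set I₂ := ∫⁻ x in {x | ‖f x‖ ≤ t}, ENNReal.ofReal ‖f x‖ ^ 2 with hI₂
  have hv' : v ≤ 2 * (a⁻¹ * I₁) := by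
    rw [hI₁]
    simp only [ofReal_norm]
    rw [mul_left_comm, ← ENNReal.div_eq_inv_mul, ENNReal.le_div_iff_mul_le (Or.inl ht0)
      (Or.inl ha'), mul_comm]
    exact hv
  have hpow : ENNReal.ofReal (2 ^ d * t) ^ 2 = a ^ 2 * 2 ^ (2 * d) := by
    rw [ENNReal.ofReal_mul (by positivity), ENNReal.ofReal_pow (by norm_num)]
    simp
    ring
  have hg : volume {x | t ≤ ‖convOp K g x‖} ≤ B * (a⁻¹ ^ 2 * I₂) + B * 2 ^ (2 * d) * v := by
    have h1 : a ^ 2 * volume {x | t ≤ ‖convOp K g x‖} ≤ B * (I₂ + a ^ 2 * 2 ^ (2 * d) * v) := by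
      refine hcheb.trans ((hL2 g _ hgi hgb).trans ?_)
      rw [hpow] at hg2
      rw [hI₂]
      simp only [ofReal_norm]
      gcongr
    rw [mul_comm, ← ENNReal.le_div_iff_mul_le (Or.inl (pow_ne_zero _ ht0))
      (Or.inl (ENNReal.pow_ne_top ha'))] at h1
    refine h1.trans (le_of_eq ?_)
    rw [ENNReal.div_eq_inv_mul, ENNReal.inv_pow]
    have : a⁻¹ ^ 2 * a ^ 2 = 1 := by
      rw [← mul_pow, ENNReal.inv_mul_cancel ht0 ha', one_pow]
    calc _ = B * (a⁻¹ ^ 2 * I₂) + (a⁻¹ ^ 2 * a ^ 2) * (B * 2 ^ (2 * d) * v) := by ring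
      _ = _ := by rw [this, one_mul]
  calc volume {x | 2 * t < ‖convOp K f x‖}
      ≤ volume {x | t ≤ ‖convOp K g x‖} + volume {x | t ≤ ‖convOp K b x‖} :=
        (measure_mono hsub).trans (measure_union_le _ _)
    _ ≤ (B * (a⁻¹ ^ 2 * I₂) + B * 2 ^ (2 * d) * (2 * (a⁻¹ * I₁))) +
        czConst d A * (2 * (a⁻¹ * I₁)) := by
        refine add_le_add (hg.trans ?_) (hbv.trans ?_)
        · gcongr
        · rw [czConst]
          gcongr
    _ = _ := by
        rw [ENNReal.ofReal_pow (by positivity), hinv]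
        ring

/-- Calderón–Zygmund theorem for operators bounded in the uniform norm. -/
theorem lintegral_convOp_rpow_le_of_sup (hd : 1 ≤ d) {K : Ed d → H₁ →L[ℂ] H₂}
    (hK : Continuous K) {M : ℝ} (hKb : ∀ x, ‖K x‖ ≤ M) {A : ℝ≥0∞} (hA : IsHormander K A)
    (hA' : A ≠ ∞) {B : ℝ} (hB : 0 ≤ B)
    (hsup : ∀ (g : Ed d → H₁) (m : ℝ), Integrable g → (∀ x, ‖g x‖ ≤ m) →
      ∀ x, ‖convOp K g x‖ ≤ B * m)
    {p : ℝ} (hp : 1 < p) {f : Ed d → H₁} (hfc : Continuous f) (hfi : Integrable f) :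
    ∫⁻ x, ‖convOp K f x‖ₑ ^ p ≤
      (ENNReal.ofReal ((B * 2 ^ d + 1) ^ p * p) * (czConst d A * 2 *
        ENNReal.ofReal (2 ^ (p - 1) / (p - 1)) +
        0 * ENNReal.ofReal (1 / (2 - p)))) * ∫⁻ x, ‖f x‖ₑ ^ p := by
  have hcf : Continuous (convOp K f) := continuous_convOp hK hKb hfi
  simp only [← ofReal_norm_rpow _ (by linarith : 0 ≤ p)]
  have hC : czConst d A ≠ ∞ := czConst_ne_top d hA'
  refine lintegral_rpow_le_of_distribution hcf.norm.measurable (fun _ => norm_nonneg _)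
    hfc.norm.measurable (fun _ => norm_nonneg _) hp (by positivity)
    (ENNReal.mul_ne_top hC (by norm_num)) ENNReal.zero_ne_top (Or.inr rfl) fun t ht => ?_
  obtain ⟨g, b, v, hfgb, hgi, hbi, hgb, hv, hg2, hbv⟩ :=
    exists_calderonZygmund hd hK hKb hA hfc hfi ht
  have ht0 : ENNReal.ofReal t ≠ 0 := by simpa using ht
  have hsub : {x | (B * 2 ^ d + 1) * t < ‖convOp K f x‖} ⊆ {x | t ≤ ‖convOp K b x‖} := by
    intro x hx
    have h1 : convOp K f x = convOp K g x + convOp K b x := by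
      rw [← convOp_add hK hKb hgi hbi]
      congr 1
      exact funext hfgb
    have h2 := norm_add_le (convOp K g x) (convOp K b x)
    rw [← h1] at h2
    have h3 : (B * 2 ^ d + 1) * t < ‖convOp K f x‖ := hx
    have h4 := hsup g _ hgi hgb x
    exact show t ≤ _ by linarith
  have hv' : v ≤ 2 * (ENNReal.ofReal t⁻¹ *
      ∫⁻ x in {x | t / 2 < ‖f x‖}, ENNReal.ofReal ‖f x‖) := by
    simp only [ofReal_norm]
    rw [ENNReal.ofReal_inv_of_pos ht, mul_left_comm, ← ENNReal.div_eq_inv_mul,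
      ENNReal.le_div_iff_mul_le (Or.inl ht0) (Or.inl ENNReal.ofReal_ne_top), mul_comm]
    exact hv
  calc volume {x | (B * 2 ^ d + 1) * t < ‖convOp K f x‖}
      ≤ volume {x | t ≤ ‖convOp K b x‖} := measure_mono hsub
    _ ≤ czConst d A * v := hbv
    _ ≤ czConst d A * (2 * (ENNReal.ofReal t⁻¹ *
        ∫⁻ x in {x | t / 2 < ‖f x‖}, ENNReal.ofReal ‖f x‖)) := by gcongr
    _ = _ := by ring

end czLp

section harmonicAnalysis

open scoped FourierTransform SchwartzMap

/-- The dilation `ξ ↦ m (2^{-j} ξ)` of a Schwartz function. -/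
def dil {d : ℕ} (m : 𝓢(Ed d, ℂ)) (j : ℤ) : 𝓢(Ed d, ℂ) :=
  SchwartzMap.compCLMOfContinuousLinearEquiv ℂ
    (LinearEquiv.smulOfNeZero ℝ (Ed d) ((2 : ℝ) ^ (-j)) (by positivity)).toContinuousLinearEquiv m

/-- The convolution kernel of the Fourier multiplier with symbol `m (2^{-j} ξ)`. -/
def dilKer {d : ℕ} (m : 𝓢(Ed d, ℂ)) (j : ℤ) : 𝓢(Ed d, ℂ) := 𝓕⁻ (dil m j)

lemma dil_apply {d : ℕ} (m : 𝓢(Ed d, ℂ)) (j : ℤ) (ξ : Ed d) :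
    dil m j ξ = m ((2 : ℝ) ^ (-j) • ξ) := rfl

lemma dilKer_apply {d : ℕ} (m : 𝓢(Ed d, ℂ)) (j : ℤ) (x : Ed d) :
    dilKer m j x = ((2 : ℝ) ^ j) ^ d • (𝓕⁻ m : 𝓢(Ed d, ℂ)) ((2 : ℝ) ^ j • x) := by
  rw [dilKer, SchwartzMap.fourierInv_coe, SchwartzMap.fourierInv_coe, Real.fourierInv_eq',
    Real.fourierInv_eq']
  have h := Measure.integral_comp_smul_of_nonneg (volume : Measure (Ed d))
    (fun v => Complex.exp (↑(2 * Real.pi * inner ℝ v ((2 : ℝ) ^ j • x)) * Complex.I) • m v)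
    ((2 : ℝ) ^ (-j)) (hR := by positivity)
  have h2 : ∀ v : Ed d, inner ℝ ((2 : ℝ) ^ (-j) • v) ((2 : ℝ) ^ j • x) = inner ℝ v x := fun v => by
    rw [real_inner_smul_left, real_inner_smul_right, ← mul_assoc, ← zpow_add₀ (by norm_num)]
    simp
  simp only [h2] at h
  have h3 : ((2 : ℝ) ^ j) ^ d = (((2 : ℝ) ^ (-j)) ^ d)⁻¹ := by
    rw [zpow_neg, inv_pow, inv_inv]
  rw [h3]
  simpa [dil_apply] using h

section schwartzDecay

variable {d : ℕ}

lemma exists_decay (Ψ : 𝓢(Ed d, ℂ)) (k : ℕ) :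
    ∃ C : ℝ, 0 ≤ C ∧ (∀ x, ‖Ψ x‖ ≤ C * ((1 + ‖x‖) ^ k)⁻¹) ∧
      ∀ x, ‖fderiv ℝ Ψ x‖ ≤ C * ((1 + ‖x‖) ^ k)⁻¹ := by
  set C := 2 ^ (k, 1).1 * (Finset.Iic (k, 1)).sup (fun m => SchwartzMap.seminorm ℝ m.1 m.2) Ψ
  refine ⟨C, by positivity, fun x => ?_, fun x => ?_⟩
  · have := SchwartzMap.one_add_le_sup_seminorm_apply (𝕜 := ℝ) (m := (k, 1)) (k := k) (n := 0)
      le_rfl (by simp) Ψ x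
    rw [norm_iteratedFDeriv_zero] at this
    rw [← div_eq_mul_inv, le_div_iff₀ (by positivity), mul_comm]
    exact this
  · have := SchwartzMap.one_add_le_sup_seminorm_apply (𝕜 := ℝ) (m := (k, 1)) (k := k) (n := 1)
      le_rfl le_rfl Ψ x
    rw [norm_iteratedFDeriv_one] at this
    rw [← div_eq_mul_inv, le_div_iff₀ (by positivity), mul_comm]
    exact this

lemma exists_norm_sub_le (Ψ : 𝓢(Ed d, ℂ)) (k : ℕ) :
    ∃ C : ℝ, 0 ≤ C ∧ ∀ (x h : Ed d) (ρ : ℝ), 0 < ρ → ‖h‖ ≤ ρ → 2 * ρ ≤ ‖x‖ →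
      ‖Ψ (x - h) - Ψ x‖ ≤ C * min ρ ρ⁻¹ * ((1 + ‖x‖) ^ k)⁻¹ := by
  obtain ⟨C, hC, h0, h1⟩ := exists_decay Ψ (k + 1)
  refine ⟨2 * 2 ^ (k + 1) * C, by positivity, fun x h ρ hρ hh hx => ?_⟩
  have hz : ∀ z ∈ Metric.closedBall x ρ, ((1 + ‖z‖) ^ (k + 1))⁻¹ ≤
      2 ^ (k + 1) * ((1 + ‖x‖) ^ (k + 1))⁻¹ := fun z hz => by
    have : ‖x‖ - ‖z‖ ≤ ρ := by
      rw [Metric.mem_closedBall, dist_comm, dist_eq_norm] at hz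
      exact (norm_sub_norm_le x z).trans hz
    have h2 : (1 + ‖x‖) / 2 ≤ 1 + ‖z‖ := by linarith
    calc ((1 + ‖z‖) ^ (k + 1))⁻¹ ≤ (((1 + ‖x‖) / 2) ^ (k + 1))⁻¹ := by gcongr
      _ = _ := by rw [div_pow]; field_simp
  have hmem : x - h ∈ Metric.closedBall x ρ := by
    rw [Metric.mem_closedBall, dist_eq_norm]
    simpa using hh
  have hmx : x ∈ Metric.closedBall x ρ := Metric.mem_closedBall_self hρ.le
  have hpk : ((1 + ‖x‖) ^ (k + 1))⁻¹ ≤ ((1 + ‖x‖) ^ k)⁻¹ * ρ⁻¹ := by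
    rw [pow_succ, mul_inv]
    gcongr
    linarith
  have hpk' : ((1 + ‖x‖) ^ (k + 1))⁻¹ ≤ ((1 + ‖x‖) ^ k)⁻¹ := by
    gcongr
    · linarith [norm_nonneg x]
    · omega
  rw [mul_comm _ (min ρ ρ⁻¹), mul_assoc, min_mul_of_nonneg _ _ (by positivity)]
  refine le_min ?_ ?_
  · have := (convex_closedBall x ρ).norm_image_sub_le_of_norm_fderiv_le (𝕜 := ℝ)
      (f := Ψ) (C := C * (2 ^ (k + 1) * ((1 + ‖x‖) ^ (k + 1))⁻¹))
      (fun z _ => Ψ.differentiableAt) (fun z h => (h1 z).trans (by gcongr; exact hz z h)) hmx hmem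
    refine this.trans ?_
    calc C * (2 ^ (k + 1) * ((1 + ‖x‖) ^ (k + 1))⁻¹) * ‖x - h - x‖
        ≤ C * (2 ^ (k + 1) * ((1 + ‖x‖) ^ k)⁻¹) * ρ := by
          gcongr
          simpa using hh
      _ ≤ 2 * (C * (2 ^ (k + 1) * ((1 + ‖x‖) ^ k)⁻¹) * ρ) :=
          le_mul_of_one_le_left (by positivity) (by norm_num)
      _ = _ := by ring
  · calc ‖Ψ (x - h) - Ψ x‖ ≤ ‖Ψ (x - h)‖ + ‖Ψ x‖ := norm_sub_le _ _
      _ ≤ C * (2 ^ (k + 1) * ((1 + ‖x‖) ^ (k + 1))⁻¹) +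
          C * (2 ^ (k + 1) * ((1 + ‖x‖) ^ (k + 1))⁻¹) := by
          gcongr
          · exact (h0 _).trans (by gcongr; exact hz _ hmem)
          · exact (h0 _).trans (by gcongr; exact hz _ hmx)
      _ ≤ C * (2 ^ (k + 1) * (((1 + ‖x‖) ^ k)⁻¹ * ρ⁻¹)) +
          C * (2 ^ (k + 1) * (((1 + ‖x‖) ^ k)⁻¹ * ρ⁻¹)) := by gcongr
      _ = _ := by ring

lemma summable_half_pow_natAbs : Summable fun n : ℤ => ((1 : ℝ) / 2) ^ n.natAbs := by
  rw [summable_int_iff_summable_nat_and_neg]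
  simp only [Int.natAbs_neg, Int.natAbs_natCast, and_self]
  exact summable_geometric_of_lt_one (by norm_num) (by norm_num)

lemma exists_sum_min_le : ∃ C : ℝ, 0 ≤ C ∧ ∀ (J : Finset ℤ) (ρ : ℝ), 0 < ρ →
    ∑ j ∈ J, min ((2 : ℝ) ^ j * ρ) ((2 : ℝ) ^ j * ρ)⁻¹ ≤ C := by
  refine ⟨2 * ∑' n : ℤ, ((1 : ℝ) / 2) ^ n.natAbs, by positivity, fun J ρ hρ => ?_⟩
  obtain ⟨k, hk⟩ := exists_mem_Ico_zpow hρ (by norm_num : (1 : ℝ) < 2)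
  have h1 : ∀ j : ℤ, min ((2 : ℝ) ^ j * ρ) ((2 : ℝ) ^ j * ρ)⁻¹ ≤
      2 * ((1 : ℝ) / 2) ^ (j + k).natAbs := fun j => by
    rcases le_total 0 (j + k) with h | h
    · refine (min_le_right _ _).trans ?_
      have : ((1 : ℝ) / 2) ^ (j + k).natAbs = ((2 : ℝ) ^ (j + k))⁻¹ := by
        rw [one_div, inv_pow, ← zpow_natCast, Int.natAbs_of_nonneg h]
      rw [this, zpow_add₀ (by norm_num)]
      have h3 : ((2 : ℝ) ^ j * ρ)⁻¹ ≤ ((2 : ℝ) ^ j * 2 ^ k)⁻¹ := by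
        gcongr
        exact hk.1
      have : 0 ≤ ((2 : ℝ) ^ j * 2 ^ k)⁻¹ := by positivity
      linarith
    · refine (min_le_left _ _).trans ?_
      have : ((1 : ℝ) / 2) ^ (j + k).natAbs = (2 : ℝ) ^ (j + k) := by
        rw [one_div, inv_pow, ← zpow_natCast, ← zpow_neg]
        congr 1
        omega
      rw [this, zpow_add₀ (by norm_num)]
      have h2 := hk.2
      rw [zpow_add_one₀ (by norm_num)] at h2
      calc (2 : ℝ) ^ j * ρ ≤ 2 ^ j * (2 ^ k * 2) := by gcongr
        _ = _ := by ring
  have hs : Summable fun j : ℤ => ((1 : ℝ) / 2) ^ (j + k).natAbs :=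
    ((Equiv.addRight k).summable_iff (f := fun n : ℤ => ((1 : ℝ) / 2) ^ n.natAbs)).2
      summable_half_pow_natAbs
  calc _ ≤ ∑ j ∈ J, 2 * ((1 : ℝ) / 2) ^ (j + k).natAbs := Finset.sum_le_sum fun j _ => h1 j
    _ = 2 * ∑ j ∈ J, ((1 : ℝ) / 2) ^ (j + k).natAbs := by rw [Finset.mul_sum]
    _ ≤ 2 * ∑' j : ℤ, ((1 : ℝ) / 2) ^ (j + k).natAbs := by
        gcongr
        exact hs.sum_le_tsum _ fun _ _ => by positivity
    _ = _ := by
        congr 1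
        exact (Equiv.addRight k).tsum_eq fun n : ℤ => ((1 : ℝ) / 2) ^ n.natAbs

lemma lintegral_decay_smul (j : ℤ) :
    ∫⁻ x : Ed d, ENNReal.ofReal (((2 : ℝ) ^ j) ^ d * ((1 + ‖(2 : ℝ) ^ j • x‖) ^ (d + 1))⁻¹) =
      ENNReal.ofReal (∫ x : Ed d, ((1 + ‖x‖) ^ (d + 1))⁻¹) := by
  have hi : Integrable fun x : Ed d => ((1 + ‖x‖) ^ (d + 1))⁻¹ := by
    have := integrable_one_add_norm (E := Ed d) (μ := volume) (r := (d + 1 : ℕ)) (by simp)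
    refine this.congr (Eventually.of_forall fun x => ?_)
    simp only
    rw [Real.rpow_neg (by positivity), Real.rpow_natCast]
  have hi2 : Integrable fun x : Ed d => ((2 : ℝ) ^ j) ^ d *
      ((1 + ‖(2 : ℝ) ^ j • x‖) ^ (d + 1))⁻¹ :=
    (hi.comp_smul (R := (2 : ℝ) ^ j) (by positivity)).const_mul _
  rw [← ofReal_integral_eq_lintegral_ofReal hi2 (Eventually.of_forall fun x => by positivity),
    integral_const_mul, Measure.integral_comp_smul_of_nonneg volume
      (fun x : Ed d => ((1 + ‖x‖) ^ (d + 1))⁻¹) _ (hR := by positivity)]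
  congr 1
  simp only [finrank_euclideanSpace, Fintype.card_fin, smul_eq_mul]
  rw [← mul_assoc, mul_inv_cancel₀ (by positivity), one_mul]

end schwartzDecay

/-- The operator-valued kernel `∑ j ∈ J, k_j L_j`, with `k_j` the kernel of the multiplier
`m (2^{-j} ξ)`. -/
def sumKer {d : ℕ} {H₁ H₂ : Type*} [NormedAddCommGroup H₁] [NormedSpace ℂ H₁]
    [NormedAddCommGroup H₂] [NormedSpace ℂ H₂] (m : 𝓢(Ed d, ℂ)) (J : Finset ℤ)
    (L : ℤ → H₁ →L[ℂ] H₂) (x : Ed d) : H₁ →L[ℂ] H₂ :=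
  ∑ j ∈ J, dilKer m j x • L j

section sumKer

variable {d : ℕ} {H₁ H₂ : Type*} [NormedAddCommGroup H₁] [NormedSpace ℂ H₁]
    [NormedAddCommGroup H₂] [NormedSpace ℂ H₂]

lemma continuous_sumKer (m : 𝓢(Ed d, ℂ)) (J : Finset ℤ) (L : ℤ → H₁ →L[ℂ] H₂) :
    Continuous (sumKer m J L) :=
  continuous_finsetSum _ fun j _ => (dilKer m j).continuous.smul continuous_const

lemma exists_norm_sumKer_le (m : 𝓢(Ed d, ℂ)) (J : Finset ℤ) (L : ℤ → H₁ →L[ℂ] H₂) :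
    ∃ M, ∀ x, ‖sumKer m J L x‖ ≤ M := by
  choose C _ hC _ using fun j => exists_decay (dilKer m j) 0
  refine ⟨∑ j ∈ J, C j * ‖L j‖, fun x => (norm_sum_le _ _).trans
    (Finset.sum_le_sum fun j _ => ?_)⟩
  rw [norm_smul]
  gcongr
  simpa using hC j x

theorem exists_isHormander_sumKer (m : 𝓢(Ed d, ℂ)) : ∃ A : ℝ≥0∞, A ≠ ∞ ∧
    ∀ (H₁ H₂ : Type) [NormedAddCommGroup H₁] [NormedSpace ℂ H₁] [NormedAddCommGroup H₂]
      [NormedSpace ℂ H₂] (J : Finset ℤ) (L : ℤ → H₁ →L[ℂ] H₂), (∀ j, ‖L j‖ ≤ 1) →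
      IsHormander (sumKer m J L) A := by
  obtain ⟨C, hC, hΨ⟩ := exists_norm_sub_le (𝓕⁻ m : 𝓢(Ed d, ℂ)) (d + 1)
  obtain ⟨S, hS, hsum⟩ := exists_sum_min_le
  set I := ∫ x : Ed d, ((1 + ‖x‖) ^ (d + 1))⁻¹
  refine ⟨ENNReal.ofReal (C * S) * ENNReal.ofReal I,
    ENNReal.mul_ne_top ENNReal.ofReal_ne_top ENNReal.ofReal_ne_top, ?_⟩
  intro H₁ H₂ _ _ _ _ J L hL c y ρ hy
  rcases ((norm_nonneg _).trans hy).eq_or_lt with h0 | hρ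
  · have : y = c := by
      rw [← h0] at hy
      exact sub_eq_zero.1 (norm_le_zero_iff.1 hy)
    simp only [this, sub_self, ← ofReal_norm, norm_zero]
    simp
  set w : ℤ → Ed d → ℝ := fun j x =>
    ((2 : ℝ) ^ j) ^ d * ((1 + ‖(2 : ℝ) ^ j • x‖) ^ (d + 1))⁻¹ with hw
  have hwm : ∀ j, Continuous (w j) := fun j => by
    refine continuous_const.mul (Continuous.inv₀ (by fun_prop) fun x => by positivity)
  have hbound : ∀ x ∈ {x : Ed d | 2 * ρ ≤ ‖x - c‖},
      ‖sumKer m J L (x - y) - sumKer m J L (x - c)‖ₑ ≤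
      ∑ j ∈ J, ENNReal.ofReal (C * min ((2 : ℝ) ^ j * ρ) ((2 : ℝ) ^ j * ρ)⁻¹) *
        ENNReal.ofReal (w j (x - c)) := fun x hx => by
    have hw0 : ∀ j, 0 ≤ w j (x - c) := fun j => by positivity
    simp only [← ENNReal.ofReal_mul' (hw0 _)]
    rw [sumKer, sumKer, ← Finset.sum_sub_distrib, ← ofReal_norm,
      ← ENNReal.ofReal_sum_of_nonneg fun j _ => mul_nonneg (by positivity) (hw0 j)]
    refine ENNReal.ofReal_le_ofReal ((norm_sum_le _ _).trans (Finset.sum_le_sum fun j _ => ?_))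
    rw [← sub_smul]
    have e1 : (2 : ℝ) ^ j • (x - y) = (2 : ℝ) ^ j • (x - c) - (2 : ℝ) ^ j • (y - c) := by
      rw [← smul_sub]
      congr 1
      abel
    have hn : ‖(2 : ℝ) ^ j‖ = 2 ^ j := Real.norm_of_nonneg (by positivity)
    have h1 := hΨ ((2 : ℝ) ^ j • (x - c)) ((2 : ℝ) ^ j • (y - c)) (2 ^ j * ρ) (by positivity)
      (by rw [norm_smul, hn]; gcongr)
      (by rw [norm_smul, hn]
          have : 2 * ρ ≤ ‖x - c‖ := hx
          calc 2 * ((2 : ℝ) ^ j * ρ) = 2 ^ j * (2 * ρ) := by ring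
            _ ≤ _ := by gcongr)
    rw [← e1] at h1
    calc ‖(dilKer m j (x - y) - dilKer m j (x - c)) • L j‖
        ≤ ‖dilKer m j (x - y) - dilKer m j (x - c)‖ * 1 :=
          (norm_smul_le _ _).trans (mul_le_mul_of_nonneg_left (hL j) (norm_nonneg _))
      _ = ((2 : ℝ) ^ j) ^ d * ‖(𝓕⁻ m : 𝓢(Ed d, ℂ)) ((2 : ℝ) ^ j • (x - y)) -
          (𝓕⁻ m : 𝓢(Ed d, ℂ)) ((2 : ℝ) ^ j • (x - c))‖ := by
          rw [mul_one, dilKer_apply, dilKer_apply, ← smul_sub, norm_smul,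
            Real.norm_of_nonneg (by positivity)]
      _ ≤ ((2 : ℝ) ^ j) ^ d * (C * min ((2 : ℝ) ^ j * ρ) ((2 : ℝ) ^ j * ρ)⁻¹ *
          ((1 + ‖(2 : ℝ) ^ j • (x - c)‖) ^ (d + 1))⁻¹) := by gcongr
      _ = _ := by rw [hw]; ring
  calc _ ≤ ∫⁻ x in {x : Ed d | 2 * ρ ≤ ‖x - c‖}, ∑ j ∈ J,
        ENNReal.ofReal (C * min ((2 : ℝ) ^ j * ρ) ((2 : ℝ) ^ j * ρ)⁻¹) *
        ENNReal.ofReal (w j (x - c)) :=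
        setLIntegral_mono' (isClosed_le continuous_const (by fun_prop)).measurableSet hbound
    _ ≤ ∫⁻ x, ∑ j ∈ J, ENNReal.ofReal (C * min ((2 : ℝ) ^ j * ρ) ((2 : ℝ) ^ j * ρ)⁻¹) *
        ENNReal.ofReal (w j (x - c)) := setLIntegral_le_lintegral _ _
    _ = ∑ j ∈ J, ENNReal.ofReal (C * min ((2 : ℝ) ^ j * ρ) ((2 : ℝ) ^ j * ρ)⁻¹) *
        ENNReal.ofReal I := by
        rw [lintegral_finsetSum' _ fun j _ => by
          have := hwm j
          exact ((this.comp (continuous_id.sub continuous_const)).measurable.ennreal_ofReal.const_mul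
            _).aemeasurable]
        refine Finset.sum_congr rfl fun j _ => ?_
        rw [lintegral_const_mul' _ _ ENNReal.ofReal_ne_top,
          lintegral_sub_right_eq_self (fun x => ENNReal.ofReal (w j x)) c, hw,
          lintegral_decay_smul j]
    _ ≤ _ := by
        rw [← Finset.sum_mul]
        gcongr
        rw [← ENNReal.ofReal_sum_of_nonneg fun j _ => by positivity, ← Finset.mul_sum]
        gcongr
        exact hsum J ρ hρ

end sumKer

/-- Fatou's lemma for `L^p` norms. -/
lemma eLpNorm_le_of_tendsto {X E : Type*} [MeasurableSpace X] {μ : Measure X}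
    [NormedAddCommGroup E] {p : ℝ≥0∞} {f : ℕ → X → E} {F : X → E}
    (hf : ∀ n, AEStronglyMeasurable (f n) μ)
    (hlim : ∀ x, Tendsto (fun n => f n x) atTop (nhds (F x))) {c : ℕ → ℝ≥0∞} {C : ℝ≥0∞}
    (hle : ∀ n, eLpNorm (f n) p μ ≤ c n) (hc : Tendsto c atTop (nhds C)) :
    eLpNorm F p μ ≤ C := by
  refine (Lp.eLpNorm_lim_le_liminf_eLpNorm hf F (Eventually.of_forall hlim)).trans ?_
  rw [← hc.liminf_eq]
  exact liminf_le_liminf (Eventually.of_forall hle)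

lemma eLpNorm_two_sq {X E : Type*} [MeasurableSpace X] {μ : Measure X} [NormedAddCommGroup E]
    (f : X → E) : eLpNorm f 2 μ ^ 2 = ∫⁻ x, ‖f x‖ₑ ^ 2 ∂μ := by
  have := eLpNorm_nnreal_pow_eq_lintegral (f := f) (μ := μ) (p := 2) (by norm_num)
  simpa using this

section kernels

variable {d : ℕ} {H₁ H₂ : Type*} [NormedAddCommGroup H₁] [NormedSpace ℂ H₁]
    [NormedAddCommGroup H₂] [NormedSpace ℂ H₂]

lemma memLp_sumKer (m : 𝓢(Ed d, ℂ)) (J : Finset ℤ) (L : ℤ → H₁ →L[ℂ] H₂) (p : ℝ≥0∞) :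
    MemLp (sumKer m J L) p := by
  have h : MemLp (fun x => ∑ j ∈ J, ‖L j‖ * ‖dilKer m j x‖) p (volume : Measure (Ed d)) :=
    memLp_finsetSum J fun j _ => ((dilKer m j).memLp p).norm.const_mul ‖L j‖
  refine h.mono (continuous_sumKer m J L).aestronglyMeasurable (Eventually.of_forall fun x => ?_)
  refine ((norm_sum_le _ _).trans (Finset.sum_le_sum fun j _ => ?_)).trans (le_abs_self _)
  rw [norm_smul, mul_comm]

lemma integrable_smul_sub (k : 𝓢(Ed d, ℂ)) {g : Ed d → H₁} (hg : Integrable g)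
    (L : H₁ →L[ℂ] H₂) (x : Ed d) : Integrable fun y => k (x - y) • L (g y) := by
  obtain ⟨C, _, hC, _⟩ := exists_decay k 0
  refine (L.integrable_comp hg).bdd_smul (C := C) ?_ (Eventually.of_forall fun y => ?_)
  · exact (k.continuous.comp (continuous_const.sub continuous_id)).aestronglyMeasurable
  · simpa using hC (x - y)

lemma convOp_sumKer (m : 𝓢(Ed d, ℂ)) (J : Finset ℤ) (L : ℤ → H₁ →L[ℂ] H₂) {g : Ed d → H₁}
    (hg : Integrable g) (x : Ed d) :
    convOp (sumKer m J L) g x = ∑ j ∈ J, ∫ y, dilKer m j (x - y) • L j (g y) := by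
  rw [convOp, ← integral_finsetSum _ fun j _ => integrable_smul_sub _ hg _ _]
  simp [sumKer]

/-- The Fourier multiplier operator with symbol `m (2^{-j} ξ)`. -/
def mulOp (m : 𝓢(Ed d, ℂ)) (j : ℤ) (g : Ed d → H₁) (x : Ed d) : H₁ :=
  ∫ y, dilKer m j (x - y) • g y

lemma convOp_sumKer_eq_sum [CompleteSpace H₁] [CompleteSpace H₂] (m : 𝓢(Ed d, ℂ)) (J : Finset ℤ)
    (L : ℤ → H₁ →L[ℂ] H₂) {g : Ed d → H₁} (hg : Integrable g) (x : Ed d) :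
    convOp (sumKer m J L) g x = ∑ j ∈ J, L j (mulOp m j g x) := by
  rw [convOp_sumKer m J L hg]
  refine Finset.sum_congr rfl fun j _ => ?_
  have h := integrable_smul_sub (dilKer m j) hg (ContinuousLinearMap.id ℂ H₁) x
  refine Eq.trans ?_ ((L j).integral_comp_comm h)
  simp

lemma memLp_two_of_bounded {H : Type*} [NormedAddCommGroup H] {g : Ed d → H} (hg : Integrable g) {c : ℝ}
    (hc : ∀ x, ‖g x‖ ≤ c) : MemLp g 2 := by
  rw [memLp_two_iff_integrable_sq_norm hg.aestronglyMeasurable]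
  refine (hg.norm.const_mul c).mono' (hg.aestronglyMeasurable.norm.pow 2)
    (Eventually.of_forall fun x => ?_)
  rw [Real.norm_of_nonneg (by positivity), pow_two]
  exact mul_le_mul_of_nonneg_right (hc x) (norm_nonneg _)

lemma integral_norm_dilKer (m : 𝓢(Ed d, ℂ)) (j : ℤ) :
    ∫ x, ‖dilKer m j x‖ = ∫ x, ‖(𝓕⁻ m : 𝓢(Ed d, ℂ)) x‖ := by
  have h := Measure.integral_comp_smul_of_nonneg (volume : Measure (Ed d))
    (fun v => ‖(𝓕⁻ m : 𝓢(Ed d, ℂ)) v‖) ((2 : ℝ) ^ j) (hR := by positivity)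
  simp only [dilKer_apply, norm_smul, integral_const_mul]
  rw [h]
  have h2 : (((2 : ℝ) ^ j) ^ d) ≠ 0 := by positivity
  simp [h2]

lemma norm_mulOp_le (m : 𝓢(Ed d, ℂ)) (j : ℤ) {g : Ed d → H₁} {c : ℝ} (hc : ∀ᵐ x, ‖g x‖ ≤ c)
    (x : Ed d) : ‖mulOp m j g x‖ ≤ (∫ x, ‖(𝓕⁻ m : 𝓢(Ed d, ℂ)) x‖) * c := by
  rw [← integral_norm_dilKer m j, ← integral_sub_left_eq_self _ volume x, ← integral_mul_const]
  refine norm_integral_le_of_norm_le ?_ (hc.mono fun y hy => ?_)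
  · exact ((dilKer m j).integrable.norm.comp_sub_left x).mul_const c
  · rw [norm_smul]
    gcongr

end kernels

section L2bound

variable {d : ℕ} {H₁ H₂ : Type*} [NormedAddCommGroup H₁] [InnerProductSpace ℂ H₁]
    [NormedAddCommGroup H₂] [InnerProductSpace ℂ H₂] [CompleteSpace H₁] [CompleteSpace H₂]

/-- The bilinear map `(z, v) ↦ z • L v`. -/
def smulBilin (L : H₁ →L[ℂ] H₂) : ℂ →L[ℂ] H₁ →L[ℂ] H₂ :=
  ((ContinuousLinearMap.lsmul ℂ ℂ : ℂ →L[ℂ] H₂ →L[ℂ] H₂).flip ∘L L).flip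

lemma smulBilin_apply (L : H₁ →L[ℂ] H₂) (z : ℂ) (v : H₁) : smulBilin L z v = z • L v := rfl

/-- The multiplier operator of `sumKer`, on Schwartz functions. -/
def sumOp (m : 𝓢(Ed d, ℂ)) (J : Finset ℤ) (L : ℤ → H₁ →L[ℂ] H₂) (g : 𝓢(Ed d, H₁)) :
    𝓢(Ed d, H₂) :=
  ∑ j ∈ J, SchwartzMap.convolution (smulBilin (L j)) (dilKer m j) g

lemma sumOp_apply (m : 𝓢(Ed d, ℂ)) (J : Finset ℤ) (L : ℤ → H₁ →L[ℂ] H₂) (g : 𝓢(Ed d, H₁))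
    (x : Ed d) : sumOp m J L g x = convOp (sumKer m J L) g x := by
  rw [convOp_sumKer m J L g.integrable, sumOp, sum_apply]
  refine Finset.sum_congr rfl fun j _ => ?_
  rw [SchwartzMap.convolution_apply, convolution]
  simp only [smulBilin_apply]
  rw [← integral_sub_left_eq_self _ volume x]
  simp

lemma fourier_sumOp (m : 𝓢(Ed d, ℂ)) (J : Finset ℤ) (L : ℤ → H₁ →L[ℂ] H₂) (g : 𝓢(Ed d, H₁))
    (ξ : Ed d) : (𝓕 (sumOp m J L g) : 𝓢(Ed d, H₂)) ξ =
      ∑ j ∈ J, dil m j ξ • L j ((𝓕 g : 𝓢(Ed d, H₁)) ξ) := by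
  have h : (𝓕 (sumOp m J L g) : 𝓢(Ed d, H₂)) =
      ∑ j ∈ J, 𝓕 (SchwartzMap.convolution (smulBilin (L j)) (dilKer m j) g) :=
    map_sum (FourierTransform.fourierCLM ℂ 𝓢(Ed d, H₂)) _ _
  rw [h, sum_apply]
  refine Finset.sum_congr rfl fun j _ => ?_
  rw [SchwartzMap.fourier_convolution]
  simp [dilKer, smulBilin_apply, SchwartzMap.pairing_apply_apply]

lemma integrable_norm_sq_schwartz {H : Type*} [NormedAddCommGroup H] [NormedSpace ℝ H]
    (g : 𝓢(Ed d, H)) : Integrable fun x => ‖g x‖ ^ 2 :=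
  (memLp_two_iff_integrable_sq_norm g.continuous.aestronglyMeasurable).1 (g.memLp 2)

lemma eLpNorm_two_schwartz {H : Type*} [NormedAddCommGroup H] [NormedSpace ℝ H]
    (g : 𝓢(Ed d, H)) : eLpNorm g 2 volume ^ 2 = ENNReal.ofReal (∫ x, ‖g x‖ ^ 2) := by
  have h := ofReal_integral_eq_lintegral_ofReal (integrable_norm_sq_schwartz g)
    (Eventually.of_forall fun x => by positivity)
  rw [eLpNorm_two_sq, h]
  refine lintegral_congr fun x => ?_
  rw [ENNReal.ofReal_pow (norm_nonneg _), ofReal_norm]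

lemma eLpNorm_sumOp_le (m : 𝓢(Ed d, ℂ)) (J : Finset ℤ) (L : ℤ → H₁ →L[ℂ] H₂)
    (hL : ∀ j, ‖L j‖ ≤ 1) {M : ℝ} (hM0 : 0 ≤ M) (hM : ∀ ξ, ∑ j ∈ J, ‖dil m j ξ‖ ≤ M)
    (g : 𝓢(Ed d, H₁)) : eLpNorm (sumOp m J L g) 2 volume ≤ ENNReal.ofReal M * eLpNorm g 2 volume := by
  rw [← ENNReal.pow_le_pow_left_iff two_ne_zero, mul_pow, eLpNorm_two_schwartz,
    eLpNorm_two_schwartz, ← ENNReal.ofReal_pow hM0, ← ENNReal.ofReal_mul (by positivity)]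
  refine ENNReal.ofReal_le_ofReal ?_
  rw [← SchwartzMap.integral_norm_sq_fourier, ← SchwartzMap.integral_norm_sq_fourier g,
    ← integral_const_mul]
  refine integral_mono (integrable_norm_sq_schwartz _)
    ((integrable_norm_sq_schwartz _).const_mul _) fun ξ => ?_
  simp only
  rw [← mul_pow, fourier_sumOp]
  gcongr
  calc _ ≤ ∑ j ∈ J, ‖dil m j ξ‖ * ‖(𝓕 g : 𝓢(Ed d, H₁)) ξ‖ := by
        refine (norm_sum_le _ _).trans (Finset.sum_le_sum fun j _ => ?_)
        rw [norm_smul]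
        gcongr
        exact ((L j).le_of_opNorm_le (hL j) _).trans (one_mul _).le
    _ ≤ _ := by
        rw [← Finset.sum_mul]
        gcongr
        exact hM ξ

lemma enorm_convOp_le {K : Ed d → H₁ →L[ℂ] H₂} (hK : Continuous K) {g : Ed d → H₁}
    (hg : AEStronglyMeasurable g volume) (x : Ed d) :
    ‖convOp K g x‖ₑ ≤ eLpNorm K 2 volume * eLpNorm g 2 volume := by
  have h1 : eLpNorm (fun y => K (x - y)) 2 volume = eLpNorm K 2 volume :=
    eLpNorm_comp_measurePreserving (g := K) hK.aestronglyMeasurable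
      (Measure.measurePreserving_sub_left volume x)
  rw [← h1]
  refine (enorm_integral_le_lintegral_enorm _).trans ?_
  rw [← eLpNorm_one_eq_lintegral_enorm]
  have hm : AEStronglyMeasurable (fun y => K (x - y)) volume :=
    (hK.comp (continuous_const.sub continuous_id)).aestronglyMeasurable
  exact eLpNorm_le_eLpNorm_mul_eLpNorm_of_nnnorm (r := 1) (p := 2) (q := 2) hm hg
    (fun T v => T v) 1 (Eventually.of_forall fun y => by
      simpa using (K (x - y)).le_opNNNorm (g y)) |>.trans (by simp)

theorem eLpNorm_two_convOp_sumKer_le (m : 𝓢(Ed d, ℂ)) (J : Finset ℤ) (L : ℤ → H₁ →L[ℂ] H₂)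
    (hL : ∀ j, ‖L j‖ ≤ 1) {M : ℝ} (hM0 : 0 ≤ M) (hM : ∀ ξ, ∑ j ∈ J, ‖dil m j ξ‖ ≤ M)
    {g : Ed d → H₁} (hg : Integrable g) (hg2 : MemLp g 2) :
    eLpNorm (convOp (sumKer m J L) g) 2 volume ≤ ENNReal.ofReal M * eLpNorm g 2 volume := by
  have hK := continuous_sumKer m J L
  obtain ⟨B, hB⟩ := exists_norm_sumKer_le m J L
  choose h hh1 hh2 hh using fun n : ℕ => hg2.exist_eLpNorm_sub_le ENNReal.ofNat_ne_top
    one_le_two (ε := 1 / ((n : ℝ) + 1)) (by positivity)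
  set G : ℕ → 𝓢(Ed d, H₁) := fun n => (hh1 n).toSchwartzMap (hh2 n) with hG
  have hGh : ∀ n, ⇑(G n) = h n := fun n => rfl
  have hlim : Tendsto (fun n : ℕ => ENNReal.ofReal (1 / ((n : ℝ) + 1))) atTop (nhds 0) := by
    rw [← ENNReal.ofReal_zero]
    exact ENNReal.tendsto_ofReal tendsto_one_div_add_atTop_nhds_zero_nat
  have hsub : ∀ n, eLpNorm (g - ⇑(G n)) 2 volume ≤ ENNReal.ofReal (1 / ((n : ℝ) + 1)) := hh
  have hK2 : eLpNorm (sumKer m J L) 2 volume ≠ ∞ := (memLp_sumKer m J L 2).2.ne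
  refine eLpNorm_le_of_tendsto (f := fun n => convOp (sumKer m J L) (G n))
    (fun n => (continuous_convOp hK hB (G n).integrable).aestronglyMeasurable) (fun x => ?_)
    (c := fun n => ENNReal.ofReal M * (eLpNorm g 2 volume + ENNReal.ofReal (1 / ((n : ℝ) + 1))))
    (fun n => ?_) ?_
  · rw [tendsto_iff_edist_tendsto_0]
    refine tendsto_of_tendsto_of_tendsto_of_le_of_le tendsto_const_nhds
      (h := fun n : ℕ => eLpNorm (sumKer m J L) 2 volume * ENNReal.ofReal (1 / ((n : ℝ) + 1)))
      ?_ (fun _ => zero_le) fun n => ?_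
    · simpa using ENNReal.Tendsto.const_mul hlim (Or.inr hK2)
    · have h1 : convOp (sumKer m J L) g x - convOp (sumKer m J L) (G n) x =
          convOp (sumKer m J L) (g - ⇑(G n)) x := by
        have := convOp_add hK hB (hg.sub (G n).integrable) (G n).integrable x
        rw [sub_eq_iff_eq_add, ← this]
        simp
      simp only
      rw [edist_comm, edist_eq_enorm_sub, h1]
      refine (enorm_convOp_le hK (hg.sub (G n).integrable).aestronglyMeasurable x).trans ?_
      gcongr
      exact hsub n
  · have h1 : convOp (sumKer m J L) (G n) = sumOp m J L (G n) :=
      funext fun x => (sumOp_apply m J L (G n) x).symm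
    rw [h1]
    refine (eLpNorm_sumOp_le m J L hL hM0 hM (G n)).trans ?_
    gcongr
    have h2 : ⇑(G n) = g - (g - ⇑(G n)) := by simp
    rw [h2]
    refine (eLpNorm_sub_le hg.aestronglyMeasurable
      (hg.sub (G n).integrable).aestronglyMeasurable one_le_two).trans ?_
    gcongr
    exact hsub n
  · have : Tendsto (fun n : ℕ => eLpNorm g 2 volume + ENNReal.ofReal (1 / ((n : ℝ) + 1))) atTop
        (nhds (eLpNorm g 2 volume)) := by simpa using tendsto_const_nhds.add hlim
    exact ENNReal.Tendsto.const_mul this (Or.inr ENNReal.ofReal_ne_top)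

end L2bound

section duality

variable {d : ℕ} {H₁ H₂ : Type*} [NormedAddCommGroup H₁] [InnerProductSpace ℂ H₁]
    [NormedAddCommGroup H₂] [InnerProductSpace ℂ H₂]

lemma integrable_convOp_prod {K : Ed d → H₁ →L[ℂ] H₂} (hK : Integrable K) {f : Ed d → H₁}
    (hf : Integrable f) :
    Integrable (fun z : Ed d × Ed d => K (z.1 - z.2) (f z.2)) (volume.prod volume) :=
  hf.convolution_integrand (ContinuousLinearMap.apply ℂ H₂) hK

lemma norm_convOp_le {K : Ed d → H₁ →L[ℂ] H₂} {M : ℝ} (hKb : ∀ x, ‖K x‖ ≤ M) {f : Ed d → H₁}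
    (hf : Integrable f) (x : Ed d) : ‖convOp K f x‖ ≤ M * ∫ y, ‖f y‖ := by
  rw [← integral_const_mul]
  exact norm_integral_le_of_norm_le (hf.norm.const_mul M)
    (Eventually.of_forall fun y => (K (x - y)).le_of_opNorm_le (hKb _) _)

lemma integral_inner_left [CompleteSpace H₁] {f : Ed d → H₁} (hf : Integrable f) (c : H₁) :
    ∫ x, inner ℂ (f x) c = inner ℂ (∫ x, f x) c := by
  rw [← inner_conj_symm, ← integral_inner hf c, ← integral_conj]
  simp

theorem eLpNorm_convOp_le_of_adjoint [CompleteSpace H₁] [CompleteSpace H₂]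
    {K : Ed d → H₁ →L[ℂ] H₂} {K' : Ed d → H₂ →L[ℂ] H₁}
    (hK : Continuous K) (hK' : Continuous K') {M : ℝ} (hKb : ∀ x, ‖K x‖ ≤ M)
    (hKb' : ∀ x, ‖K' x‖ ≤ M)
    (hKi : Integrable K) (hadj : ∀ z v w, inner ℂ w (K z v) = inner ℂ (K' (-z) w) v) {p q : ℝ}
    (hp : 2 < p) (hpq : p.HolderConjugate q) {C : ℝ≥0∞}
    (hC : ∀ h : Ed d → H₂, Continuous h → Integrable h →
      eLpNorm (convOp K' h) (ENNReal.ofReal q) volume ≤ C * eLpNorm h (ENNReal.ofReal q) volume)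
    {f : Ed d → H₁} (hfc : Continuous f) (hfi : Integrable f) :
    eLpNorm (convOp K f) (ENNReal.ofReal p) volume ≤
      C * eLpNorm f (ENNReal.ofReal p) volume := by
  set F := convOp K f with hF
  have hFc : Continuous F := continuous_convOp hK hKb hfi
  have hFi : Integrable F := (integrable_convOp_prod hKi hfi).integral_prod_left
  set b := M * ∫ y, ‖f y‖ with hb
  have hFb : ∀ x, ‖F x‖ ≤ b := norm_convOp_le hKb hfi
  have hb0 : 0 ≤ b := (norm_nonneg _).trans (hFb 0)
  have hp0 : 0 < p := by linarith
  have hq0 : 0 < q := hpq.symm.pos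
  set h : Ed d → H₂ := fun x => ((‖F x‖ ^ (p - 2) : ℝ) : ℂ) • F x with hh
  have hFp : Continuous fun x => ‖F x‖ ^ (p - 2) :=
    hFc.norm.rpow_const fun _ => Or.inr (by linarith)
  have hhc : Continuous h := (Complex.continuous_ofReal.comp hFp).smul hFc
  have hFpb : ∀ x, ‖F x‖ ^ (p - 2) ≤ b ^ (p - 2) := fun x =>
    Real.rpow_le_rpow (norm_nonneg _) (hFb x) (by linarith)
  have hhn : ∀ x, ‖h x‖ = ‖F x‖ ^ (p - 1) := fun x => by
    rw [hh]
    simp only [norm_smul, Complex.norm_real, Real.norm_of_nonneg (Real.rpow_nonneg (norm_nonneg _) _)]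
    rcases eq_or_ne ‖F x‖ 0 with h0 | h0
    · rw [h0, mul_zero, Real.zero_rpow (by linarith)]
    · rw [← Real.rpow_add_one h0]
      congr 1
      ring
  have hhi : Integrable h :=
    (hFi.norm.const_mul (b ^ (p - 2))).mono' hhc.aestronglyMeasurable
      (Eventually.of_forall fun x => by
        rw [hh]
        simp only [norm_smul, Complex.norm_real,
          Real.norm_of_nonneg (Real.rpow_nonneg (norm_nonneg _) _)]
        exact mul_le_mul_of_nonneg_right (hFpb x) (norm_nonneg _))
  have hhb : ∀ x, ‖h x‖ ≤ b ^ (p - 1) := fun x => by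
    rw [hhn]
    exact Real.rpow_le_rpow (norm_nonneg _) (hFb x) (by linarith)
  have hprod : Integrable (fun z : Ed d × Ed d => inner ℂ (h z.1) (K (z.1 - z.2) (f z.2)))
      (volume.prod volume) := by
    refine ((integrable_convOp_prod hKi hfi).norm.const_mul (b ^ (p - 1))).mono' ?_
      (Eventually.of_forall fun z => ?_)
    · refine Continuous.aestronglyMeasurable ?_
      exact (hhc.comp continuous_fst).inner
        ((hK.comp (continuous_fst.sub continuous_snd)).clm_apply (hfc.comp continuous_snd))
    · refine (norm_inner_le_norm _ _).trans ?_
      gcongr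
      exact hhb _
  have hswap : ∫ x, inner ℂ (h x) (F x) = ∫ y, inner ℂ (convOp K' h y) (f y) := by
    calc ∫ x, inner ℂ (h x) (F x) = ∫ x, ∫ y, inner ℂ (h x) (K (x - y) (f y)) :=
          integral_congr_ae (Eventually.of_forall fun x =>
            (integral_inner (integrable_convOp_integrand hK hKb hfi x) _).symm)
      _ = ∫ y, ∫ x, inner ℂ (h x) (K (x - y) (f y)) := integral_integral_swap hprod
      _ = _ := by
        refine integral_congr_ae (Eventually.of_forall fun y => ?_)
        simp only [hadj, neg_sub]
        exact integral_inner_left (integrable_convOp_integrand hK' hKb' hhi y) _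
  set a := eLpNorm F (ENNReal.ofReal p) volume with ha
  have hF2 : ∀ x, inner ℂ (h x) (F x) = ((‖F x‖ ^ p : ℝ) : ℂ) := fun x => by
    rw [hh]
    simp only [inner_smul_left, inner_self_eq_norm_sq_to_K, Complex.conj_ofReal]
    rcases eq_or_ne ‖F x‖ 0 with h0 | h0
    · rw [h0, Real.zero_rpow hp0.ne']
      simp
    · have : ‖F x‖ ^ p = ‖F x‖ ^ (p - 2) * ‖F x‖ ^ 2 := by
        rw [← Real.rpow_natCast, ← Real.rpow_add (by positivity)]
        congr 1
        push_cast
        ring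
      rw [this]
      push_cast
      rfl
  have hap : a ^ p = eLpNorm (fun x => ‖F x‖ ^ p) 1 volume := by
    rw [eLpNorm_norm_rpow F hp0, one_mul]
  have hah : eLpNorm h (ENNReal.ofReal q) volume = a ^ (p - 1) := by
    have h1 : eLpNorm h (ENNReal.ofReal q) volume =
        eLpNorm (fun x => ‖F x‖ ^ (p - 1)) (ENNReal.ofReal q) volume :=
      eLpNorm_congr_norm_ae (Eventually.of_forall fun x => by
        rw [hhn, Real.norm_of_nonneg (Real.rpow_nonneg (norm_nonneg _) _)])
    rw [h1, eLpNorm_norm_rpow F (by linarith), ← ENNReal.ofReal_mul hq0.le,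
      show q * (p - 1) = p by rw [mul_comm]; exact hpq.sub_one_mul_conj]
  have hFpi : Integrable fun x => ‖F x‖ ^ p := by
    refine (hFi.norm.const_mul (b ^ (p - 1))).mono'
      (hFc.norm.rpow_const fun _ => Or.inr hp0.le).aestronglyMeasurable
      (Eventually.of_forall fun x => ?_)
    rw [Real.norm_of_nonneg (Real.rpow_nonneg (norm_nonneg _) _)]
    calc ‖F x‖ ^ p = ‖F x‖ ^ (p - 1) * ‖F x‖ := by
          rcases eq_or_ne ‖F x‖ 0 with h0 | h0
          · rw [h0, mul_zero, Real.zero_rpow hp0.ne']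
          · rw [← Real.rpow_add_one h0]
            congr 1
            ring
      _ ≤ _ := by
          gcongr
          · linarith
          · exact hFb x
  have hafin : a ^ p ≠ ∞ := by
    rw [hap]
    exact (memLp_one_iff_integrable.2 hFpi).2.ne
  have haf : a ≠ ∞ := fun h0 => hafin (by rw [h0, ENNReal.top_rpow_of_pos hp0])
  have : ENNReal.HolderTriple (ENNReal.ofReal q) (ENNReal.ofReal p) 1 := by
    constructor
    rw [← ENNReal.ofReal_inv_of_pos hq0, ← ENNReal.ofReal_inv_of_pos hp0,
      ← ENNReal.ofReal_add (by positivity) (by positivity), add_comm, hpq.inv_add_inv_eq_one]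
    simp
  have hmain : a ^ p ≤ C * a ^ (p - 1) * eLpNorm f (ENNReal.ofReal p) volume := by
    have h1 : a ^ p = ‖∫ x, inner ℂ (h x) (F x)‖ₑ := by
      simp only [hF2]
      rw [integral_complex_ofReal, ← ofReal_norm, Complex.norm_real, Real.norm_of_nonneg
        (integral_nonneg fun x => Real.rpow_nonneg (norm_nonneg _) _), hap,
        ofReal_integral_eq_lintegral_ofReal hFpi
          (Eventually.of_forall fun x => Real.rpow_nonneg (norm_nonneg _) _),
        eLpNorm_one_eq_lintegral_enorm]
      refine lintegral_congr fun x => ?_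
      rw [Real.enorm_of_nonneg (Real.rpow_nonneg (norm_nonneg _) _)]
    rw [h1, hswap, ← hah]
    refine (enorm_integral_le_lintegral_enorm _).trans ?_
    rw [← eLpNorm_one_eq_lintegral_enorm]
    have h2 := eLpNorm_le_eLpNorm_mul_eLpNorm_of_nnnorm (r := 1) (p := ENNReal.ofReal q)
      (q := ENNReal.ofReal p) (μ := (volume : Measure (Ed d)))
      (continuous_convOp hK' hKb' hhi).aestronglyMeasurable hfc.aestronglyMeasurable
      (fun u v => inner ℂ u v) 1 (Eventually.of_forall fun y => by
        simpa using nnnorm_inner_le_nnnorm (𝕜 := ℂ) (convOp K' h y) (f y))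
    refine h2.trans ?_
    rw [ENNReal.coe_one, one_mul]
    gcongr
    exact hC h hhc hhi
  rcases eq_or_ne a 0 with h0 | h0
  · rw [h0]
    exact zero_le
  have h3 : a ^ p = a * a ^ (p - 1) := by
    conv_rhs => rw [mul_comm]; rhs; rw [← ENNReal.rpow_one a]
    rw [← ENNReal.rpow_add _ _ h0 haf, sub_add_cancel]
  rw [h3, mul_right_comm] at hmain
  exact (ENNReal.mul_le_mul_iff_left (by simp [h0, haf])
    (ENNReal.rpow_ne_top_of_nonneg (by linarith) haf)).1 hmain

end duality

section littlewoodPaley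

variable {d : ℕ}

lemma conj_dilKer {m : 𝓢(Ed d, ℂ)} (hm : ∀ ξ, (starRingEnd ℂ) (m ξ) = m ξ) (j : ℤ) (x : Ed d) :
    (starRingEnd ℂ) (dilKer m j x) = dilKer m j (-x) := by
  rw [dilKer, SchwartzMap.fourierInv_coe, Real.fourierInv_eq', Real.fourierInv_eq', ← integral_conj]
  refine integral_congr_ae (Eventually.of_forall fun v => ?_)
  simp only [smul_eq_mul, map_mul, ← Complex.exp_conj, dil_apply, hm, Complex.conj_ofReal,
    Complex.conj_I, inner_neg_right]
  congr 2
  push_cast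
  ring

theorem exists_eLpNorm_convOp_sumKer_le (hd : 1 ≤ d) (m : 𝓢(Ed d, ℂ))
    (hm : ∀ ξ, (starRingEnd ℂ) (m ξ) = m ξ) {M₀ : ℝ}
    (hM : ∀ (J : Finset ℤ) ξ, ∑ j ∈ J, ‖dil m j ξ‖ ≤ M₀) {p : ℝ} (hp : 1 < p) :
    ∃ C : ℝ≥0∞, C ≠ ∞ ∧ ∀ (H₁ H₂ : Type) [NormedAddCommGroup H₁] [InnerProductSpace ℂ H₁]
      [NormedAddCommGroup H₂] [InnerProductSpace ℂ H₂] [CompleteSpace H₁] [CompleteSpace H₂]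
      (J : Finset ℤ) (L : ℤ → H₁ →L[ℂ] H₂), (∀ j, ‖L j‖ ≤ 1) → ∀ f : Ed d → H₁,
      Continuous f → Integrable f →
      eLpNorm (convOp (sumKer m J L) f) (ENNReal.ofReal p) volume ≤
        C * eLpNorm f (ENNReal.ofReal p) volume := by
  have hM0 : 0 ≤ M₀ := by simpa using hM ∅ 0
  have lt_two : ∀ {p : ℝ}, 1 < p → p < 2 →
      ∃ C : ℝ≥0∞, C ≠ ∞ ∧ ∀ (H₁ H₂ : Type) [NormedAddCommGroup H₁] [InnerProductSpace ℂ H₁]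
      [NormedAddCommGroup H₂] [InnerProductSpace ℂ H₂] [CompleteSpace H₁] [CompleteSpace H₂]
      (J : Finset ℤ) (L : ℤ → H₁ →L[ℂ] H₂), (∀ j, ‖L j‖ ≤ 1) → ∀ f : Ed d → H₁,
      Continuous f → Integrable f →
      eLpNorm (convOp (sumKer m J L) f) (ENNReal.ofReal p) volume ≤
        C * eLpNorm f (ENNReal.ofReal p) volume := by
    intro p hp hp2
    obtain ⟨A, hA', hA⟩ := exists_isHormander_sumKer m
    set B : ℝ≥0∞ := ENNReal.ofReal M₀ ^ 2 with hB
    have hB' : B ≠ ∞ := ENNReal.pow_ne_top ENNReal.ofReal_ne_top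
    set C := ENNReal.ofReal (2 ^ p * p) * ((B * 2 ^ (2 * d) + czConst d A) * 2 *
      ENNReal.ofReal (2 ^ (p - 1) / (p - 1)) + B * ENNReal.ofReal (1 / (2 - p))) with hC
    have hC' : C ≠ ∞ := by
      have := czConst_ne_top d hA'
      have h2 : (2 : ℝ≥0∞) ^ (2 * d) ≠ ∞ := ENNReal.pow_ne_top ENNReal.ofNat_ne_top
      rw [hC]
      finiteness
    have hp0 : ENNReal.ofReal p ≠ 0 := by simpa using by linarith
    have hpr : (ENNReal.ofReal p).toReal = p := ENNReal.toReal_ofReal (by linarith)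
    refine ⟨C ^ (1 / p), ENNReal.rpow_ne_top_of_nonneg (by positivity) hC', ?_⟩
    intro H₁ H₂ _ _ _ _ _ _ J L hL f hfc hfi
    obtain ⟨M, hMb⟩ := exists_norm_sumKer_le m J L
    have := eLpNorm_le_of_lintegral_rpow_le (C := C) (μ := (volume : Measure (Ed d)))
      (f := convOp (sumKer m J L) f) (g := f) hp0 ENNReal.ofReal_ne_top ?_
    · rwa [hpr] at this
    · rw [hpr]
      refine lintegral_convOp_rpow_le_of_L2 hd (continuous_sumKer m J L) hMb (hA H₁ H₂ J L hL) hA'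
        hB' (fun g c hg hgc => ?_) hp hp2 hfc hfi
      rw [← eLpNorm_two_sq, ← eLpNorm_two_sq, hB, ← mul_pow]
      gcongr
      exact eLpNorm_two_convOp_sumKer_le m J L hL hM0 (hM J) hg (memLp_two_of_bounded hg hgc)
  rcases lt_trichotomy p 2 with hp2 | rfl | hp2
  · exact lt_two hp hp2
  · refine ⟨ENNReal.ofReal M₀ + 1, by simp, ?_⟩
    intro H₁ H₂ _ _ _ _ _ _ J L hL f hfc hfi
    rw [show ENNReal.ofReal 2 = 2 by simp]
    by_cases hf : eLpNorm f 2 volume = ∞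
    · rw [hf, ENNReal.mul_top (by simp)]
      exact le_top
    · refine (eLpNorm_two_convOp_sumKer_le m J L hL hM0 (hM J) hfi
        ⟨hfi.aestronglyMeasurable, lt_top_iff_ne_top.2 hf⟩).trans ?_
      gcongr
      exact le_self_add
  · set q := p.conjExponent with hq
    have hpq : p.HolderConjugate q := Real.HolderConjugate.conjExponent hp
    have hq2 : q < 2 := by
      have := hpq.sub_one_mul_conj
      nlinarith
    obtain ⟨C, hC, h⟩ := lt_two hpq.symm.lt hq2
    refine ⟨C, hC, ?_⟩
    intro H₁ H₂ _ _ _ _ _ _ J L hL f hfc hfi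
    set L' : ℤ → H₂ →L[ℂ] H₁ := fun j => ContinuousLinearMap.adjoint (L j) with hL'
    obtain ⟨M, hM1⟩ := exists_norm_sumKer_le m J L
    obtain ⟨M', hM2⟩ := exists_norm_sumKer_le m J L'
    refine eLpNorm_convOp_le_of_adjoint (continuous_sumKer m J L) (continuous_sumKer m J L')
      (fun x => (hM1 x).trans (le_max_left M M')) (fun x => (hM2 x).trans (le_max_right M M'))
      (memLp_one_iff_integrable.1 (memLp_sumKer m J L 1)) (fun z v w => ?_) hp2 hpq
      (fun g hgc hgi => h H₂ H₁ J L' (fun j => ?_) g hgc hgi) hfc hfi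
    · simp only [sumKer, sum_apply, inner_sum, sum_inner]
      refine Finset.sum_congr rfl fun j _ => ?_
      rw [smul_apply, smul_apply, inner_smul_left,
        inner_smul_right, conj_dilKer hm, neg_neg, hL', ContinuousLinearMap.adjoint_inner_left]
    · rw [hL']
      exact (LinearIsometryEquiv.norm_map _ _).trans_le (hL j)

end littlewoodPaley

section maximal

variable {d : ℕ}

lemma exists_eLpNorm_sup_mulOp_le (hd : 1 ≤ d) (m : 𝓢(Ed d, ℂ)) {p : ℝ≥0∞} (hp : 1 < p) :
    ∃ C : ℝ≥0∞, C ≠ ∞ ∧ ∀ (J : Finset ℤ) (f : Ed d → ℂ), Continuous f → Integrable f →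
      eLpNorm (fun x (j : J) => mulOp m j f x) p volume ≤ C * eLpNorm f p volume := by
  set B : ℝ := ∫ x, ‖(𝓕⁻ m : 𝓢(Ed d, ℂ)) x‖ with hB
  have hB0 : 0 ≤ B := by positivity
  have hsup : ∀ (J : Finset ℤ) (f : Ed d → ℂ) (c : ℝ), 0 ≤ c → (∀ᵐ x, ‖f x‖ ≤ c) → ∀ x,
      ‖fun j : J => mulOp m j f x‖ ≤ B * c := fun J f c hc hfc x =>
    (pi_norm_le_iff_of_nonneg (by positivity)).2 fun j => norm_mulOp_le m j hfc x
  rcases eq_or_ne p ∞ with rfl | hp'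
  · refine ⟨ENNReal.ofReal B + 1, by simp, fun J f hfc hfi => ?_⟩
    by_cases hf : eLpNorm f ∞ volume = ∞
    · rw [hf, ENNReal.mul_top (by simp)]
      exact le_top
    · have h1 : ∀ᵐ x, ‖f x‖ ≤ (eLpNorm f ∞ volume).toReal := by
        filter_upwards [ae_le_eLpNormEssSup (f := f) (μ := (volume : Measure (Ed d)))] with x hx
        rw [← eLpNorm_exponent_top] at hx
        simpa using ENNReal.toReal_mono hf hx
      have h2 := eLpNormEssSup_le_of_ae_bound (μ := (volume : Measure (Ed d)))
        (Eventually.of_forall (hsup J f _ ENNReal.toReal_nonneg h1))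
      rw [← eLpNorm_exponent_top, ENNReal.ofReal_mul hB0, ENNReal.ofReal_toReal hf] at h2
      refine h2.trans ?_
      gcongr
      exact le_self_add
  · obtain ⟨A, hA', hA⟩ := exists_isHormander_sumKer m
    have hpr : 1 < p.toReal := by
      rw [← ENNReal.toReal_one]
      exact (ENNReal.toReal_lt_toReal ENNReal.one_ne_top hp').2 hp
    set q := p.toReal with hq
    set C := ENNReal.ofReal ((B * 2 ^ d + 1) ^ q * q) * (czConst d A * 2 *
      ENNReal.ofReal (2 ^ (q - 1) / (q - 1)) + 0 * ENNReal.ofReal (1 / (2 - q))) with hC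
    have hC' : C ≠ ∞ := by
      have := czConst_ne_top d hA'
      rw [hC]
      finiteness
    have hp0 : p ≠ 0 := (zero_lt_one.trans hp).ne'
    refine ⟨C ^ (1 / q), ENNReal.rpow_ne_top_of_nonneg (by positivity) hC',
      fun J f hfc hfi => ?_⟩
    set L : ℤ → ℂ →L[ℂ] (J → ℂ) := fun j =>
      if hj : j ∈ J then ContinuousLinearMap.single ℂ (fun _ : J => ℂ) ⟨j, hj⟩ else 0 with hL
    have hLn : ∀ j, ‖L j‖ ≤ 1 := fun j => by
      refine ContinuousLinearMap.opNorm_le_bound _ zero_le_one fun z => ?_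
      by_cases hj : j ∈ J
      · rw [one_mul, pi_norm_le_iff_of_nonneg (norm_nonneg _)]
        intro k
        by_cases hk : k = ⟨j, hj⟩
        · simp [hL, hj, hk]
        · simp [hL, hj, hk]
      · simp [hL, hj]
    have hLe : ∀ g : Ed d → ℂ, Integrable g →
        convOp (sumKer m J L) g = fun x (j : J) => mulOp m j g x := fun g hg => by
      funext x k
      rw [convOp_sumKer_eq_sum m J L hg, Finset.sum_apply, Finset.sum_eq_single (k : ℤ)]
      · simp [hL]
      · intro j hj hjk
        have : k ≠ ⟨j, hj⟩ := fun h => hjk (by rw [h])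
        simp [hL, hj, this]
      · simp
    obtain ⟨M, hMb⟩ := exists_norm_sumKer_le m J L
    rw [← hLe f hfi]
    refine eLpNorm_le_of_lintegral_rpow_le hp0 hp' ?_
    refine lintegral_convOp_rpow_le_of_sup hd (continuous_sumKer m J L) hMb (hA ℂ (J → ℂ) J L hLn)
      hA' hB0 (fun g c hg hgc x => ?_) hpr hfc hfi
    rw [hLe g hg]
    exact hsup J g c ((norm_nonneg _).trans (hgc 0)) (Eventually.of_forall hgc) x

end maximal

section squareFunction

variable {d : ℕ}

/-- `x ↦ (u j x)_{j ∈ J}` as a function with values in `ℓ²(J)`. -/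
def ell2 (J : Finset ℤ) (u : ℤ → Ed d → ℂ) (x : Ed d) : EuclideanSpace ℂ J :=
  WithLp.toLp 2 fun j => u j x

lemma ell2_apply (J : Finset ℤ) (u : ℤ → Ed d → ℂ) (x : Ed d) (j : J) : ell2 J u x j = u j x := rfl

lemma continuous_ell2 (J : Finset ℤ) {u : ℤ → Ed d → ℂ} (hu : ∀ j, Continuous (u j)) :
    Continuous (ell2 J u) :=
  (PiLp.continuous_toLp 2 _).comp (continuous_pi fun j => hu j)

lemma integrable_ell2 (J : Finset ℤ) {u : ℤ → Ed d → ℂ} (hu : ∀ j, Continuous (u j))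
    (hi : ∀ j, Integrable (u j)) : Integrable (ell2 J u) := by
  have h : Integrable fun x => ∑ j : J, ‖u j x‖ := integrable_finsetSum _ fun j _ => (hi j).norm
  refine h.mono' (continuous_ell2 J hu).aestronglyMeasurable (Eventually.of_forall fun x => ?_)
  have h2 : ell2 J u x = ∑ j : J, u j x • EuclideanSpace.single j (1 : ℂ) := by
    ext k
    simp [ell2_apply, Finset.sum_apply, Pi.single_apply]
  rw [h2]
  refine (norm_sum_le _ _).trans (Finset.sum_le_sum fun j _ => ?_)
  rw [norm_smul]
  simp

theorem exists_eLpNorm_ell2_mulOp_le (hd : 1 ≤ d) (m : 𝓢(Ed d, ℂ))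
    (hm : ∀ ξ, (starRingEnd ℂ) (m ξ) = m ξ) {M₀ : ℝ}
    (hM : ∀ (J : Finset ℤ) ξ, ∑ j ∈ J, ‖dil m j ξ‖ ≤ M₀) {p : ℝ} (hp : 1 < p) :
    ∃ C : ℝ≥0∞, C ≠ ∞ ∧ ∀ (J : Finset ℤ) (f : Ed d → ℂ), Continuous f → Integrable f →
      eLpNorm (ell2 J fun j => mulOp m j f) (ENNReal.ofReal p) volume ≤
        C * eLpNorm f (ENNReal.ofReal p) volume := by
  obtain ⟨C, hC, h⟩ := exists_eLpNorm_convOp_sumKer_le hd m hm hM hp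
  refine ⟨C, hC, fun J f hfc hfi => ?_⟩
  set L : ℤ → ℂ →L[ℂ] EuclideanSpace ℂ J := fun j =>
    if hj : j ∈ J then ContinuousLinearMap.toSpanSingleton ℂ (EuclideanSpace.single ⟨j, hj⟩ (1 : ℂ))
    else 0 with hL
  have hLn : ∀ j, ‖L j‖ ≤ 1 := fun j => by
    by_cases hj : j ∈ J <;> simp [hL, hj]
  have hLe : convOp (sumKer m J L) f = ell2 J fun j => mulOp m j f := by
    funext x
    ext k
    rw [convOp_sumKer_eq_sum m J L hfi, ell2_apply, WithLp.ofLp_sum, Finset.sum_apply,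
      Finset.sum_eq_single (k : ℤ)]
    · simp [hL]
    · intro j hj hjk
      have : k ≠ ⟨j, hj⟩ := fun h => hjk (by rw [h])
      simp [hL, hj, this]
    · simp
  rw [← hLe]
  exact h ℂ _ J L hLn f hfc hfi

theorem exists_eLpNorm_sum_mulOp_le (hd : 1 ≤ d) (m : 𝓢(Ed d, ℂ))
    (hm : ∀ ξ, (starRingEnd ℂ) (m ξ) = m ξ) {M₀ : ℝ}
    (hM : ∀ (J : Finset ℤ) ξ, ∑ j ∈ J, ‖dil m j ξ‖ ≤ M₀) {p : ℝ} (hp : 1 < p) :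
    ∃ C : ℝ≥0∞, C ≠ ∞ ∧ ∀ (J : Finset ℤ) (l : ℤ) (u : ℤ → Ed d → ℂ), (∀ j, Continuous (u j)) →
      (∀ j, Integrable (u j)) →
      eLpNorm (fun x => ∑ j ∈ J, mulOp m (j + l) (u j) x) (ENNReal.ofReal p) volume ≤
        C * eLpNorm (ell2 J u) (ENNReal.ofReal p) volume := by
  obtain ⟨C, hC, h⟩ := exists_eLpNorm_convOp_sumKer_le hd m hm hM hp
  refine ⟨C, hC, fun J l u huc hui => ?_⟩
  set L : ℤ → EuclideanSpace ℂ J →L[ℂ] ℂ := fun j =>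
    if hj : j - l ∈ J then EuclideanSpace.proj (⟨j - l, hj⟩ : J) else 0 with hL
  have hLn : ∀ j, ‖L j‖ ≤ 1 := fun j => by
    refine ContinuousLinearMap.opNorm_le_bound _ zero_le_one fun v => ?_
    by_cases hj : j - l ∈ J
    · simpa [hL, hj] using PiLp.norm_apply_le v _
    · simp [hL, hj]
  have hi := integrable_ell2 J huc hui
  have hLe : convOp (sumKer m (J.map (addRightEmbedding l)) L) (ell2 J u) =
      fun x => ∑ j ∈ J, mulOp m (j + l) (u j) x := by
    funext x
    rw [convOp_sumKer m _ L hi, Finset.sum_map]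
    refine Finset.sum_congr rfl fun j hj => ?_
    rw [mulOp]
    refine integral_congr_ae (Eventually.of_forall fun y => ?_)
    simp [hL, hj, ell2_apply]
  rw [← hLe]
  exact h _ ℂ _ L hLn _ (continuous_ell2 J huc) hi

end squareFunction

section symbols

variable {d : ℕ}

/-- The Schwartz function `|ξ|^a ψ(ξ)`, for `ψ` supported in an annulus. -/
lemma exists_rpow_norm_mul (ψ : 𝓢(Ed d, ℂ)) (hψ : ∀ ξ, ψ ξ ≠ 0 → 1 / 2 ≤ ‖ξ‖ ∧ ‖ξ‖ ≤ 2) (a : ℝ) :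
    ∃ θ : 𝓢(Ed d, ℂ), ∀ ξ, θ ξ = ((‖ξ‖ ^ a : ℝ) : ℂ) * ψ ξ := by
  have hc : HasCompactSupport fun ξ => ((‖ξ‖ ^ a : ℝ) : ℂ) * ψ ξ := by
    refine HasCompactSupport.of_support_subset_isCompact (isCompact_closedBall (0 : Ed d) 2)
      fun ξ hξ => ?_
    have := hψ ξ (right_ne_zero_of_mul hξ)
    simpa using this.2
  have hs : ContDiff ℝ (⊤ : ℕ∞) fun ξ => ((‖ξ‖ ^ a : ℝ) : ℂ) * ψ ξ := by
    rw [contDiff_iff_contDiffAt]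
    intro ξ
    rcases eq_or_ne ξ 0 with rfl | h
    · refine (contDiffAt_const (c := (0 : ℂ))).congr_of_eventuallyEq ?_
      filter_upwards [Metric.ball_mem_nhds (0 : Ed d) (show (0 : ℝ) < 1 / 2 by norm_num)] with η hη
      have : ψ η = 0 := by
        by_contra h
        have := (hψ η h).1
        rw [Metric.mem_ball, dist_zero_right] at hη
        linarith
      simp [this]
    · refine ContDiffAt.mul ?_ ψ.smooth'.contDiffAt
      exact Complex.ofRealCLM.contDiff.contDiffAt.comp ξ
        ((contDiffAt_norm ℝ h).rpow_const_of_ne (norm_ne_zero_iff.2 h))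
  exact ⟨hc.toSchwartzMap hs, fun ξ => rfl⟩

lemma exists_sum_dil_le (m : 𝓢(Ed d, ℂ)) (hm : ∀ ξ, m ξ ≠ 0 → 1 / 2 ≤ ‖ξ‖ ∧ ‖ξ‖ ≤ 2) :
    ∃ M₀ : ℝ, ∀ (J : Finset ℤ) ξ, ∑ j ∈ J, ‖dil m j ξ‖ ≤ M₀ := by
  obtain ⟨C, hC, h⟩ := exists_sum_min_le
  obtain ⟨B, hB, hb, _⟩ := exists_decay m 0
  refine ⟨2 * B * C, fun J ξ => ?_⟩
  have h1 : ∀ η, ‖m η‖ ≤ 2 * B * min ‖η‖ ‖η‖⁻¹ := fun η => by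
    rcases eq_or_ne (m η) 0 with h0 | h0
    · rw [h0, norm_zero]
      positivity
    · obtain ⟨h2, h3⟩ := hm η h0
      have h4 : 1 / 2 ≤ min ‖η‖ ‖η‖⁻¹ := le_min h2 (by
        rw [one_div]
        gcongr)
      have h5 := hb η
      simp only [pow_zero, inv_one, mul_one] at h5
      nlinarith
  rcases eq_or_ne ξ 0 with rfl | hξ
  · refine (Finset.sum_nonpos fun j _ => ?_).trans (by positivity)
    rw [dil_apply, smul_zero]
    simpa using h1 0
  · calc ∑ j ∈ J, ‖dil m j ξ‖ ≤ ∑ j ∈ J, 2 * B * min ((2 : ℝ) ^ (-j) * ‖ξ‖) ((2 : ℝ) ^ (-j) * ‖ξ‖)⁻¹ := by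
          refine Finset.sum_le_sum fun j _ => ?_
          have := h1 ((2 : ℝ) ^ (-j) • ξ)
          rwa [norm_smul, Real.norm_of_nonneg (by positivity)] at this
      _ = 2 * B * ∑ j ∈ J.map (Equiv.neg ℤ).toEmbedding,
            min ((2 : ℝ) ^ j * ‖ξ‖) ((2 : ℝ) ^ j * ‖ξ‖)⁻¹ := by
          rw [Finset.sum_map, Finset.mul_sum]
          rfl
      _ ≤ 2 * B * C := by
          gcongr
          exact h _ _ (norm_pos_iff.2 hξ)

/-- A real-valued bump function equal to `1` on the unit ball and supported in the ball of
radius `2`. -/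
lemma exists_bump (d : ℕ) : ∃ φ : 𝓢(Ed d, ℂ), (∀ ξ, (starRingEnd ℂ) (φ ξ) = φ ξ) ∧
    (∀ ξ, ‖φ ξ‖ ≤ 1) ∧ (∀ ξ, ‖ξ‖ ≤ 1 → φ ξ = 1) ∧ ∀ ξ, 2 ≤ ‖ξ‖ → φ ξ = 0 := by
  let b : ContDiffBump (0 : Ed d) := ⟨1, 2, by norm_num, by norm_num⟩
  have hc : HasCompactSupport fun ξ => ((b ξ : ℝ) : ℂ) :=
    b.hasCompactSupport.comp_left (g := fun t : ℝ => (t : ℂ)) Complex.ofReal_zero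
  have hs : ContDiff ℝ (⊤ : ℕ∞) fun ξ => ((b ξ : ℝ) : ℂ) :=
    Complex.ofRealCLM.contDiff.comp b.contDiff
  refine ⟨hc.toSchwartzMap hs, fun ξ => Complex.conj_ofReal _, fun ξ => ?_, fun ξ hξ => ?_,
    fun ξ hξ => ?_⟩
  · change ‖((b ξ : ℝ) : ℂ)‖ ≤ 1
    rw [Complex.norm_real, Real.norm_of_nonneg b.nonneg]
    exact b.le_one
  · change ((b ξ : ℝ) : ℂ) = 1
    rw [b.one_of_mem_closedBall (by simpa using hξ), Complex.ofReal_one]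
  · change ((b ξ : ℝ) : ℂ) = 0
    rw [b.zero_of_le_dist (by simpa using hξ), Complex.ofReal_zero]

end symbols

section fourierSide

variable {d : ℕ}

/-- `|D|^s` in the normalisation of `Real.fourierIntegral`. -/
def rieszF (s : ℝ) (u : Ed d → ℂ) : Ed d → ℂ :=
  𝓕⁻ fun ξ => ((‖ξ‖ ^ s : ℝ) : ℂ) * 𝓕 u ξ

lemma rieszD_eq (s : ℝ) (u : Ed d → ℂ) :
    rieszD d s u = fun x => (((2 * Real.pi) ^ s : ℝ) : ℂ) * rieszF s u x := by
  have hpi : (0 : ℝ) < 2 * Real.pi := by positivity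
  have hFT : ∀ η : Ed d, FT d u ((2 * Real.pi) • η) = 𝓕 u η := fun η => by
    rw [FT, Real.fourier_eq']
    refine integral_congr_ae (Eventually.of_forall fun v => ?_)
    simp only [real_inner_smul_right, smul_eq_mul]
    congr 2
    push_cast
    ring
  funext x
  rw [rieszD, FTinv, rieszF, Real.fourierInv_eq']
  have h := Measure.integral_comp_smul_of_nonneg (volume : Measure (Ed d))
    (fun ξ => Complex.exp (Complex.I * ((inner ℝ x ξ : ℝ) : ℂ)) * (((‖ξ‖ ^ s : ℝ) : ℂ) * FT d u ξ))
    (2 * Real.pi) (hR := hpi.le)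
  rw [finrank_euclideanSpace_fin] at h
  have h2 : ∀ y : ℂ, (((2 * Real.pi) ^ d : ℝ) : ℂ)⁻¹ * y = ((2 * Real.pi) ^ d)⁻¹ • y := fun y => by
    rw [Complex.real_smul]
    push_cast
    rfl
  rw [h2, ← h, ← integral_const_mul]
  refine integral_congr_ae (Eventually.of_forall fun η => ?_)
  simp only [hFT, norm_smul, real_inner_smul_right, smul_eq_mul, Real.norm_of_nonneg hpi.le,
    Real.mul_rpow hpi.le (norm_nonneg _), real_inner_comm]
  rw [show Complex.I * ((2 * Real.pi * inner ℝ x η : ℝ) : ℂ) =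
    ((2 * Real.pi * inner ℝ x η : ℝ) : ℂ) * Complex.I by ring]
  push_cast
  ring

lemma apply_eq_fourierInv (u : 𝓢(Ed d, ℂ)) (x : Ed d) :
    u x = 𝓕⁻ (fun ξ => (𝓕 u : 𝓢(Ed d, ℂ)) ξ) x := by
  have : u = 𝓕⁻ (𝓕 u : 𝓢(Ed d, ℂ)) := by simp
  conv_lhs => rw [this]
  rw [SchwartzMap.fourierInv_coe]

lemma tendsto_fourierInv {w : ℕ → Ed d → ℂ} {v : Ed d → ℂ} {b : Ed d → ℝ} (hb : Integrable b)
    (hw : ∀ n, AEStronglyMeasurable (w n) volume) (hwb : ∀ n, ∀ᵐ ξ, ‖w n ξ‖ ≤ b ξ)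
    (hv : ∀ᵐ ξ, Tendsto (fun n => w n ξ) atTop (nhds (v ξ))) (x : Ed d) :
    Tendsto (fun n => 𝓕⁻ (w n) x) atTop (nhds (𝓕⁻ v x)) := by
  simp only [Real.fourierInv_eq']
  refine tendsto_integral_of_dominated_convergence b (fun n => ?_) hb (fun n => ?_) ?_
  · have hE : Continuous fun v : Ed d => Complex.exp (↑(2 * Real.pi * inner ℝ v x) * Complex.I) := by
      fun_prop
    exact hE.aestronglyMeasurable.smul (hw n)
  · filter_upwards [hwb n] with ξ hξ
    rw [norm_smul, Complex.norm_exp_ofReal_mul_I, one_mul]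
    exact hξ
  · filter_upwards [hv] with ξ hξ
    exact hξ.const_smul _

/-- Fourier multipliers act on inverse Fourier transforms of integrable functions. -/
lemma mulOp_fourierInv (m : 𝓢(Ed d, ℂ)) (j : ℤ) {h : Ed d → ℂ} (hh : Integrable h) (x : Ed d) :
    mulOp m j (𝓕⁻ h) x = 𝓕⁻ (fun ξ => dil m j ξ * h ξ) x := by
  set E : Ed d → Ed d → ℂ := fun v w => Complex.exp (↑(2 * Real.pi * inner ℝ v w) * Complex.I) with hE
  have hEc : Continuous fun z : Ed d × Ed d => E z.2 z.1 := by
    rw [hE]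
    fun_prop
  have hinv : ∀ (u : Ed d → ℂ) w, 𝓕⁻ u w = ∫ v, E v w * u v := fun u w => Real.fourierInv_eq' u w
  have hk : ∀ η, ∫ y, dilKer m j (x - y) * E η y = E η x * dil m j η := fun η => by
    have h1 : dil m j = 𝓕 (dilKer m j) := by simp [dilKer]
    rw [h1, SchwartzMap.fourier_coe, Real.fourier_eq', ← integral_const_mul,
      ← integral_sub_left_eq_self _ volume x]
    refine integral_congr_ae (Eventually.of_forall fun y => ?_)
    simp only [sub_sub_cancel, hE, smul_eq_mul]
    rw [← mul_assoc, ← Complex.exp_add, mul_comm]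
    congr 2
    rw [inner_sub_right, real_inner_comm η y]
    push_cast
    ring
  have hprod : Integrable (fun z : Ed d × Ed d => dilKer m j (x - z.1) * (E z.2 z.1 * h z.2))
      (volume.prod volume) := by
    have h0 : Integrable (fun z : Ed d × Ed d => dilKer m j (x - z.1) * h z.2)
      (volume.prod volume) := ((dilKer m j).integrable.comp_sub_left x).mul_prod hh
    refine h0.norm.mono' ?_ (Eventually.of_forall fun z => ?_)
    · have := hEc.aestronglyMeasurable (μ := (volume : Measure (Ed d)).prod volume).mul
        h0.aestronglyMeasurable
      refine this.congr (Eventually.of_forall fun z => ?_)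
      simp only [Pi.mul_apply]
      ring
    · simp only [norm_mul, hE, Complex.norm_exp_ofReal_mul_I, one_mul, le_refl]
  rw [mulOp, hinv]
  simp only [hinv, smul_eq_mul, ← integral_const_mul]
  rw [integral_integral_swap hprod]
  refine integral_congr_ae (Eventually.of_forall fun η => ?_)
  simp only [← mul_assoc]
  rw [integral_mul_const, hk]

/-- Pointwise product of Schwartz functions. -/
def schMul (f g : 𝓢(Ed d, ℂ)) : 𝓢(Ed d, ℂ) := SchwartzMap.pairing (ContinuousLinearMap.mul ℂ ℂ) f g

lemma schMul_apply (f g : 𝓢(Ed d, ℂ)) (x : Ed d) : schMul f g x = f x * g x := rfl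

lemma fourier_neg_apply (f : 𝓢(Ed d, ℂ)) (x : Ed d) :
    (𝓕⁻ f : 𝓢(Ed d, ℂ)) (-x) = (𝓕 f : 𝓢(Ed d, ℂ)) x := by
  rw [SchwartzMap.fourierInv_coe, SchwartzMap.fourier_coe, Real.fourierInv_eq_fourier_neg, neg_neg]

lemma fourier_schMul (f g : 𝓢(Ed d, ℂ)) (ξ : Ed d) :
    (𝓕 (schMul f g) : 𝓢(Ed d, ℂ)) ξ =
      ∫ t, (𝓕 f : 𝓢(Ed d, ℂ)) t * (𝓕 g : 𝓢(Ed d, ℂ)) (ξ - t) := by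
  have h : (𝓕⁻ (schMul f g) : 𝓢(Ed d, ℂ)) =
      SchwartzMap.convolution (ContinuousLinearMap.mul ℂ ℂ) (𝓕⁻ f) (𝓕⁻ g) := by
    have := SchwartzMap.fourier_convolution (ContinuousLinearMap.mul ℂ ℂ) (𝓕⁻ f) (𝓕⁻ g)
    simp only [FourierTransform.fourier_fourierInv_eq] at this
    rw [schMul, ← this]
    simp
  rw [← fourier_neg_apply, h, SchwartzMap.convolution_apply, MeasureTheory.convolution,
    ← integral_neg_eq_self]
  refine integral_congr_ae (Eventually.of_forall fun t => ?_)
  simp only [ContinuousLinearMap.mul_apply', fourier_neg_apply]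
  rw [show -ξ - -t = -(ξ - t) by abel, fourier_neg_apply]

lemma integrable_one_add_norm_rpow_mul (f : 𝓢(Ed d, ℂ)) (s : ℝ) :
    Integrable fun t => (1 + ‖t‖) ^ s * ‖f t‖ := by
  obtain ⟨k, hk⟩ := exists_nat_ge (s + d + 1)
  obtain ⟨C, hC, h, _⟩ := exists_decay f k
  have h1 : Integrable fun t : Ed d => C * (1 + ‖t‖) ^ (-(d + 1 : ℝ)) :=
    (integrable_one_add_norm (by simp)).const_mul C
  have hpos : ∀ t : Ed d, 0 < 1 + ‖t‖ := fun t => by positivity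
  refine h1.mono' (Continuous.aestronglyMeasurable ?_) (Eventually.of_forall fun t => ?_)
  · exact ((continuous_const.add continuous_norm).rpow_const fun t => Or.inl (hpos t).ne').mul
      f.continuous.norm
  · rw [Real.norm_of_nonneg (by positivity)]
    calc (1 + ‖t‖) ^ s * ‖f t‖ ≤ (1 + ‖t‖) ^ s * (C * ((1 + ‖t‖) ^ k)⁻¹) := by
          gcongr
          exact h t
      _ = C * (1 + ‖t‖) ^ (s - k) := by
          rw [Real.rpow_sub (hpos t), Real.rpow_natCast]
          ring
      _ ≤ _ := by
          gcongr
          · linarith [norm_nonneg t]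
          · linarith

lemma integrable_rpow_norm_mul (f : 𝓢(Ed d, ℂ)) {s : ℝ} (hs : 0 ≤ s) :
    Integrable fun t => ((‖t‖ ^ s : ℝ) : ℂ) * f t := by
  refine (integrable_one_add_norm_rpow_mul f s).mono' (Continuous.aestronglyMeasurable ?_)
    (Eventually.of_forall fun t => ?_)
  · exact (Complex.continuous_ofReal.comp (continuous_norm.rpow_const fun _ => Or.inr hs)).mul
      f.continuous
  · rw [norm_mul, Complex.norm_real, Real.norm_of_nonneg (by positivity)]
    gcongr
    linarith

theorem tendsto_rieszF_schMul {s : ℝ} (hs : 0 ≤ s) {f g : 𝓢(Ed d, ℂ)} {F G : ℕ → 𝓢(Ed d, ℂ)} {c : ℂ}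
    (hF : ∀ n ξ, ‖(𝓕 (F n) : 𝓢(Ed d, ℂ)) ξ‖ ≤ ‖(𝓕 f : 𝓢(Ed d, ℂ)) ξ‖)
    (hG : ∀ n ξ, ‖(𝓕 (G n) : 𝓢(Ed d, ℂ)) ξ‖ ≤ ‖(𝓕 g : 𝓢(Ed d, ℂ)) ξ‖)
    (hFl : ∀ᵐ ξ, Tendsto (fun n => (𝓕 (F n) : 𝓢(Ed d, ℂ)) ξ) atTop
      (nhds (c * (𝓕 f : 𝓢(Ed d, ℂ)) ξ)))
    (hGl : ∀ᵐ ξ, Tendsto (fun n => (𝓕 (G n) : 𝓢(Ed d, ℂ)) ξ) atTop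
      (nhds (c * (𝓕 g : 𝓢(Ed d, ℂ)) ξ))) (x : Ed d) :
    Tendsto (fun n => rieszF s (schMul (F n) (G n)) x) atTop
      (nhds (c ^ 2 * rieszF s (schMul f g) x)) := by
  set f' : 𝓢(Ed d, ℂ) := 𝓕 f
  set g' : 𝓢(Ed d, ℂ) := 𝓕 g
  have hconst : c ^ 2 * rieszF s (schMul f g) x =
      𝓕⁻ (fun ξ => ((‖ξ‖ ^ s : ℝ) : ℂ) * (c ^ 2 * (𝓕 (schMul f g) : 𝓢(Ed d, ℂ)) ξ)) x := by
    rw [rieszF, Real.fourierInv_eq', Real.fourierInv_eq', ← integral_const_mul]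
    refine integral_congr_ae (Eventually.of_forall fun ξ => ?_)
    simp only [smul_eq_mul, SchwartzMap.fourier_coe]
    ring
  rw [hconst]
  have hwf := integrable_one_add_norm_rpow_mul f' s
  have hwg := integrable_one_add_norm_rpow_mul g' s
  have hconv := hwf.convolution_integrand (ContinuousLinearMap.mul ℝ ℝ) hwg
  simp only [ContinuousLinearMap.mul_apply'] at hconv
  have hb : ∀ n ξ t, ‖(𝓕 (F n) : 𝓢(Ed d, ℂ)) t * (𝓕 (G n) : 𝓢(Ed d, ℂ)) (ξ - t)‖ ≤
      ‖f' t‖ * ‖g' (ξ - t)‖ := fun n ξ t => by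
    rw [norm_mul]
    exact mul_le_mul (hF n t) (hG n _) (norm_nonneg _) (norm_nonneg _)
  have hfg : ∀ ξ, Integrable fun t => ‖f' t‖ * ‖g' (ξ - t)‖ := fun ξ => by
    obtain ⟨C, _, hC, _⟩ := exists_decay g' 0
    refine f'.integrable.norm.mul_bdd (c := C) ?_ (Eventually.of_forall fun t => ?_)
    · exact (g'.continuous.comp (continuous_const.sub continuous_id)).norm.aestronglyMeasurable
    · simpa using hC (ξ - t)
  refine tendsto_fourierInv hconv.integral_prod_left (fun n => ?_) (fun n => ?_) ?_ x
  · exact ((Complex.continuous_ofReal.comp (continuous_norm.rpow_const fun _ => Or.inr hs)).mul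
      (by rw [← SchwartzMap.fourier_coe]; exact SchwartzMap.continuous _)).aestronglyMeasurable
  · filter_upwards [hconv.prod_right_ae] with ξ hξ
    rw [← SchwartzMap.fourier_coe, fourier_schMul, ← integral_const_mul]
    refine norm_integral_le_of_norm_le hξ (Eventually.of_forall fun t => ?_)
    rw [norm_mul, Complex.norm_real, Real.norm_of_nonneg (by positivity)]
    have h1 : ‖ξ‖ ^ s ≤ (1 + ‖t‖) ^ s * (1 + ‖ξ - t‖) ^ s := by
      rw [← Real.mul_rpow (by positivity) (by positivity)]
      gcongr
      have : ‖ξ‖ ≤ ‖t‖ + ‖ξ - t‖ := by simpa using norm_add_le t (ξ - t)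
      nlinarith [norm_nonneg t, norm_nonneg (ξ - t)]
    calc _ ≤ ((1 + ‖t‖) ^ s * (1 + ‖ξ - t‖) ^ s) * (‖f' t‖ * ‖g' (ξ - t)‖) := by
          gcongr
          exact hb n ξ t
      _ = _ := by ring
  · refine Eventually.of_forall fun ξ => ?_
    refine Tendsto.const_mul _ ?_
    simp only [← SchwartzMap.fourier_coe, fourier_schMul]
    rw [← integral_const_mul]
    refine tendsto_integral_of_dominated_convergence _ (fun n => ?_) (hfg ξ)
      (fun n => Eventually.of_forall (hb n ξ)) ?_
    · exact ((SchwartzMap.continuous _).mul ((SchwartzMap.continuous _).comp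
        (continuous_const.sub continuous_id))).aestronglyMeasurable
    · filter_upwards [hFl, (Measure.measurePreserving_sub_left volume ξ).quasiMeasurePreserving.ae hGl]
        with t h1 h2
      convert h1.mul h2 using 2
      ring

end fourierSide

section littlewoodPaley

variable {d : ℕ}

/-- `mulOp`, on Schwartz functions. -/
def mulS (m : 𝓢(Ed d, ℂ)) (j : ℤ) (f : 𝓢(Ed d, ℂ)) : 𝓢(Ed d, ℂ) :=
  sumOp m {j} (fun _ => ContinuousLinearMap.id ℂ ℂ) f

lemma mulS_apply (m : 𝓢(Ed d, ℂ)) (j : ℤ) (f : 𝓢(Ed d, ℂ)) (x : Ed d) :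
    mulS m j f x = mulOp m j f x := by
  rw [mulS, sumOp_apply, convOp_sumKer_eq_sum _ _ _ f.integrable]
  simp

lemma coe_mulS (m : 𝓢(Ed d, ℂ)) (j : ℤ) (f : 𝓢(Ed d, ℂ)) : ⇑(mulS m j f) = mulOp m j f :=
  funext (mulS_apply m j f)

lemma fourier_mulS (m : 𝓢(Ed d, ℂ)) (j : ℤ) (f : 𝓢(Ed d, ℂ)) (ξ : Ed d) :
    (𝓕 (mulS m j f) : 𝓢(Ed d, ℂ)) ξ = dil m j ξ * (𝓕 f : 𝓢(Ed d, ℂ)) ξ := by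
  rw [mulS, fourier_sumOp]
  simp

lemma eq_of_fourier_eq {u v : 𝓢(Ed d, ℂ)}
    (h : ∀ ξ, (𝓕 u : 𝓢(Ed d, ℂ)) ξ = (𝓕 v : 𝓢(Ed d, ℂ)) ξ) : u = v := by
  ext x
  rw [apply_eq_fourierInv u, apply_eq_fourierInv v]
  simp only [h]

lemma fourier_sub_apply (u v : 𝓢(Ed d, ℂ)) (ξ : Ed d) :
    (𝓕 (u - v) : 𝓢(Ed d, ℂ)) ξ = (𝓕 u : 𝓢(Ed d, ℂ)) ξ - (𝓕 v : 𝓢(Ed d, ℂ)) ξ := by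
  rw [sub_eq_add_neg, FourierTransform.fourier_add, FourierTransform.fourier_neg]
  simp [sub_eq_add_neg]

lemma fourier_sum_apply {ι : Type*} (J : Finset ι) (u : ι → 𝓢(Ed d, ℂ)) (ξ : Ed d) :
    (𝓕 (∑ j ∈ J, u j) : 𝓢(Ed d, ℂ)) ξ = ∑ j ∈ J, (𝓕 (u j) : 𝓢(Ed d, ℂ)) ξ := by
  have h : (𝓕 (∑ j ∈ J, u j) : 𝓢(Ed d, ℂ)) = ∑ j ∈ J, 𝓕 (u j) :=
    map_sum (FourierTransform.fourierCLM ℂ 𝓢(Ed d, ℂ)) u J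
  rw [h, sum_apply]

lemma fourier_smul_apply (c : ℂ) (u : 𝓢(Ed d, ℂ)) (ξ : Ed d) :
    (𝓕 (c • u) : 𝓢(Ed d, ℂ)) ξ = c * (𝓕 u : 𝓢(Ed d, ℂ)) ξ := by
  rw [FourierTransform.fourier_smul]
  simp

/-- Young's inequality for the operators `mulOp`. -/
lemma eLpNorm_mulOp_le (m : 𝓢(Ed d, ℂ)) (j : ℤ) {u : Ed d → ℂ} (hu : AEStronglyMeasurable u volume)
    {p : ℝ} (hp : 1 < p) : eLpNorm (mulOp m j u) (ENNReal.ofReal p) volume ≤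
      ENNReal.ofReal (∫ x, ‖(𝓕⁻ m : 𝓢(Ed d, ℂ)) x‖) * eLpNorm u (ENNReal.ofReal p) volume := by
  have hp0 : 0 < p := by linarith
  set k := dilKer m j
  set K : ℝ≥0∞ := ENNReal.ofReal (∫ x, ‖(𝓕⁻ m : 𝓢(Ed d, ℂ)) x‖)
  have hK : ∫⁻ x, ‖k x‖ₑ = K := by
    rw [← ofReal_integral_norm_eq_lintegral_enorm k.integrable, integral_norm_dilKer]
  have hkm : Measurable fun x => ‖k x‖ₑ := k.continuous.enorm.measurable
  have hk1 : ∀ x, AEMeasurable (fun y => ‖k (x - y)‖ₑ) volume := fun x =>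
    (hkm.comp (measurable_const.sub measurable_id)).aemeasurable
  have hkx : ∀ x, ∫⁻ y, ‖k (x - y)‖ₑ = K := fun x => by
    rw [← hK]
    exact lintegral_sub_left_eq_self (fun y => ‖k y‖ₑ) x
  obtain ⟨q, hpq⟩ : ∃ q, p.HolderConjugate q := ⟨_, Real.HolderConjugate.conjExponent hp⟩
  have hpt : ∀ x, ‖mulOp m j u x‖ₑ ^ p ≤ K ^ (p - 1) * ∫⁻ y, ‖k (x - y)‖ₑ * ‖u y‖ₑ ^ p := fun x => by
    have h1 : ‖mulOp m j u x‖ₑ ≤ ∫⁻ y, ‖k (x - y)‖ₑ ^ (1 / q) * (‖k (x - y)‖ₑ ^ (1 / p) * ‖u y‖ₑ) := by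
      refine (enorm_integral_le_lintegral_enorm _).trans_eq (lintegral_congr fun y => ?_)
      rw [enorm_smul, ← mul_assoc, ← ENNReal.rpow_add_of_nonneg _ _ hpq.symm.one_div_nonneg
        hpq.one_div_nonneg]
      have : 1 / q + 1 / p = 1 := by simpa using hpq.symm.inv_add_inv_eq_one
      rw [this, ENNReal.rpow_one]
    have h2 := h1.trans (ENNReal.lintegral_mul_le_Lp_mul_Lq volume hpq.symm ((hk1 x).pow_const _)
      (((hk1 x).pow_const _).mul hu.enorm))
    refine (ENNReal.rpow_le_rpow h2 hp0.le).trans_eq ?_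
    rw [ENNReal.mul_rpow_of_nonneg _ _ hp0.le, ← ENNReal.rpow_mul, ← ENNReal.rpow_mul,
      one_div_mul_cancel hp0.ne', ENNReal.rpow_one]
    congr 1
    · simp only [← ENNReal.rpow_mul, one_div_mul_cancel hpq.symm.ne_zero, ENNReal.rpow_one, hkx]
      congr 1
      have := hpq.symm.inv_add_inv_eq_one
      have hq := hpq.symm.ne_zero
      field_simp at this ⊢
      linarith
    · refine lintegral_congr fun y => ?_
      simp only [ENNReal.mul_rpow_of_nonneg _ _ hp0.le, ← ENNReal.rpow_mul,
        one_div_mul_cancel hp0.ne', ENNReal.rpow_one]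
  have hp1 : ENNReal.ofReal p ≠ 0 := by simpa using hp0
  rw [← ENNReal.rpow_le_rpow_iff hp0, ENNReal.mul_rpow_of_nonneg _ _ hp0.le,
    eLpNorm_eq_lintegral_rpow_enorm_toReal hp1 ENNReal.ofReal_ne_top,
    eLpNorm_eq_lintegral_rpow_enorm_toReal hp1 ENNReal.ofReal_ne_top, ENNReal.toReal_ofReal hp0.le,
    ← ENNReal.rpow_mul, ← ENNReal.rpow_mul, one_div_mul_cancel hp0.ne', ENNReal.rpow_one,
    ENNReal.rpow_one]
  have hprod : AEMeasurable (fun z : Ed d × Ed d => ‖k (z.1 - z.2)‖ₑ * ‖u z.2‖ₑ ^ p)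
      (volume.prod volume) :=
    (hkm.comp (measurable_fst.sub measurable_snd)).aemeasurable.mul
      ((hu.comp_snd).enorm.pow_const _)
  calc ∫⁻ x, ‖mulOp m j u x‖ₑ ^ p
      ≤ ∫⁻ x, K ^ (p - 1) * ∫⁻ y, ‖k (x - y)‖ₑ * ‖u y‖ₑ ^ p := lintegral_mono hpt
    _ = K ^ (p - 1) * ∫⁻ y, ∫⁻ x, ‖k (x - y)‖ₑ * ‖u y‖ₑ ^ p := by
        rw [lintegral_const_mul'' _ hprod.lintegral_prod_right', lintegral_lintegral_swap hprod]
    _ = K ^ (p - 1) * (K * ∫⁻ y, ‖u y‖ₑ ^ p) := by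
        congr 1
        rw [← lintegral_const_mul'' _ (hu.enorm.pow_const _)]
        refine lintegral_congr fun y => ?_
        have hky : Measurable fun x => ‖k (x - y)‖ₑ :=
          hkm.comp (measurable_id.sub measurable_const)
        rw [lintegral_mul_const _ hky, lintegral_sub_right_eq_self (fun x => ‖k x‖ₑ) y, hK]
    _ = K ^ p * ∫⁻ y, ‖u y‖ₑ ^ p := by
        rw [← mul_assoc]
        congr 1
        conv_lhs => rw [← ENNReal.rpow_one K, ← ENNReal.rpow_mul]
        rw [← ENNReal.rpow_add_of_nonneg _ _ (by linarith) zero_le_one]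
        congr 1
        ring

/-- The annular cut-off `φ(ξ) - φ(2ξ)`. -/
def annulus (φ : 𝓢(Ed d, ℂ)) : 𝓢(Ed d, ℂ) := φ - dil φ (-1)

lemma dil_annulus (φ : 𝓢(Ed d, ℂ)) (j : ℤ) (ξ : Ed d) :
    dil (annulus φ) j ξ = dil φ j ξ - dil φ (j - 1) ξ := by
  rw [dil_apply, annulus, sub_apply, dil_apply, dil_apply, dil_apply, smul_smul,
    ← zpow_add₀ two_ne_zero]
  congr 4
  ring

lemma sum_dil_annulus (φ : 𝓢(Ed d, ℂ)) (k : ℤ) (n : ℕ) (ξ : Ed d) :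
    ∑ l ∈ Finset.range n, dil (annulus φ) (k - l) ξ = dil φ k ξ - dil φ (k - n) ξ := by
  induction n with
  | zero => simp
  | succ n ih =>
    rw [Finset.sum_range_succ, ih, dil_annulus]
    push_cast
    rw [sub_sub k]
    ring

lemma norm_zpow_smul (j : ℤ) (ξ : Ed d) : ‖(2 : ℝ) ^ (-j) • ξ‖ = ‖ξ‖ / 2 ^ j := by
  rw [norm_smul, Real.norm_of_nonneg (by positivity), zpow_neg, inv_mul_eq_div]

lemma dil_eq_one {φ : 𝓢(Ed d, ℂ)} (hφ1 : ∀ ξ, ‖ξ‖ ≤ 1 → φ ξ = 1) {j : ℤ} {ξ : Ed d}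
    (h : ‖ξ‖ ≤ 2 ^ j) : dil φ j ξ = 1 := by
  rw [dil_apply]
  refine hφ1 _ ?_
  rwa [norm_zpow_smul, div_le_one (by positivity)]

lemma dil_eq_zero {φ : 𝓢(Ed d, ℂ)} (hφ0 : ∀ ξ, 2 ≤ ‖ξ‖ → φ ξ = 0) {j : ℤ} {ξ : Ed d}
    (h : 2 ^ (j + 1) ≤ ‖ξ‖) : dil φ j ξ = 0 := by
  rw [dil_apply]
  refine hφ0 _ ?_
  rwa [norm_zpow_smul, le_div_iff₀ (by positivity), ← zpow_one_add₀ two_ne_zero, add_comm]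

lemma dil_annulus_ne_zero {φ : 𝓢(Ed d, ℂ)} (hφ1 : ∀ ξ, ‖ξ‖ ≤ 1 → φ ξ = 1)
    (hφ0 : ∀ ξ, 2 ≤ ‖ξ‖ → φ ξ = 0) {j : ℤ} {ξ : Ed d} (h : dil (annulus φ) j ξ ≠ 0) :
    2 ^ (j - 1) ≤ ‖ξ‖ ∧ ‖ξ‖ ≤ 2 ^ (j + 1) := by
  rw [dil_annulus] at h
  constructor
  · by_contra! h1
    have h2 : (2 : ℝ) ^ (j - 1) ≤ 2 ^ j := zpow_le_zpow_right₀ one_le_two (by omega)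
    rw [dil_eq_one hφ1 h1.le, dil_eq_one hφ1 (h1.le.trans h2), sub_self] at h
    exact h rfl
  · by_contra! h1
    have h2 : (2 : ℝ) ^ (j - 1 + 1) ≤ 2 ^ (j + 1) := zpow_le_zpow_right₀ one_le_two (by omega)
    rw [dil_eq_zero hφ0 h1.le, dil_eq_zero hφ0 (h2.trans h1.le), sub_self] at h
    exact h rfl

lemma dil_zero (m : 𝓢(Ed d, ℂ)) (ξ : Ed d) : dil m 0 ξ = m ξ := by
  simp [dil_apply]

lemma annulus_ne_zero {φ : 𝓢(Ed d, ℂ)} (hφ1 : ∀ ξ, ‖ξ‖ ≤ 1 → φ ξ = 1)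
    (hφ0 : ∀ ξ, 2 ≤ ‖ξ‖ → φ ξ = 0) (ξ : Ed d) (h : annulus φ ξ ≠ 0) :
    1 / 2 ≤ ‖ξ‖ ∧ ‖ξ‖ ≤ 2 := by
  rw [← dil_zero] at h
  have := dil_annulus_ne_zero hφ1 hφ0 h
  norm_num at this
  constructor <;> linarith

lemma conj_annulus {φ : 𝓢(Ed d, ℂ)} (hφ : ∀ ξ, (starRingEnd ℂ) (φ ξ) = φ ξ) (ξ : Ed d) :
    (starRingEnd ℂ) (annulus φ ξ) = annulus φ ξ := by
  rw [annulus, sub_apply, dil_apply, map_sub, hφ, hφ]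

lemma conj_rpow_mul {m θ : 𝓢(Ed d, ℂ)} {a : ℝ} (hm : ∀ ξ, (starRingEnd ℂ) (m ξ) = m ξ)
    (hθ : ∀ ξ, θ ξ = ((‖ξ‖ ^ a : ℝ) : ℂ) * m ξ) (ξ : Ed d) : (starRingEnd ℂ) (θ ξ) = θ ξ := by
  rw [hθ, map_mul, hm, Complex.conj_ofReal]

lemma dil_rpow_mul {m θ : 𝓢(Ed d, ℂ)} {a : ℝ} (hθ : ∀ ξ, θ ξ = ((‖ξ‖ ^ a : ℝ) : ℂ) * m ξ) (j : ℤ)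
    (ξ : Ed d) : (((2 : ℝ) ^ (j * a) : ℝ) : ℂ) * dil θ j ξ = ((‖ξ‖ ^ a : ℝ) : ℂ) * dil m j ξ := by
  rw [dil_apply, hθ, dil_apply, norm_zpow_smul, Real.div_rpow (norm_nonneg _) (by positivity),
    ← Real.rpow_intCast, ← Real.rpow_mul two_pos.le, ← mul_assoc, ← Complex.ofReal_mul,
    mul_div_cancel₀ _ (by positivity)]

/-- The Schwartz function with Fourier transform `|ξ|^s (φ(2^{-k} ξ) - φ(2^{n-k} ξ)) û(ξ)`, where
`θ(ξ) = |ξ|^s (φ(ξ) - φ(2ξ))`. -/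
def rieszS (s : ℝ) (θ : 𝓢(Ed d, ℂ)) (k : ℤ) (n : ℕ) (u : 𝓢(Ed d, ℂ)) : 𝓢(Ed d, ℂ) :=
  ∑ l ∈ Finset.range n, (((2 : ℝ) ^ (((k - l : ℤ) : ℝ) * s) : ℝ) : ℂ) • mulS θ (k - l) u

lemma fourier_rieszS {s : ℝ} {φ θ : 𝓢(Ed d, ℂ)}
    (hθ : ∀ ξ, θ ξ = ((‖ξ‖ ^ s : ℝ) : ℂ) * annulus φ ξ) (k : ℤ) (n : ℕ) (u : 𝓢(Ed d, ℂ)) (ξ : Ed d) :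
    (𝓕 (rieszS s θ k n u) : 𝓢(Ed d, ℂ)) ξ =
      ((‖ξ‖ ^ s : ℝ) : ℂ) * ((dil φ k ξ - dil φ (k - n) ξ) * (𝓕 u : 𝓢(Ed d, ℂ)) ξ) := by
  rw [rieszS, fourier_sum_apply, ← sum_dil_annulus, Finset.sum_mul, Finset.mul_sum]
  refine Finset.sum_congr rfl fun l _ => ?_
  rw [fourier_smul_apply, fourier_mulS, ← mul_assoc, ← mul_assoc, dil_rpow_mul hθ]

end littlewoodPaley

section littlewoodPaleyBounds

variable {d : ℕ}

lemma fourierInv_sub_apply {h k : Ed d → ℂ} (hh : Integrable h) (hk : Integrable k) (x : Ed d) :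
    𝓕⁻ (fun ξ => h ξ - k ξ) x = 𝓕⁻ h x - 𝓕⁻ k x := by
  have hE : Continuous fun v : Ed d => Complex.exp (↑(2 * Real.pi * inner ℝ v x) * Complex.I) := by
    fun_prop
  have key : ∀ {u : Ed d → ℂ}, Integrable u →
      Integrable fun v => Complex.exp (↑(2 * Real.pi * inner ℝ v x) * Complex.I) • u v := fun hu =>
    hu.bdd_smul (C := 1) hE.aestronglyMeasurable (Eventually.of_forall fun v => by
      rw [Complex.norm_exp_ofReal_mul_I])
  simp only [Real.fourierInv_eq']
  rw [← integral_sub (key hh) (key hk)]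
  simp only [smul_sub]

lemma continuous_fourierInv {h : Ed d → ℂ} (hh : Integrable h) : Continuous (𝓕⁻ h) := by
  have : 𝓕⁻ h = fun x => ∫ v, Complex.exp (↑(2 * Real.pi * inner ℝ v x) * Complex.I) • h v := by
    funext x
    rw [Real.fourierInv_eq']
  rw [this]
  refine continuous_of_dominated (bound := fun v => ‖h v‖) (fun x => ?_) (fun x => ?_) hh.norm ?_
  · have hE : Continuous fun v : Ed d => Complex.exp (↑(2 * Real.pi * inner ℝ v x) * Complex.I) := by
      fun_prop
    exact hE.aestronglyMeasurable.smul hh.aestronglyMeasurable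
  · exact Eventually.of_forall fun v => by rw [norm_smul, Complex.norm_exp_ofReal_mul_I, one_mul]
  · exact Eventually.of_forall fun v => by fun_prop

lemma integrable_riesz {s : ℝ} (hs : 0 ≤ s) (u : 𝓢(Ed d, ℂ)) :
    Integrable fun ξ => ((‖ξ‖ ^ s : ℝ) : ℂ) * 𝓕 (⇑u) ξ := by
  rw [← SchwartzMap.fourier_coe]
  exact integrable_rpow_norm_mul _ hs

lemma integrable_dil_mul (m : 𝓢(Ed d, ℂ)) (j : ℤ) {h : Ed d → ℂ} (hh : Integrable h) :
    Integrable fun ξ => dil m j ξ * h ξ := by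
  obtain ⟨C, _, hC, _⟩ := exists_decay (dil m j) 0
  exact hh.bdd_mul (c := C) (dil m j).continuous.aestronglyMeasurable
    (Eventually.of_forall fun ξ => by simpa using hC ξ)

/-- Each `rieszS` is a difference of two smooth truncations of `|D|^s u`. -/
lemma rieszS_apply {s : ℝ} (hs : 0 ≤ s) {φ θ : 𝓢(Ed d, ℂ)}
    (hθ : ∀ ξ, θ ξ = ((‖ξ‖ ^ s : ℝ) : ℂ) * annulus φ ξ) (k : ℤ) (n : ℕ) (u : 𝓢(Ed d, ℂ)) (x : Ed d) :
    rieszS s θ k n u x = mulOp φ k (rieszF s u) x - mulOp φ (k - n) (rieszF s u) x := by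
  have hi := integrable_riesz hs u
  rw [apply_eq_fourierInv, rieszF, mulOp_fourierInv _ _ hi, mulOp_fourierInv _ _ hi,
    ← fourierInv_sub_apply (integrable_dil_mul _ _ hi) (integrable_dil_mul _ _ hi)]
  refine congrArg (fun h : Ed d → ℂ => 𝓕⁻ h x) (funext fun ξ => ?_)
  rw [fourier_rieszS hθ, SchwartzMap.fourier_coe]
  ring

lemma continuous_mulOp (m : 𝓢(Ed d, ℂ)) (j : ℤ) {h : Ed d → ℂ} (hh : Integrable h) :
    Continuous (mulOp m j (𝓕⁻ h)) := by
  have : mulOp m j (𝓕⁻ h) = 𝓕⁻ fun ξ => dil m j ξ * h ξ := funext (mulOp_fourierInv m j hh)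
  rw [this]
  exact continuous_fourierInv (integrable_dil_mul m j hh)

theorem exists_eLpNorm_ell2_annulus_le (hd : 1 ≤ d) {s : ℝ} (hs : 0 ≤ s) {φ : 𝓢(Ed d, ℂ)}
    (hφ : ∀ ξ, (starRingEnd ℂ) (φ ξ) = φ ξ) (hφ1 : ∀ ξ, ‖ξ‖ ≤ 1 → φ ξ = 1)
    (hφ0 : ∀ ξ, 2 ≤ ‖ξ‖ → φ ξ = 0) {p : ℝ} (hp : 1 < p) :
    ∃ C : ℝ≥0∞, C ≠ ∞ ∧ ∀ (J : Finset ℤ) (g : 𝓢(Ed d, ℂ)),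
      eLpNorm (ell2 J fun j x => (((2 : ℝ) ^ (j * s) : ℝ) : ℂ) * mulS (annulus φ) j g x)
        (ENNReal.ofReal p) volume ≤ C * eLpNorm (rieszF s g) (ENNReal.ofReal p) volume := by
  have hann := annulus_ne_zero hφ1 hφ0
  obtain ⟨θ, hθ⟩ := exists_rpow_norm_mul _ hann s
  obtain ⟨q, hq⟩ := exists_rpow_norm_mul _ hann (-s)
  have hq_ann : ∀ ξ, q ξ ≠ 0 → 1 / 2 ≤ ‖ξ‖ ∧ ‖ξ‖ ≤ 2 := fun ξ hξ => hann ξ fun h => hξ (by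
    rw [hq, h, mul_zero])
  obtain ⟨M₀, hM₀⟩ := exists_sum_dil_le q hq_ann
  obtain ⟨C, hC, hbd⟩ := exists_eLpNorm_ell2_mulOp_le hd q (conj_rpow_mul (conj_annulus hφ) hq) hM₀ hp
  set B : ℝ≥0∞ := ENNReal.ofReal (∫ x, ‖(𝓕⁻ φ : 𝓢(Ed d, ℂ)) x‖)
  refine ⟨C * (B + B), by finiteness, fun J g => ?_⟩
  obtain ⟨M, hM⟩ : ∃ M : ℕ, ∀ j ∈ J, -(M : ℤ) ≤ j ∧ j ≤ M := by
    refine ⟨J.sup Int.natAbs, fun j hj => ?_⟩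
    have : j.natAbs ≤ J.sup Int.natAbs := Finset.le_sup (f := Int.natAbs) hj
    omega
  set G := rieszS s θ (M + 1) (2 * M + 3) g
  have hell : (ell2 J fun j x => (((2 : ℝ) ^ (j * s) : ℝ) : ℂ) * mulS (annulus φ) j g x) =
      ell2 J fun j => mulOp q j G := by
    funext x
    ext ⟨j, hj⟩
    rw [ell2_apply, ell2_apply, ← mulS_apply]
    have hS : (((2 : ℝ) ^ (j * s) : ℝ) : ℂ) • mulS (annulus φ) j g = mulS q j G := by
      refine eq_of_fourier_eq fun ξ => ?_
      rw [fourier_smul_apply, fourier_mulS, fourier_mulS, fourier_rieszS hθ]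
      by_cases h0 : dil (annulus φ) j ξ = 0
      · have : dil q j ξ = 0 := by
          have := dil_rpow_mul hq j ξ
          rw [h0, mul_zero, mul_eq_zero, Complex.ofReal_eq_zero] at this
          exact this.resolve_left (by positivity)
        rw [h0, this]
        ring
      · obtain ⟨h1, h2⟩ := dil_annulus_ne_zero hφ1 hφ0 h0
        obtain ⟨h3, h4⟩ := hM j hj
        have hξ : 0 < ‖ξ‖ := lt_of_lt_of_le (by positivity) h1
        have e1 : dil φ (M + 1) ξ = 1 :=
          dil_eq_one hφ1 (h2.trans (zpow_le_zpow_right₀ one_le_two (by omega)))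
        have e2 : dil φ (M + 1 - (2 * M + 3 : ℕ)) ξ = 0 :=
          dil_eq_zero hφ0 ((zpow_le_zpow_right₀ one_le_two (by push_cast; omega)).trans h1)
        rw [e1, e2, sub_zero, one_mul, ← mul_assoc, ← mul_assoc]
        congr 1
        have h5 := dil_rpow_mul hq j ξ
        have h6 : (((2 : ℝ) ^ (j * s) : ℝ) : ℂ) * (((2 : ℝ) ^ (j * -s) : ℝ) : ℂ) = 1 := by
          rw [← Complex.ofReal_mul, ← Real.rpow_add two_pos]
          simp
        have h7 : ((‖ξ‖ ^ s : ℝ) : ℂ) * ((‖ξ‖ ^ (-s) : ℝ) : ℂ) = 1 := by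
          rw [← Complex.ofReal_mul, ← Real.rpow_add hξ]
          simp
        calc _ = ((2 : ℝ) ^ (j * s) : ℝ) * (((‖ξ‖ ^ s : ℝ) : ℂ) *
              (((‖ξ‖ ^ (-s) : ℝ) : ℂ) * dil (annulus φ) j ξ)) := by
              rw [← mul_assoc ((‖ξ‖ ^ s : ℝ) : ℂ), h7, one_mul]
          _ = (((2 : ℝ) ^ (j * s) : ℝ) * (((2 : ℝ) ^ (j * -s) : ℝ) : ℂ)) * (dil q j ξ *
              ((‖ξ‖ ^ s : ℝ) : ℂ)) := by
              rw [← h5]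
              ring
          _ = _ := by rw [h6, one_mul]
    rw [← hS]
    simp
  have hR : AEStronglyMeasurable (rieszF s g) volume :=
    (continuous_fourierInv (integrable_riesz hs g)).aestronglyMeasurable
  have hG : ⇑G = mulOp φ (M + 1) (rieszF s g) - mulOp φ (M + 1 - (2 * M + 3 : ℕ)) (rieszF s g) :=
    funext fun x => rieszS_apply hs hθ _ _ g x
  have hp1 : 1 ≤ ENNReal.ofReal p := by
    rw [← ENNReal.ofReal_one]
    exact ENNReal.ofReal_le_ofReal hp.le
  rw [hell, mul_assoc]
  refine (hbd J G G.continuous G.integrable).trans (mul_le_mul_right ?_ _)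
  rw [hG, add_mul]
  refine (eLpNorm_sub_le (continuous_mulOp φ _ (integrable_riesz hs g)).aestronglyMeasurable
    (continuous_mulOp φ _ (integrable_riesz hs g)).aestronglyMeasurable hp1).trans ?_
  exact add_le_add (eLpNorm_mulOp_le φ _ hR hp) (eLpNorm_mulOp_le φ _ hR hp)

lemma tendsto_dil_zero {φ : 𝓢(Ed d, ℂ)} (hφ0 : ∀ ξ, 2 ≤ ‖ξ‖ → φ ξ = 0) {ξ : Ed d} (hξ : ξ ≠ 0)
    (k : ℤ) : Tendsto (fun n : ℕ => dil φ (k - n) ξ) atTop (nhds 0) := by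
  have hlim : Tendsto (fun n : ℕ => (2 : ℝ) ^ (k + 1) * (1 / 2) ^ n) atTop (nhds 0) := by
    simpa using (tendsto_pow_atTop_nhds_zero_of_lt_one (by norm_num : (0 : ℝ) ≤ 1 / 2)
      (by norm_num)).const_mul ((2 : ℝ) ^ (k + 1))
  refine tendsto_const_nhds.congr' ?_
  filter_upwards [hlim.eventually (gt_mem_nhds (norm_pos_iff.2 hξ))] with n hn
  refine (dil_eq_zero hφ0 ?_).symm
  refine le_of_eq_of_le ?_ hn.le
  rw [show k - n + 1 = k + 1 - (n : ℤ) by ring, zpow_sub₀ two_ne_zero, zpow_natCast]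
  simp [div_eq_mul_inv]

lemma tendsto_dil_one {φ : 𝓢(Ed d, ℂ)} (hφ1 : ∀ ξ, ‖ξ‖ ≤ 1 → φ ξ = 1) (ξ : Ed d) :
    Tendsto (fun n : ℕ => dil φ n ξ) atTop (nhds 1) := by
  refine tendsto_const_nhds.congr' ?_
  have h := tendsto_pow_atTop_atTop_of_one_lt (one_lt_two : (1 : ℝ) < 2)
  filter_upwards [h.eventually (eventually_ge_atTop ‖ξ‖)] with n hn
  exact (dil_eq_one hφ1 (by rwa [zpow_natCast])).symm

lemma tendsto_rieszS {s : ℝ} (hs : 0 < s) {φ θ : 𝓢(Ed d, ℂ)} (hφb : ∀ ξ, ‖φ ξ‖ ≤ 1)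
    (hφ1 : ∀ ξ, ‖ξ‖ ≤ 1 → φ ξ = 1) (hφ0 : ∀ ξ, 2 ≤ ‖ξ‖ → φ ξ = 0)
    (hθ : ∀ ξ, θ ξ = ((‖ξ‖ ^ s : ℝ) : ℂ) * annulus φ ξ) {k : ℤ} {u : 𝓢(Ed d, ℂ)}
    (hu : ∀ ξ, 2 ^ k ≤ ‖ξ‖ → (𝓕 u : 𝓢(Ed d, ℂ)) ξ = 0) (x : Ed d) :
    Tendsto (fun n => rieszS s θ k n u x) atTop (nhds (rieszF s u x)) := by
  simp only [apply_eq_fourierInv (rieszS s θ k _ u), rieszF]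
  have hb := ((integrable_riesz hs.le u).norm.const_mul 2)
  refine tendsto_fourierInv hb (fun n => (SchwartzMap.continuous _).aestronglyMeasurable)
    (fun n => Eventually.of_forall fun ξ => ?_) (Eventually.of_forall fun ξ => ?_) x
  · rw [fourier_rieszS hθ, SchwartzMap.fourier_coe, mul_left_comm, norm_mul]
    gcongr
    refine (norm_sub_le _ _).trans ?_
    have h1 := hφb ((2 : ℝ) ^ (-k) • ξ)
    have h2 := hφb ((2 : ℝ) ^ (-(k - n)) • ξ)
    rw [← dil_apply] at h1 h2
    linarith
  · simp only [fourier_rieszS hθ, ← SchwartzMap.fourier_coe]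
    rcases eq_or_ne ξ 0 with rfl | hξ
    · simp [Real.zero_rpow hs.ne']
    refine Tendsto.const_mul _ ?_
    have h1 := ((tendsto_dil_zero hφ0 hξ k).const_sub (dil φ k ξ)).mul_const
      ((𝓕 u : 𝓢(Ed d, ℂ)) ξ)
    convert h1 using 2
    rcases le_or_gt (2 ^ k) ‖ξ‖ with h2 | h2
    · rw [hu ξ h2, mul_zero]
    · rw [dil_eq_one hφ1 h2.le, sub_zero, one_mul]

theorem exists_eLpNorm_sum_rieszF_le (hd : 1 ≤ d) {s : ℝ} (hs : 0 < s) {p : ℝ} (hp : 1 < p) :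
    ∃ C : ℝ≥0∞, C ≠ ∞ ∧ ∀ (J : Finset ℤ) (u : ℤ → 𝓢(Ed d, ℂ)),
      (∀ j ξ, 2 ^ (j + 2) ≤ ‖ξ‖ → (𝓕 (u j) : 𝓢(Ed d, ℂ)) ξ = 0) →
      eLpNorm (fun x => ∑ j ∈ J, rieszF s (u j) x) (ENNReal.ofReal p) volume ≤
        C * eLpNorm (ell2 J fun j x => (((2 : ℝ) ^ (j * s) : ℝ) : ℂ) * u j x)
          (ENNReal.ofReal p) volume := by
  obtain ⟨φ, hφ, hφb, hφ1, hφ0⟩ := exists_bump d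
  have hann := annulus_ne_zero hφ1 hφ0
  obtain ⟨θ, hθ⟩ := exists_rpow_norm_mul _ hann s
  have hθ_ann : ∀ ξ, θ ξ ≠ 0 → 1 / 2 ≤ ‖ξ‖ ∧ ‖ξ‖ ≤ 2 := fun ξ hξ => hann ξ fun h => hξ (by
    rw [hθ, h, mul_zero])
  obtain ⟨M₀, hM₀⟩ := exists_sum_dil_le θ hθ_ann
  obtain ⟨C, hC, hbd⟩ := exists_eLpNorm_sum_mulOp_le hd θ (conj_rpow_mul (conj_annulus hφ) hθ) hM₀ hp
  have hp1 : 1 ≤ ENNReal.ofReal p := by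
    rw [← ENNReal.ofReal_one]
    exact ENNReal.ofReal_le_ofReal hp.le
  set c : ℕ → ℝ := fun l => (2 : ℝ) ^ (((2 - l : ℤ) : ℝ) * s) with hc
  have hcpos : ∀ l, 0 ≤ c l := fun l => by positivity
  have hsum : Summable c := by
    have h1 : c = fun l : ℕ => (2 : ℝ) ^ (2 * s) * ((2 : ℝ) ^ (-s)) ^ l := by
      funext l
      rw [hc, ← Real.rpow_natCast, ← Real.rpow_mul two_pos.le, ← Real.rpow_add two_pos]
      push_cast
      ring_nf
    rw [h1]
    exact (summable_geometric_of_lt_one (by positivity)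
      (Real.rpow_lt_one_of_one_lt_of_neg one_lt_two (by linarith))).mul_left _
  refine ⟨ENNReal.ofReal (∑' l, c l) * C, by finiteness, fun J u hu => ?_⟩
  set U : ℤ → Ed d → ℂ := fun j x => (((2 : ℝ) ^ (j * s) : ℝ) : ℂ) * u j x
  have hUc : ∀ j, Continuous (U j) := fun j => continuous_const.mul (u j).continuous
  have hUi : ∀ j, Integrable (U j) := fun j => (u j).integrable.const_mul _
  set F : ℕ → Ed d → ℂ := fun l x => ∑ j ∈ J, mulOp θ (j + (2 - l)) (U j) x
  have hmulU : ∀ j k x, mulOp θ k (U j) x = (((2 : ℝ) ^ (j * s) : ℝ) : ℂ) * mulS θ k (u j) x :=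
    fun j k x => by
      rw [mulS_apply, mulOp, mulOp, ← integral_const_mul]
      refine integral_congr_ae (Eventually.of_forall fun y => ?_)
      simp only [U, smul_eq_mul]
      ring
  have hFc : ∀ l, Continuous (F l) := fun l => by
    refine continuous_finsetSum _ fun j _ => ?_
    rw [show mulOp θ (j + (2 - l)) (U j) = _ from funext (hmulU j (j + (2 - l)))]
    exact continuous_const.mul (SchwartzMap.continuous _)
  have hid : ∀ n x, ∑ l ∈ Finset.range n, (c l : ℂ) * F l x =
      ∑ j ∈ J, rieszS s θ (j + 2) n (u j) x := fun n x => by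
    simp only [F, Finset.mul_sum]
    rw [Finset.sum_comm]
    refine Finset.sum_congr rfl fun j _ => ?_
    rw [rieszS, sum_apply]
    refine Finset.sum_congr rfl fun l _ => ?_
    rw [hmulU, smul_apply, smul_eq_mul, ← mul_assoc, ← Complex.ofReal_mul, hc,
      ← Real.rpow_add two_pos, add_sub_assoc]
    congr 4
    push_cast
    ring
  refine eLpNorm_le_of_tendsto (f := fun n x => ∑ l ∈ Finset.range n, (c l : ℂ) * F l x)
    (c := fun _ => ENNReal.ofReal (∑' l, c l) * C * eLpNorm (ell2 J U) (ENNReal.ofReal p) volume)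
    (fun n => ?_) (fun x => ?_) (fun n => ?_) tendsto_const_nhds
  · exact (continuous_finsetSum _ fun l _ =>
      continuous_const.mul (hFc l)).aestronglyMeasurable
  · simp only [hid]
    exact tendsto_finsetSum _ fun j _ => tendsto_rieszS hs hφb hφ1 hφ0 hθ (hu j) x
  · have h1 : (fun x => ∑ l ∈ Finset.range n, (c l : ℂ) * F l x) =
        ∑ l ∈ Finset.range n, (c l : ℂ) • F l := by
      funext x
      simp [Finset.sum_apply]
    rw [h1]
    refine (eLpNorm_sum_le (fun l _ => ((hFc l).const_smul _).aestronglyMeasurable) hp1).trans ?_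
    have h2 : ∀ l ∈ Finset.range n, eLpNorm ((c l : ℂ) • F l) (ENNReal.ofReal p) volume ≤
        ENNReal.ofReal (c l) * (C * eLpNorm (ell2 J U) (ENNReal.ofReal p) volume) := fun l _ => by
      rw [eLpNorm_const_smul, ← ofReal_norm, Complex.norm_real, Real.norm_of_nonneg (hcpos l)]
      gcongr
      exact hbd J (2 - l) U hUc hUi
    refine (Finset.sum_le_sum h2).trans ?_
    rw [← Finset.sum_mul, ← ENNReal.ofReal_sum_of_nonneg fun l _ => hcpos l, mul_assoc]
    gcongr
    exact hsum.sum_le_tsum _ fun l _ => hcpos l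

end littlewoodPaleyBounds

section paraproducts

variable {d : ℕ}

lemma mulS_annulus (φ : 𝓢(Ed d, ℂ)) (j : ℤ) (f : 𝓢(Ed d, ℂ)) (x : Ed d) :
    mulS (annulus φ) j f x = mulS φ j f x - mulS φ (j - 1) f x := by
  have : mulS (annulus φ) j f = mulS φ j f - mulS φ (j - 1) f := eq_of_fourier_eq fun ξ => by
    rw [fourier_sub_apply, fourier_mulS, fourier_mulS, fourier_mulS, dil_annulus, sub_mul]
  rw [this, sub_apply]

lemma norm_ell2_mul_le (J : Finset ℤ) {a u : ℤ → Ed d → ℂ} {x : Ed d} {A : ℝ} (hA : 0 ≤ A)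
    (h : ∀ j ∈ J, ‖a j x‖ ≤ A) : ‖ell2 J (fun j x => a j x * u j x) x‖ ≤ A * ‖ell2 J u x‖ := by
  rw [EuclideanSpace.norm_eq, EuclideanSpace.norm_eq, ← Real.sqrt_sq hA, ← Real.sqrt_mul (sq_nonneg A),
    Finset.mul_sum]
  refine Real.sqrt_le_sqrt (Finset.sum_le_sum fun j _ => ?_)
  rw [ell2_apply, ell2_apply, norm_mul, mul_pow]
  gcongr
  exact h j j.2

lemma eLpNorm_ell2_mulS_mul_le (φ f : 𝓢(Ed d, ℂ)) {J K : Finset ℤ} {σ : ℤ → ℤ} (hσ : ∀ j ∈ J, σ j ∈ K)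
    {a : ℤ → Ed d → ℂ} (ha : ∀ j, Continuous (a j)) {p q r : ℝ≥0∞} [ENNReal.HolderTriple p q r] :
    eLpNorm (ell2 J fun j x => mulS φ (σ j) f x * a j x) r volume ≤
      eLpNorm (fun x (k : K) => mulOp φ k f x) p volume * eLpNorm (ell2 J a) q volume := by
  have hc : Continuous fun x (k : K) => mulOp φ k f x := continuous_pi fun k => by
    rw [← coe_mulS]
    exact SchwartzMap.continuous _
  have h1 : ∀ x, ‖ell2 J (fun j x => mulS φ (σ j) f x * a j x) x‖ ≤
      ‖(‖fun k : K => mulOp φ k f x‖ * ‖ell2 J a x‖ : ℝ)‖ := fun x => by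
    rw [Real.norm_of_nonneg (by positivity)]
    refine norm_ell2_mul_le J (norm_nonneg _) fun j hj => ?_
    rw [mulS_apply]
    exact norm_le_pi_norm (fun k : K => mulOp φ k f x) ⟨σ j, hσ j hj⟩
  refine (eLpNorm_mono h1).trans ?_
  have h2 := eLpNorm_le_eLpNorm_mul_eLpNorm_of_nnnorm (r := r) (p := p) (q := q)
    (μ := (volume : Measure (Ed d)))
    hc.norm.aestronglyMeasurable (continuous_ell2 J ha).norm.aestronglyMeasurable
    (fun x y : ℝ => x * y) 1 (Eventually.of_forall fun x => by rw [nnnorm_mul, one_mul])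
  simpa only [ENNReal.coe_one, one_mul, eLpNorm_norm] using h2

/-- The frequency-localised increments of the product `f g`. -/
def prodIncr (φ f g : 𝓢(Ed d, ℂ)) (j : ℤ) : 𝓢(Ed d, ℂ) :=
  schMul (mulS φ j f) (mulS φ j g) - schMul (mulS φ (j - 1) f) (mulS φ (j - 1) g)

lemma sum_prodIncr (φ f g : 𝓢(Ed d, ℂ)) (N : ℕ) :
    ∑ j ∈ Finset.Ioc (-N : ℤ) N, prodIncr φ f g j =
      schMul (mulS φ N f) (mulS φ N g) - schMul (mulS φ (-N) f) (mulS φ (-N) g) := by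
  have key : ∀ (a : ℤ) (n : ℕ), ∑ j ∈ Finset.Ioc a (a + n), prodIncr φ f g j =
      schMul (mulS φ (a + n) f) (mulS φ (a + n) g) - schMul (mulS φ a f) (mulS φ a g) := by
    intro a n
    induction n with
    | zero => simp
    | succ n ih =>
      have h1 : Finset.Ioc a (a + (n + 1 : ℕ)) = insert (a + (n + 1 : ℕ)) (Finset.Ioc a (a + n)) := by
        ext j
        simp only [Finset.mem_Ioc, Finset.mem_insert]
        push_cast
        omega
      rw [h1, Finset.sum_insert (by simp), ih, prodIncr]
      have h2 : a + (n + 1 : ℕ) - 1 = a + n := by push_cast; ring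
      rw [h2]
      abel
  have h := key (-N) (2 * N)
  have h1 : (-N : ℤ) + (2 * N : ℕ) = N := by push_cast; ring
  rwa [h1] at h

lemma fourier_prodIncr_eq_zero {φ : 𝓢(Ed d, ℂ)} (hφ0 : ∀ ξ, 2 ≤ ‖ξ‖ → φ ξ = 0)
    (f g : 𝓢(Ed d, ℂ)) (j : ℤ) (ξ : Ed d) (hξ : 2 ^ (j + 2) ≤ ‖ξ‖) :
    (𝓕 (prodIncr φ f g j) : 𝓢(Ed d, ℂ)) ξ = 0 := by
  have key : ∀ k ≤ j, (𝓕 (schMul (mulS φ k f) (mulS φ k g)) : 𝓢(Ed d, ℂ)) ξ = 0 := fun k hk => by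
    rw [fourier_schMul]
    refine (integral_congr_ae (Eventually.of_forall fun t => ?_)).trans (integral_zero _ _)
    simp only [fourier_mulS]
    have hξ' : (2 : ℝ) ^ (k + 1) + 2 ^ (k + 1) ≤ ‖ξ‖ := by
      rw [← two_mul, ← zpow_one_add₀ two_ne_zero]
      exact (zpow_le_zpow_right₀ one_le_two (by omega)).trans hξ
    rcases le_or_gt (2 ^ (k + 1)) ‖t‖ with h | h
    · rw [dil_eq_zero hφ0 h]
      ring
    · have h1 : ‖ξ‖ ≤ ‖t‖ + ‖ξ - t‖ := by simpa using norm_add_le t (ξ - t)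
      rw [dil_eq_zero hφ0 (show 2 ^ (k + 1) ≤ ‖ξ - t‖ by linarith)]
      ring
  rw [prodIncr, fourier_sub_apply, key j le_rfl, key (j - 1) (by omega), sub_zero]

lemma prodIncr_apply (φ f g : 𝓢(Ed d, ℂ)) (j : ℤ) (x : Ed d) :
    prodIncr φ f g j x =
      mulS φ (j - 1) f x * mulS (annulus φ) j g x + mulS φ j g x * mulS (annulus φ) j f x := by
  rw [prodIncr, sub_apply, schMul_apply, schMul_apply, mulS_annulus, mulS_annulus]
  ring

theorem exists_eLpNorm_sum_rieszF_prodIncr_le (hd : 1 ≤ d) {s : ℝ} (hs : 0 < s) {φ : 𝓢(Ed d, ℂ)}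
    (hφ : ∀ ξ, (starRingEnd ℂ) (φ ξ) = φ ξ) (hφ1 : ∀ ξ, ‖ξ‖ ≤ 1 → φ ξ = 1)
    (hφ0 : ∀ ξ, 2 ≤ ‖ξ‖ → φ ξ = 0) {p p₂ p₃ : ℝ} {r₁ r₄ : ℝ≥0∞} (hp : 1 < p) (hp₂ : 1 < p₂)
    (hp₃ : 1 < p₃) (hr₁ : 1 < r₁) (hr₄ : 1 < r₄)
    [ENNReal.HolderTriple r₁ (ENNReal.ofReal p₂) (ENNReal.ofReal p)]
    [ENNReal.HolderTriple r₄ (ENNReal.ofReal p₃) (ENNReal.ofReal p)] :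
    ∃ C : ℝ≥0∞, C ≠ ∞ ∧ ∀ (N : ℕ) (f g : 𝓢(Ed d, ℂ)),
      eLpNorm (fun x => ∑ j ∈ Finset.Ioc (-N : ℤ) N, rieszF s (prodIncr φ f g j) x)
        (ENNReal.ofReal p) volume ≤
      C * (eLpNorm f r₁ volume * eLpNorm (rieszF s g) (ENNReal.ofReal p₂) volume +
        eLpNorm (rieszF s f) (ENNReal.ofReal p₃) volume * eLpNorm g r₄ volume) := by
  obtain ⟨C₀, hC₀, h₀⟩ := exists_eLpNorm_sum_rieszF_le hd hs hp
  obtain ⟨C₁, hC₁, h₁⟩ := exists_eLpNorm_sup_mulOp_le hd φ hr₁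
  obtain ⟨C₂, hC₂, h₂⟩ := exists_eLpNorm_ell2_annulus_le hd hs.le hφ hφ1 hφ0 hp₂
  obtain ⟨C₃, hC₃, h₃⟩ := exists_eLpNorm_ell2_annulus_le hd hs.le hφ hφ1 hφ0 hp₃
  obtain ⟨C₄, hC₄, h₄⟩ := exists_eLpNorm_sup_mulOp_le hd φ hr₄
  have hp1 : 1 ≤ ENNReal.ofReal p := by
    rw [← ENNReal.ofReal_one]
    exact ENNReal.ofReal_le_ofReal hp.le
  refine ⟨C₀ * (C₁ * C₂ + C₄ * C₃), by finiteness, fun N f g => ?_⟩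
  set J := Finset.Ioc (-N : ℤ) N
  set K := Finset.Icc (-N : ℤ) N
  set a : 𝓢(Ed d, ℂ) → ℤ → Ed d → ℂ :=
    fun u j x => (((2 : ℝ) ^ (j * s) : ℝ) : ℂ) * mulS (annulus φ) j u x
  have ha : ∀ u j, Continuous (a u j) := fun u j => continuous_const.mul (SchwartzMap.continuous _)
  have hb1 : ∀ j, Continuous fun x => mulS φ (j - 1) f x * a g j x := fun j =>
    (SchwartzMap.continuous _).mul (ha g j)
  have hb2 : ∀ j, Continuous fun x => mulS φ j g x * a f j x := fun j =>
    (SchwartzMap.continuous _).mul (ha f j)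
  have hsplit : (ell2 J fun j x => (((2 : ℝ) ^ (j * s) : ℝ) : ℂ) * prodIncr φ f g j x) =
      (ell2 J fun j x => mulS φ (j - 1) f x * a g j x) + ell2 J fun j x => mulS φ j g x * a f j x := by
    funext x
    ext j
    rw [Pi.add_apply, PiLp.add_apply, ell2_apply, ell2_apply, ell2_apply, prodIncr_apply]
    simp only [a]
    ring
  have hJ1 : ∀ j ∈ J, j - 1 ∈ K := fun j hj => by
    simp only [J, K, Finset.mem_Ioc, Finset.mem_Icc] at hj ⊢
    omega
  have hJ2 : ∀ j ∈ J, j ∈ K := fun j hj => by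
    simp only [J, K, Finset.mem_Ioc, Finset.mem_Icc] at hj ⊢
    omega
  refine (h₀ J (prodIncr φ f g) (fourier_prodIncr_eq_zero hφ0 f g)).trans ?_
  rw [mul_assoc]
  gcongr
  rw [hsplit]
  refine (eLpNorm_add_le (continuous_ell2 J hb1).aestronglyMeasurable
    (continuous_ell2 J hb2).aestronglyMeasurable hp1).trans ?_
  set X := eLpNorm f r₁ volume * eLpNorm (rieszF s g) (ENNReal.ofReal p₂) volume
  set Y := eLpNorm (rieszF s f) (ENNReal.ofReal p₃) volume * eLpNorm g r₄ volume
  have t1 : eLpNorm (ell2 J fun j x => mulS φ (j - 1) f x * a g j x) (ENNReal.ofReal p) volume ≤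
      C₁ * C₂ * X := by
    refine (eLpNorm_ell2_mulS_mul_le (p := r₁) (q := ENNReal.ofReal p₂) φ f hJ1 (ha g)).trans ?_
    refine (mul_le_mul' (h₁ K f f.continuous f.integrable) (h₂ J g)).trans_eq ?_
    simp only [X]
    ring
  have t2 : eLpNorm (ell2 J fun j x => mulS φ j g x * a f j x) (ENNReal.ofReal p) volume ≤
      C₄ * C₃ * Y := by
    refine (eLpNorm_ell2_mulS_mul_le (σ := id) (p := r₄) (q := ENNReal.ofReal p₃) φ g hJ2
      (ha f)).trans ?_
    refine (mul_le_mul' (h₄ K g g.continuous g.integrable) (h₃ J f)).trans_eq ?_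
    simp only [Y]
    ring
  calc _ ≤ C₁ * C₂ * X + C₄ * C₃ * Y := add_le_add t1 t2
    _ ≤ (C₁ * C₂ + C₄ * C₃) * X + (C₁ * C₂ + C₄ * C₃) * Y := by
        gcongr
        · exact le_self_add
        · exact le_add_self
    _ = _ := by rw [mul_add]

lemma rieszF_sub {s : ℝ} (hs : 0 ≤ s) (u v : 𝓢(Ed d, ℂ)) (x : Ed d) :
    rieszF s (u - v : 𝓢(Ed d, ℂ)) x = rieszF s u x - rieszF s v x := by
  rw [rieszF, rieszF, rieszF, ← fourierInv_sub_apply (integrable_riesz hs u) (integrable_riesz hs v)]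
  refine congrArg (fun h : Ed d → ℂ => 𝓕⁻ h x) (funext fun ξ => ?_)
  rw [← SchwartzMap.fourier_coe, fourier_sub_apply, mul_sub]
  simp only [SchwartzMap.fourier_coe]

lemma rieszF_sum {s : ℝ} (hs : 0 ≤ s) (J : Finset ℤ) (u : ℤ → 𝓢(Ed d, ℂ)) (x : Ed d) :
    rieszF s (∑ j ∈ J, u j : 𝓢(Ed d, ℂ)) x = ∑ j ∈ J, rieszF s (u j) x := by
  induction J using Finset.induction_on with
  | empty =>
    have h := rieszF_sub hs 0 0 x
    rw [sub_self, sub_self] at h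
    simpa using h
  | insert j J hj ih =>
    rw [Finset.sum_insert hj, Finset.sum_insert hj, ← ih]
    have h := rieszF_sub hs (u j + ∑ j ∈ J, u j) (∑ j ∈ J, u j) x
    rw [add_sub_cancel_right] at h
    rw [h]
    ring

lemma rieszF_zero (u : 𝓢(Ed d, ℂ)) : rieszF 0 u = u := by
  funext x
  rw [apply_eq_fourierInv u x, rieszF]
  simp only [Real.rpow_zero, Complex.ofReal_one, one_mul, SchwartzMap.fourier_coe]

theorem exists_eLpNorm_rieszF_schMul_le (hd : 1 ≤ d) {s : ℝ} (hs : 0 < s)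
    {p p₂ p₃ : ℝ} {r₁ r₄ : ℝ≥0∞} (hp : 1 < p) (hp₂ : 1 < p₂)
    (hp₃ : 1 < p₃) (hr₁ : 1 < r₁) (hr₄ : 1 < r₄)
    [ENNReal.HolderTriple r₁ (ENNReal.ofReal p₂) (ENNReal.ofReal p)]
    [ENNReal.HolderTriple r₄ (ENNReal.ofReal p₃) (ENNReal.ofReal p)] :
    ∃ C : ℝ≥0∞, C ≠ ∞ ∧ ∀ f g : 𝓢(Ed d, ℂ),
      eLpNorm (rieszF s (schMul f g)) (ENNReal.ofReal p) volume ≤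
      C * (eLpNorm f r₁ volume * eLpNorm (rieszF s g) (ENNReal.ofReal p₂) volume +
        eLpNorm (rieszF s f) (ENNReal.ofReal p₃) volume * eLpNorm g r₄ volume) := by
  obtain ⟨φ, hφ, hφb, hφ1, hφ0⟩ := exists_bump d
  obtain ⟨C, hC, h⟩ := exists_eLpNorm_sum_rieszF_prodIncr_le hd hs hφ hφ1 hφ0 hp hp₂ hp₃ hr₁ hr₄
  refine ⟨C, hC, fun f g => ?_⟩
  have : NeZero d := ⟨by omega⟩
  have : Nontrivial (Ed d) := inferInstance
  have hne : ∀ᵐ ξ : Ed d, ξ ≠ 0 := by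
    rw [ae_iff]
    simp
  have hle : ∀ (u : 𝓢(Ed d, ℂ)) (k : ℤ) ξ,
      ‖(𝓕 (mulS φ k u) : 𝓢(Ed d, ℂ)) ξ‖ ≤ ‖(𝓕 u : 𝓢(Ed d, ℂ)) ξ‖ := fun u k ξ => by
    rw [fourier_mulS, norm_mul]
    exact mul_le_of_le_one_left (norm_nonneg _) (hφb _)
  have hone : ∀ u : 𝓢(Ed d, ℂ), ∀ᵐ ξ, Tendsto (fun n : ℕ => (𝓕 (mulS φ n u) : 𝓢(Ed d, ℂ)) ξ) atTop
      (nhds (1 * (𝓕 u : 𝓢(Ed d, ℂ)) ξ)) := fun u => Eventually.of_forall fun ξ => by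
    simp only [fourier_mulS]
    exact (tendsto_dil_one hφ1 ξ).mul_const _
  have hzero : ∀ u : 𝓢(Ed d, ℂ), ∀ᵐ ξ, Tendsto (fun n : ℕ => (𝓕 (mulS φ (-n) u) : 𝓢(Ed d, ℂ)) ξ)
      atTop (nhds (0 * (𝓕 u : 𝓢(Ed d, ℂ)) ξ)) := fun u => hne.mono fun ξ hξ => by
    simp only [fourier_mulS]
    have := tendsto_dil_zero hφ0 hξ 0
    simp only [zero_sub] at this
    exact this.mul_const _
  refine eLpNorm_le_of_tendsto
    (f := fun (N : ℕ) x => ∑ j ∈ Finset.Ioc (-N : ℤ) N, rieszF s (prodIncr φ f g j) x)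
    (fun N => ?_) (fun x => ?_) (fun N => h N f g) tendsto_const_nhds
  · exact (continuous_finsetSum _ fun j _ =>
      continuous_fourierInv (integrable_riesz hs.le _)).aestronglyMeasurable
  · simp only [← rieszF_sum hs.le, sum_prodIncr, rieszF_sub hs.le]
    have h1 := tendsto_rieszF_schMul hs.le (fun n => hle f n) (fun n => hle g n) (hone f) (hone g) x
    have h0 := tendsto_rieszF_schMul hs.le (fun n => hle f (-n)) (fun n => hle g (-n))
      (hzero f) (hzero g) x
    simpa using h1.sub h0

end paraproducts

end harmonicAnalysis

/-- Homogeneous Kato–Ponce inequality. For `d ≥ 1`, `s ≥ 0`, `1 < r < ∞` and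
`1/r = 1/r₁ + 1/r₂ = 1/r₃ + 1/r₄` with `r₂, r₃ ∈ (1,∞)` and `r₁, r₄ ∈ (1,∞]`, there is
`C > 0` such that for all Schwartz `f, g`:
`‖|D|^s(fg)‖_{L^r} ≤ C(‖f‖_{L^{r₁}}‖|D|^s g‖_{L^{r₂}} + ‖|D|^s f‖_{L^{r₃}}‖g‖_{L^{r₄}})`. -/
theorem kato_ponce_homogeneous
    (d : ℕ) (hd : 1 ≤ d) (s : ℝ) (hs : 0 ≤ s) (r r₁ r₂ r₃ r₄ : ℝ≥0∞)
    (hr : 1 < r) (hr' : r < ∞)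
    (hr₁ : 1 < r₁) (hr₂ : 1 < r₂) (hr₂' : r₂ < ∞)
    (hr₃ : 1 < r₃) (hr₃' : r₃ < ∞) (hr₄ : 1 < r₄)
    (hsum1 : 1 / r = 1 / r₁ + 1 / r₂) (hsum2 : 1 / r = 1 / r₃ + 1 / r₄) :
    ∃ C : ℝ, 0 < C ∧
      ∀ f g : SchwartzMap (Ed d) ℂ,
        eLpNorm (rieszD d s (fun x => f x * g x)) r volume ≤
          ENNReal.ofReal C *
            (eLpNorm (fun x => f x) r₁ volume *
                eLpNorm (rieszD d s (fun x => g x)) r₂ volume +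
              eLpNorm (rieszD d s (fun x => f x)) r₃ volume *
                eLpNorm (fun x => g x) r₄ volume) := by
  have key : ∃ C : ℝ≥0∞, C ≠ ∞ ∧ ∀ f g : SchwartzMap (Ed d) ℂ,
      eLpNorm (rieszF s (schMul f g)) r volume ≤
        C * (eLpNorm f r₁ volume * eLpNorm (rieszF s g) r₂ volume +
          eLpNorm (rieszF s f) r₃ volume * eLpNorm g r₄ volume) := by
    simp only [one_div] at hsum1 hsum2
    have i1 : ENNReal.HolderTriple r₁ r₂ r := ⟨hsum1.symm⟩
    have i2 : ENNReal.HolderTriple r₄ r₃ r := ⟨by rw [add_comm, hsum2]⟩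
    rcases hs.eq_or_lt with rfl | hs0
    · refine ⟨1, by finiteness, fun f g => ?_⟩
      rw [rieszF_zero, rieszF_zero, rieszF_zero, one_mul]
      refine le_trans ?_ le_self_add
      have h := eLpNorm_le_eLpNorm_mul_eLpNorm_of_nnnorm (r := r) (p := r₁) (q := r₂)
        (μ := (volume : Measure (Ed d))) f.continuous.aestronglyMeasurable
        g.continuous.aestronglyMeasurable (fun x y : ℂ => x * y) 1
        (Eventually.of_forall fun x => by rw [nnnorm_mul, one_mul])
      rw [ENNReal.coe_one, one_mul] at h
      exact h
    · have toReal_of : ∀ q : ℝ≥0∞, 1 < q → q < ∞ → ∃ p : ℝ, 1 < p ∧ q = ENNReal.ofReal p :=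
        fun q h1 h2 => ⟨q.toReal, by
          rwa [← ENNReal.toReal_one, ENNReal.toReal_lt_toReal ENNReal.one_ne_top h2.ne],
          (ENNReal.ofReal_toReal h2.ne).symm⟩
      obtain ⟨p, hp, rfl⟩ := toReal_of r hr hr'
      obtain ⟨p₂, hp₂, rfl⟩ := toReal_of r₂ hr₂ hr₂'
      obtain ⟨p₃, hp₃, rfl⟩ := toReal_of r₃ hr₃ hr₃'
      exact exists_eLpNorm_rieszF_schMul_le hd hs0 hp hp₂ hp₃ hr₁ hr₄
  obtain ⟨C, hC, h⟩ := key
  refine ⟨C.toReal + 1, by positivity, fun f g => ?_⟩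
  have hscale : ∀ (u : Ed d → ℂ) (q : ℝ≥0∞), eLpNorm (rieszD d s u) q volume =
      ‖(((2 * Real.pi) ^ s : ℝ) : ℂ)‖ₑ * eLpNorm (rieszF s u) q volume := fun u q => by
    rw [rieszD_eq, ← eLpNorm_const_smul]
    rfl
  have hCle : C ≤ ENNReal.ofReal (C.toReal + 1) := by
    rw [← ENNReal.ofReal_toReal hC]
    exact ENNReal.ofReal_le_ofReal (by simp)
  rw [hscale, hscale, hscale]
  set c := ‖(((2 * Real.pi) ^ s : ℝ) : ℂ)‖ₑ
  calc c * eLpNorm (rieszF s (schMul f g)) r volume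
      ≤ c * (ENNReal.ofReal (C.toReal + 1) * (eLpNorm f r₁ volume * eLpNorm (rieszF s g) r₂ volume +
          eLpNorm (rieszF s f) r₃ volume * eLpNorm g r₄ volume)) := by
        gcongr
        exact (h f g).trans (mul_le_mul_left hCle _)
    _ = _ := by ring
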